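/- There is a constant c > 0 such that for all signs s₁, s₂, s₃ ∈ {+1,−1} and all ℂ²-valued Schwartz functions ψ, ψ′ on ℝ×ℝ², the null-form bilinear estimate ‖⟨β Π_{s₁}(D)ψ, Π_{s₂}(D)ψ′⟩_{ℂ²}‖_{X^{−1/2,−1/3,∞}_{s₃}} ≤ c ‖ψ‖_{X^{0,1/3,1}_{s₁}} ‖ψ′‖_{X^{0,1/3,1}_{s₂}} holds, where Π_s(D) is the space–time Fourier multiplier (Π_s(D)ψ)~(τ,ξ) = Π_s(ξ) ψ̃(τ,ξ) and ⟨·,·⟩_{ℂ²} is the Hermitian inner product on ℂ² applied pointwise. -/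

import Mathlib

open MeasureTheory Complex
open scoped RealInnerProductSpace

noncomputable section

/-- ℝ² with the Euclidean norm. -/
abbrev E2 : Type := EuclideanSpace ℝ (Fin 2)

/-- Space-time ℝ × ℝ². -/
abbrev SpaceTime : Type := ℝ × E2

/-- Space–time Fourier transform f̃(τ,ξ). -/
def ftST (f : SpaceTime → ℂ) (τ : ℝ) (ξ : E2) : ℂ :=
  ∫ p : SpaceTime, Complex.exp (-Complex.I * ((p.1 * τ + ⟪p.2, ξ⟫ : ℝ) : ℂ)) * f p

/-- Spatial Fourier transform. -/
def ftX (f : E2 → ℂ) (ξ : E2) : ℂ :=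
  ∫ x : E2, Complex.exp (-Complex.I * ((⟪x, ξ⟫ : ℝ) : ℂ)) * f x

/-- Japanese bracket ⟨x⟩ = (1+x²)^{1/2}. -/
def jap (x : ℝ) : ℝ := Real.sqrt (1 + x ^ 2)

/-- L² norm in the Fourier variables (τ,ξ). -/
def l2F (g : ℝ → E2 → ℂ) : ℝ := Real.sqrt (∫ τ : ℝ, ∫ ξ : E2, ‖g τ ξ‖ ^ 2)

/-- Classical wave-Bourgain norm ‖f‖_{X^{a,b}_s}. -/
def Xnorm (a b s : ℝ) (f : SpaceTime → ℂ) : ℝ :=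
  l2F fun τ ξ => ((jap ‖ξ‖ ^ a * jap (τ + s * ‖ξ‖) ^ b : ℝ) : ℂ) * ftST f τ ξ

/-- The hypotheses on the Littlewood–Paley bump function φ. -/
structure IsLPBump (φ : ℝ → ℝ) : Prop where
  smooth : ContDiff ℝ (⊤ : ℕ∞) φ
  compactSupport : HasCompactSupport φ
  nonneg : ∀ τ, 0 ≤ φ τ
  support_subset : ∀ τ, φ τ ≠ 0 → 1 / 2 ≤ |τ| ∧ |τ| ≤ 2
  pos : ∀ τ, 1 / Real.sqrt 2 ≤ |τ| → |τ| ≤ Real.sqrt 2 → 0 < φ τ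

/-- ∑_{j∈ℤ} φ(2^{−j}τ). -/
def lpSum (φ : ℝ → ℝ) (τ : ℝ) : ℝ := ∑' j : ℤ, φ (τ / 2 ^ j)

/-- The Littlewood–Paley pieces φ̂_k: φ̂_k(τ) = φ(2^{−k}τ)/∑_{j∈ℤ}φ(2^{−j}τ) for k ≥ 1,
    φ̂_0 = 1 − ∑_{k≥1} φ̂_k. -/
def lpPiece (φ : ℝ → ℝ) : ℕ → ℝ → ℝ
  | 0, τ => 1 - ∑' k : ℕ, φ (τ / 2 ^ (k + 1)) / lpSum φ τ
  | k + 1, τ => φ (τ / 2 ^ (k + 1)) / lpSum φ τ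

/-- Bourgain–Besov norm ‖f‖_{X^{a,b,1}_s}. -/
def XnormB (φ : ℝ → ℝ) (a b s : ℝ) (f : SpaceTime → ℂ) : ℝ :=
  ∑' k : ℕ, (2 : ℝ) ^ (b * k) *
    l2F fun τ ξ => ((jap ‖ξ‖ ^ a * lpPiece φ k (τ + s * ‖ξ‖) : ℝ) : ℂ) * ftST f τ ξ

/-- Bourgain–Besov norm ‖f‖_{X^{a,b,∞}_s}. -/
def XnormBinf (φ : ℝ → ℝ) (a b s : ℝ) (f : SpaceTime → ℂ) : ℝ :=
  ⨆ k : ℕ, (2 : ℝ) ^ (b * k) *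
    l2F fun τ ξ => ((jap ‖ξ‖ ^ a * lpPiece φ k (τ + s * ‖ξ‖) : ℝ) : ℂ) * ftST f τ ξ

/-- Mixed norm ‖f‖_{L^q_t L^r_x}. -/
def mixedNorm (q r : ℝ) (f : SpaceTime → ℂ) : ℝ :=
  (∫ t : ℝ, (∫ x : E2, ‖f (t, x)‖ ^ r) ^ (q / r)) ^ (1 / q)

/-- L² norm on the slab [0,T] × ℝ². -/
def l2Slab (T : ℝ) (f : SpaceTime → ℂ) : ℝ :=
  Real.sqrt (∫ t in Set.Icc (0 : ℝ) T, ∫ x : E2, ‖f (t, x)‖ ^ 2)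
/-- ℂ². -/
abbrev C2 : Type := EuclideanSpace ℂ (Fin 2)

/-- α¹ = ((0,1),(1,0)). -/
def alpha1 : Matrix (Fin 2) (Fin 2) ℂ := !![0, 1; 1, 0]

/-- α² = ((0,−i),(i,0)). -/
def alpha2 : Matrix (Fin 2) (Fin 2) ℂ := !![0, -Complex.I; Complex.I, 0]

/-- β = ((1,0),(0,−1)). -/
def betaM : Matrix (Fin 2) (Fin 2) ℂ := !![1, 0; 0, -1]

/-- Π_s(ξ) = ½(I + s(ξ₁α¹ + ξ₂α²)/|ξ|). -/
def diracProj (s : ℝ) (ξ : E2) : Matrix (Fin 2) (Fin 2) ℂ :=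
  (1/2 : ℂ) • (1 + ((s / ‖ξ‖ : ℝ) : ℂ) • ((ξ 0 : ℂ) • alpha1 + (ξ 1 : ℂ) • alpha2))

/-- The space–time Fourier multiplier Π_s(D), with (Π_s(D)ψ)~(τ,ξ) = Π_s(ξ)ψ̃(τ,ξ). -/
def diracProjD (s : ℝ) (ψ : SpaceTime → C2) (p : SpaceTime) : Fin 2 → ℂ := fun i =>
  ((2 * Real.pi) ^ (-3 : ℝ) : ℝ) •
    ∫ τ : ℝ, ∫ ξ : E2, Complex.exp (Complex.I * ((p.1 * τ + ⟪p.2, ξ⟫ : ℝ) : ℂ)) *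
      (diracProj s ξ).mulVec (fun j => ftST (fun q => ψ q j) τ ξ) i

/-- The scalar null form ⟨β Π_{s₁}(D)ψ, Π_{s₂}(D)ψ′⟩_{ℂ²}, with the Hermitian inner
    product of ℂ² applied pointwise. -/
def nullForm (s₁ s₂ : ℝ) (ψ ψ' : SpaceTime → C2) (p : SpaceTime) : ℂ :=
  ∑ i : Fin 2, (starRingEnd ℂ) (betaM.mulVec (diracProjD s₁ ψ p) i) * diracProjD s₂ ψ' p i

/-- Bourgain–Besov norm ‖ψ‖_{X^{a,b,1}_s} of a ℂ²-valued function, with |ψ̃(τ,ξ)| the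
    ℂ²-norm. -/
def XnormBvec (φ : ℝ → ℝ) (a b s : ℝ) (ψ : SpaceTime → C2) : ℝ :=
  ∑' k : ℕ, (2 : ℝ) ^ (b * k) *
    Real.sqrt (∫ τ : ℝ, ∫ ξ : E2,
      (jap ‖ξ‖ ^ a * lpPiece φ k (τ + s * ‖ξ‖)) ^ 2 * ∑ i : Fin 2, ‖ftST (fun q => ψ q i) τ ξ‖ ^ 2)

lemma IsLPBump.zpow_le {φ : ℝ → ℝ} (hφ : IsLPBump φ) {τ : ℝ} {j : ℤ} (h : φ (τ / 2 ^ j) ≠ 0) :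
    (2 : ℝ) ^ j ≤ 2 * |τ| ∧ |τ| ≤ 2 * 2 ^ j := by
  have h2 : (0 : ℝ) < 2 ^ j := by positivity
  have := hφ.support_subset _ h
  rw [abs_div, abs_of_pos h2, div_le_iff₀ h2, le_div_iff₀ h2] at this
  constructor <;> linarith [this.1, this.2]

lemma IsLPBump.summable_zpow {φ : ℝ → ℝ} (hφ : IsLPBump φ) (τ : ℝ) :
    Summable fun j : ℤ => φ (τ / 2 ^ j) := by
  refine summable_of_hasFiniteSupport ?_
  change (Function.support fun j : ℤ => φ (τ / 2 ^ j)).Finite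
  by_cases hne : (Function.support fun j : ℤ => φ (τ / 2 ^ j)).Nonempty
  · obtain ⟨i, hi⟩ := hne
    have key : ∀ j k : ℤ, φ (τ / 2 ^ j) ≠ 0 → φ (τ / 2 ^ k) ≠ 0 → j ≤ k + 2 := by
      intro j k hj hk
      have h1 := (hφ.zpow_le hj).1
      have h2 := (hφ.zpow_le hk).2
      have h3 : (2 : ℝ) ^ j ≤ 2 ^ (k + 2) := by
        rw [zpow_add₀ (by norm_num)]; norm_num; linarith
      exact (zpow_le_zpow_iff_right₀ (by norm_num : (1 : ℝ) < 2)).1 h3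
    apply (Set.finite_Icc (i - 2) (i + 2)).subset
    intro j hj
    exact ⟨by linarith [key i j hi hj], key j i hj hi⟩
  · rw [Set.not_nonempty_iff_eq_empty.1 hne]; exact Set.finite_empty

lemma IsLPBump.lpSum_nonneg {φ : ℝ → ℝ} (hφ : IsLPBump φ) (τ : ℝ) : 0 ≤ lpSum φ τ :=
  tsum_nonneg fun _ => hφ.nonneg _

lemma IsLPBump.lpSum_pos {φ : ℝ → ℝ} (hφ : IsLPBump φ) {τ : ℝ} (hτ : τ ≠ 0) : 0 < lpSum φ τ := by
  have ha : 0 < |τ| * Real.sqrt 2 := by positivity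
  have h2 : Real.sqrt 2 * Real.sqrt 2 = 2 := Real.mul_self_sqrt (by norm_num)
  have hs : 0 < Real.sqrt 2 := by positivity
  obtain ⟨n, hn⟩ := exists_mem_Ico_zpow (y := (2 : ℝ)) ha (by norm_num)
  have hp : (0 : ℝ) < 2 ^ n := by positivity
  have hn2 : |τ| * Real.sqrt 2 < 2 ^ n * 2 := by
    have := hn.2; rwa [zpow_add_one₀ (by norm_num)] at this
  have : 0 < φ (τ / 2 ^ n) := by
    apply hφ.pos
    · rw [abs_div, abs_of_pos hp, div_le_div_iff₀ hs hp]; linarith [hn.1]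
    · rw [abs_div, abs_of_pos hp, div_le_iff₀ hp]
      have : |τ| * Real.sqrt 2 ≤ (Real.sqrt 2 * 2 ^ n) * Real.sqrt 2 := by nlinarith
      exact le_of_mul_le_mul_right this hs
  exact (hφ.summable_zpow τ).tsum_pos (fun _ => hφ.nonneg _) n this

lemma IsLPBump.summable_nat {φ : ℝ → ℝ} (hφ : IsLPBump φ) (τ : ℝ) :
    Summable fun k : ℕ => φ (τ / 2 ^ (k + 1)) := by
  have hinj : Function.Injective fun k : ℕ => ((k + 1 : ℕ) : ℤ) := by
    intro a b h; simpa using h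
  have := (hφ.summable_zpow τ).comp_injective hinj
  refine this.congr fun k => ?_
  simp only [Function.comp_apply, zpow_natCast]

lemma IsLPBump.tsum_nat_le {φ : ℝ → ℝ} (hφ : IsLPBump φ) (τ : ℝ) :
    ∑' k : ℕ, φ (τ / 2 ^ (k + 1)) ≤ lpSum φ τ := by
  have hinj : Function.Injective fun k : ℕ => ((k + 1 : ℕ) : ℤ) := by
    intro a b h; simpa using h
  refine (hφ.summable_nat τ).tsum_le_tsum_of_inj _ hinj (fun _ _ => hφ.nonneg _) (fun k => ?_)
    (hφ.summable_zpow τ)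
  simp only [zpow_natCast, le_refl]

lemma IsLPBump.hasSum_lpPiece {φ : ℝ → ℝ} (hφ : IsLPBump φ) (τ : ℝ) :
    HasSum (fun k => lpPiece φ k τ) 1 := by
  rw [← hasSum_nat_add_iff' 1]
  have h : Summable fun k : ℕ => lpPiece φ (k + 1) τ :=
    (hφ.summable_nat τ).div_const (lpSum φ τ)
  have h1 : (1 : ℝ) - ∑ i ∈ Finset.range 1, lpPiece φ i τ = ∑' k : ℕ, lpPiece φ (k + 1) τ := by
    rw [Finset.sum_range_one]
    simp only [lpPiece, sub_sub_cancel]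
  rw [h1]
  exact h.hasSum

lemma IsLPBump.lpPiece_nonneg {φ : ℝ → ℝ} (hφ : IsLPBump φ) (k : ℕ) (τ : ℝ) :
    0 ≤ lpPiece φ k τ := by
  cases k with
  | zero =>
    simp only [lpPiece]
    rw [tsum_div_const]
    have := div_le_one_of_le₀ (hφ.tsum_nat_le τ) (hφ.lpSum_nonneg τ)
    linarith
  | succ k => exact div_nonneg (hφ.nonneg _) (hφ.lpSum_nonneg τ)

lemma IsLPBump.lpPiece_le_one {φ : ℝ → ℝ} (hφ : IsLPBump φ) (k : ℕ) (τ : ℝ) :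
    lpPiece φ k τ ≤ 1 :=
  le_hasSum (hφ.hasSum_lpPiece τ) k fun _ _ => hφ.lpPiece_nonneg _ _

lemma IsLPBump.abs_le_of_lpPiece_ne_zero {φ : ℝ → ℝ} (hφ : IsLPBump φ) {k : ℕ} {τ : ℝ}
    (h : lpPiece φ k τ ≠ 0) : |τ| ≤ 2 ^ (k + 1) := by
  cases k with
  | zero =>
    by_contra! hlt
    apply h
    have h0 : τ ≠ 0 := by rintro rfl; norm_num at hlt
    have hinj : Function.Injective fun k : ℕ => ((k + 1 : ℕ) : ℤ) := by
      intro a b h; simpa using h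
    have : ∑' k : ℕ, φ (τ / 2 ^ (k + 1)) = lpSum φ τ := by
      unfold lpSum
      rw [← hinj.tsum_eq (f := fun j : ℤ => φ (τ / 2 ^ j))]
      · simp only [zpow_natCast]
      · intro j hj
        have h1 := (hφ.zpow_le hj).2
        have h2 : (2 : ℝ) ^ (0 : ℤ) < 2 ^ j := by simp only [zpow_zero]; norm_num at hlt; linarith
        have h3 : 0 < j := (zpow_lt_zpow_iff_right₀ (by norm_num : (1 : ℝ) < 2)).1 h2
        exact ⟨(j - 1).toNat, by simp; omega⟩
    simp only [lpPiece]
    rw [tsum_div_const, this, div_self (hφ.lpSum_pos h0).ne', sub_self]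
  | succ k =>
    have h1 : φ (τ / 2 ^ (k + 1)) ≠ 0 := by
      intro h0; apply h; simp [lpPiece, h0]
    have := (hφ.zpow_le (j := ((k + 1 : ℕ) : ℤ)) (by rwa [zpow_natCast])).2
    rw [zpow_natCast] at this
    rw [pow_succ]; linarith

lemma IsLPBump.le_abs_of_lpPiece_ne_zero {φ : ℝ → ℝ} (hφ : IsLPBump φ) {k : ℕ} {τ : ℝ}
    (h : lpPiece φ k τ ≠ 0) : (2 : ℝ) ^ k ≤ 2 * (1 + |τ|) := by
  cases k with
  | zero => have := abs_nonneg τ; norm_num; linarith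
  | succ k =>
    have h1 : φ (τ / 2 ^ (k + 1)) ≠ 0 := by
      intro h0; apply h; simp [lpPiece, h0]
    have := (hφ.zpow_le (j := ((k + 1 : ℕ) : ℤ)) (by rwa [zpow_natCast])).1
    rw [zpow_natCast] at this
    linarith

lemma measurable_tsum_of_nonneg {ι α : Type*} [Countable ι] [MeasurableSpace α] {f : ι → α → ℝ}
    (hf : ∀ i, Measurable (f i)) (h0 : ∀ i x, 0 ≤ f i x) (hs : ∀ x, Summable fun i => f i x) :
    Measurable fun x => ∑' i, f i x := by
  have : (fun x => ∑' i, f i x) = fun x => (∑' i, ENNReal.ofReal (f i x)).toReal := by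
    ext x
    rw [← ENNReal.ofReal_tsum_of_nonneg (fun i => h0 i x) (hs x),
      ENNReal.toReal_ofReal (tsum_nonneg fun i => h0 i x)]
  rw [this]
  exact (Measurable.tsum fun i => (hf i).ennreal_ofReal).ennreal_toReal

lemma IsLPBump.measurable_lpPiece {φ : ℝ → ℝ} (hφ : IsLPBump φ) (k : ℕ) :
    Measurable (lpPiece φ k) := by
  have hm : Measurable φ := hφ.smooth.continuous.measurable
  have hS : Measurable (lpSum φ) :=
    measurable_tsum_of_nonneg (fun j => hm.comp (measurable_id.div_const _))
      (fun _ _ => hφ.nonneg _) hφ.summable_zpow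
  have hk : ∀ k : ℕ, Measurable fun τ => φ (τ / 2 ^ (k + 1)) / lpSum φ τ := fun k =>
    (hm.comp (measurable_id.div_const _)).div hS
  cases k with
  | zero =>
    exact measurable_const.sub (measurable_tsum_of_nonneg hk
      (fun k τ => div_nonneg (hφ.nonneg _) (hφ.lpSum_nonneg τ))
      (fun τ => (hφ.summable_nat τ).div_const _))
  | succ k => exact hk k

theorem Complex.norm_cosh_sub_one (μ ν : ℝ) :
    ‖Complex.cosh (μ + ν * Complex.I) - 1‖ = Real.cosh μ - Real.cos ν := by
  have h1 : 0 ≤ Real.cosh μ - Real.cos ν := by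
    linarith [Real.one_le_cosh μ, Real.cos_le_one ν]
  rw [← Real.sqrt_sq h1, Complex.norm_def]
  congr 1
  rw [Complex.cosh_add, Complex.cosh_mul_I, Complex.sinh_mul_I, Complex.normSq_apply]
  have e1 : Complex.cosh μ * Complex.cos ν + Complex.sinh μ * (Complex.sin ν * Complex.I) - 1
      = ⟨Real.cosh μ * Real.cos ν - 1, Real.sinh μ * Real.sin ν⟩ := by
    apply Complex.ext <;> simp [Complex.cosh_ofReal_re, Complex.sinh_ofReal_re, Complex.cos_ofReal_re,
      Complex.sin_ofReal_re]
  rw [e1]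
  have h2 := Real.cosh_sq μ
  have h3 := Real.sin_sq_add_cos_sq ν
  simp only
  have h4 : Real.sin ν ^ 2 = 1 - Real.cos ν ^ 2 := by linarith
  have h5 : Real.sinh μ ^ 2 = Real.cosh μ ^ 2 - 1 := by linarith
  have : Real.sinh μ * Real.sin ν * (Real.sinh μ * Real.sin ν)
    = Real.sinh μ ^ 2 * Real.sin ν ^ 2 := by ring
  rw [this, h4, h5]; ring

theorem Complex.norm_cosh_add_one (μ ν : ℝ) :
    ‖Complex.cosh (μ + ν * Complex.I) + 1‖ = Real.cosh μ + Real.cos ν := by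
  have h := Complex.norm_cosh_sub_one μ (ν + Real.pi)
  have e : (μ + ((ν + Real.pi : ℝ) : ℂ) * Complex.I) = (μ + ν * Complex.I) + Real.pi * Complex.I := by
    push_cast; ring
  rw [e, Complex.cosh_add, Complex.cosh_mul_I, Complex.sinh_mul_I, Complex.cos_pi, Complex.sin_pi,
    Real.cos_add_pi] at h
  have e2 : Complex.cosh (μ + ν * Complex.I) * -1 + Complex.sinh (μ + ν * Complex.I) * (0 * Complex.I) - 1
    = -(Complex.cosh (μ + ν * Complex.I) + 1) := by ring
  rw [e2, norm_neg] at h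
  rw [h]; ring

/-- The half strip on which `cosh` is injective. -/
def halfStrip : Set ℂ := {ζ | 0 < ζ.re ∧ -Real.pi < ζ.im ∧ ζ.im < Real.pi}

theorem measurableSet_halfStrip : MeasurableSet halfStrip :=
  (measurableSet_lt measurable_const Complex.measurable_re).inter
    ((measurableSet_lt measurable_const Complex.measurable_im).inter
      (measurableSet_lt Complex.measurable_im measurable_const))

theorem injOn_cosh_halfStrip : Set.InjOn Complex.cosh halfStrip := by
  rintro ζ ⟨h1, h2, h3⟩ ω ⟨g1, g2, g3⟩ h
  rw [← Complex.cos_mul_I, ← Complex.cos_mul_I, Complex.cos_eq_cos_iff] at h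
  obtain ⟨k, hk⟩ := h
  have hpi := Real.pi_pos
  rcases hk with hk | hk
  · have hre := congrArg Complex.re hk
    have him := congrArg Complex.im hk
    simp at hre him
    have hk0 : k = 0 := by
      have h4 : (k : ℝ) < 1 := by
        by_contra hc
        push Not at hc
        nlinarith
      have h5 : (-1 : ℝ) < k := by
        by_contra hc
        push Not at hc
        nlinarith
      have h6 : k < 1 := by exact_mod_cast h4
      have h7 : -1 < k := by exact_mod_cast h5
      omega
    subst hk0
    simp at hre
    exact Complex.ext him.symm (by linarith)
  · have him := congrArg Complex.im hk
    simp at him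
    linarith

theorem exists_halfStrip_cosh_eq {w : ℂ} (hw : w.im ≠ 0) : ∃ ζ ∈ halfStrip, Complex.cosh ζ = w := by
  obtain ⟨ω, hω⟩ := Complex.cos_surjective w
  have key : ∃ ζ : ℂ, 0 ≤ ζ.re ∧ Complex.cosh ζ = w := by
    rcases le_total 0 (ω * Complex.I).re with h | h
    · exact ⟨ω * Complex.I, h, by rw [Complex.cosh_mul_I, hω]⟩
    · exact ⟨-(ω * Complex.I), by simpa using h, by rw [Complex.cosh_neg, Complex.cosh_mul_I, hω]⟩
  obtain ⟨ζ, hre, hζ⟩ := key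
  have hper : ∀ n : ℤ, Complex.cosh (ζ - n * (2 * Real.pi) * Complex.I) = w := by
    intro n
    rw [← hζ, ← Complex.cos_mul_I, ← Complex.cos_mul_I, Complex.cos_eq_cos_iff]
    refine ⟨-n, Or.inl ?_⟩
    push_cast
    linear_combination (n : ℂ) * 2 * Real.pi * Complex.I_sq
  have hmem := toIocMod_mem_Ioc Real.two_pi_pos (-Real.pi) ζ.im
  set n := toIocDiv Real.two_pi_pos (-Real.pi) ζ.im with hn
  have hmod : toIocMod Real.two_pi_pos (-Real.pi) ζ.im = ζ.im - n * (2 * Real.pi) := by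
    rw [toIocMod, zsmul_eq_mul]
  rw [hmod] at hmem
  set ξ := ζ - n * (2 * Real.pi) * Complex.I with hξ
  have hξre : ξ.re = ζ.re := by simp [hξ]
  have hξim : ξ.im = ζ.im - n * (2 * Real.pi) := by simp [hξ]
  have hc : Complex.cosh ξ = w := hper n
  have him : w.im = Real.sinh ξ.re * Real.sin ξ.im := by
    rw [← hc]
    conv_lhs => rw [← Complex.re_add_im ξ, Complex.cosh_add, Complex.cosh_mul_I, Complex.sinh_mul_I]
    simp [Complex.cosh_ofReal_re, Complex.sinh_ofReal_re, Complex.cos_ofReal_re,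
      Complex.sin_ofReal_re]
  refine ⟨ξ, ⟨?_, ?_, ?_⟩, hc⟩
  · rcases (hξre ▸ hre : 0 ≤ ξ.re).eq_or_lt with h | h
    · exfalso; apply hw; rw [him, ← h]; simp
    · exact h
  · rw [hξim]; exact hmem.1
  · have h2 : ξ.im ≤ Real.pi := by rw [hξim]; linarith [hmem.2]
    rcases h2.eq_or_lt with h | h
    · exfalso; apply hw; rw [him, h]; simp
    · exact h

theorem volume_complex_im_eq_zero : (volume : Measure ℂ) {z : ℂ | z.im = 0} = 0 := by
  have h := (Complex.volume_preserving_equiv_real_prod).measure_preimage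
    (s := {p : ℝ × ℝ | p.2 = 0}) (measurableSet_eq_fun measurable_snd measurable_const).nullMeasurableSet
  have e : (Complex.measurableEquivRealProd ⁻¹' {p : ℝ × ℝ | p.2 = 0}) = {z : ℂ | z.im = 0} := by
    ext z; simp [Complex.measurableEquivRealProd]
  rw [e] at h
  rw [h]
  have : {p : ℝ × ℝ | p.2 = 0} = Set.univ ×ˢ {(0:ℝ)} := by ext p; simp
  rw [this, Measure.volume_eq_prod, Measure.prod_prod]; simp

/-- Elliptic coordinates with foci `0` and `-N`. -/
theorem lintegral_le_elliptic {N : ℝ} (hN : 0 < N) {G : ℝ → ℝ → ENNReal}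
    (hG : Measurable fun p : ℝ × ℝ => G p.1 p.2) :
    ∫⁻ z : ℂ, G ‖z‖ ‖(N : ℂ) + z‖ ≤
      ∫⁻ μ in Set.Ioi (0 : ℝ), ∫⁻ ν in Set.Ioo (-Real.pi) Real.pi,
        ENNReal.ofReal ((N / 2 * (Real.cosh μ - Real.cos ν)) * (N / 2 * (Real.cosh μ + Real.cos ν))) *
          G (N / 2 * (Real.cosh μ - Real.cos ν)) (N / 2 * (Real.cosh μ + Real.cos ν)) := by
  set f : ℂ → ℂ := fun ζ => (N / 2 : ℂ) * (Complex.cosh ζ - 1) with hf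
  have hN2 : ((N : ℂ) / 2) ≠ 0 := by
    simpa using hN.ne'
  set f' : ℂ → ℂ →L[ℝ] ℂ := fun ζ =>
    ((ContinuousLinearMap.toSpanSingleton ℂ ((N / 2 : ℂ) * Complex.sinh ζ)).restrictScalars ℝ) with hf'
  have hder : ∀ ζ ∈ halfStrip, HasFDerivWithinAt f (f' ζ) halfStrip ζ := by
    intro ζ _
    have h1 : HasDerivAt f ((N / 2 : ℂ) * Complex.sinh ζ) ζ :=
      ((Complex.hasDerivAt_cosh ζ).sub_const 1).const_mul _
    exact (h1.hasFDerivAt.restrictScalars ℝ).hasFDerivWithinAt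
  have hinj : Set.InjOn f halfStrip := by
    intro x hx y hy hxy
    apply injOn_cosh_halfStrip hx hy
    have := mul_left_cancel₀ hN2 hxy
    exact sub_left_injective this
  have hdet : ∀ μ ν : ℝ, |(f' (μ + ν * Complex.I)).det| =
      (N / 2 * (Real.cosh μ - Real.cos ν)) * (N / 2 * (Real.cosh μ + Real.cos ν)) := by
    intro μ ν
    have h1 : (f' (μ + ν * Complex.I)).det =
        Complex.normSq ((N / 2 : ℂ) * Complex.sinh (μ + ν * Complex.I)) := by
      have : (f' (μ + ν * Complex.I)).det = LinearMap.det
        ((LinearMap.mul ℂ ℂ ((N / 2 : ℂ) * Complex.sinh (μ + ν * Complex.I))).restrictScalars ℝ) := by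
        rw [ContinuousLinearMap.det]
        congr 1
        refine LinearMap.ext fun z => ?_
        simp [hf', ContinuousLinearMap.toSpanSingleton, mul_comm]
      rw [this, LinearMap.det_restrictScalars]
      simp [Algebra.norm_complex_apply]
    rw [h1, abs_of_nonneg (Complex.normSq_nonneg _), Complex.normSq_eq_norm_sq, norm_mul, mul_pow]
    have h2 : ‖Complex.sinh (μ + ν * Complex.I)‖ ^ 2 =
        (Real.cosh μ - Real.cos ν) * (Real.cosh μ + Real.cos ν) := by
      rw [← Complex.norm_cosh_sub_one, ← Complex.norm_cosh_add_one, ← norm_mul, ← norm_pow,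
        Complex.sinh_sq]
      congr 1; ring
    rw [h2]
    have h3 : ‖(N / 2 : ℂ)‖ = N / 2 := by
      rw [norm_div, Complex.norm_real, Real.norm_of_nonneg hN.le]; simp
    rw [h3]; ring
  have hnorm1 : ∀ μ ν : ℝ, ‖f (μ + ν * Complex.I)‖ = N / 2 * (Real.cosh μ - Real.cos ν) := by
    intro μ ν
    rw [hf]; simp only
    rw [norm_mul, Complex.norm_cosh_sub_one, norm_div, Complex.norm_real, Real.norm_of_nonneg hN.le]
    simp
  have hnorm2 : ∀ μ ν : ℝ, ‖(N : ℂ) + f (μ + ν * Complex.I)‖ = N / 2 * (Real.cosh μ + Real.cos ν) := by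
    intro μ ν
    have : (N : ℂ) + f (μ + ν * Complex.I) = (N / 2 : ℂ) * (Complex.cosh (μ + ν * Complex.I) + 1) := by
      rw [hf]; ring
    rw [this, norm_mul, Complex.norm_cosh_add_one, norm_div, Complex.norm_real,
      Real.norm_of_nonneg hN.le]
    simp
  have himage : ∀ᵐ z : ℂ, z ∈ f '' halfStrip := by
    have h0 : ∀ᵐ z : ℂ, z.im ≠ 0 := by
      rw [ae_iff]; simpa using volume_complex_im_eq_zero
    filter_upwards [h0] with z hz
    obtain ⟨ζ, h1, h2⟩ := exists_halfStrip_cosh_eq (w := 1 + (N / 2 : ℂ)⁻¹ * z) (by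
      have : (N / 2 : ℂ)⁻¹ = (((N / 2)⁻¹ : ℝ) : ℂ) := by push_cast; rfl
      rw [this]
      simp [hN.ne', hz])
    refine ⟨ζ, h1, ?_⟩
    rw [hf]; simp only
    rw [h2, add_sub_cancel_left, mul_inv_cancel_left₀ hN2]
  have hrest : (volume : Measure ℂ) = volume.restrict (f '' halfStrip) :=
    (Measure.restrict_eq_self_of_ae_mem himage).symm
  rw [hrest, lintegral_image_eq_lintegral_abs_det_fderiv_mul volume measurableSet_halfStrip hder hinj]
  set H : ℝ × ℝ → ENNReal := fun p =>
    ENNReal.ofReal ((N / 2 * (Real.cosh p.1 - Real.cos p.2)) * (N / 2 * (Real.cosh p.1 + Real.cos p.2))) *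
          G (N / 2 * (Real.cosh p.1 - Real.cos p.2)) (N / 2 * (Real.cosh p.1 + Real.cos p.2)) with hH
  have hHm : Measurable H := by
    apply Measurable.mul
    · exact ENNReal.measurable_ofReal.comp (by fun_prop : Measurable fun p : ℝ × ℝ =>
        (N / 2 * (Real.cosh p.1 - Real.cos p.2)) * (N / 2 * (Real.cosh p.1 + Real.cos p.2)))
    · exact hG.comp (by fun_prop :  Measurable fun p : ℝ × ℝ =>
        ((N / 2 * (Real.cosh p.1 - Real.cos p.2)), (N / 2 * (Real.cosh p.1 + Real.cos p.2))))
  have e1 : ∀ ζ : ℂ, ENNReal.ofReal |(f' ζ).det| * G ‖f ζ‖ ‖(N : ℂ) + f ζ‖ =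
      H (Complex.measurableEquivRealProd ζ) := by
    intro ζ
    have hζ : ζ = ζ.re + ζ.im * Complex.I := (Complex.re_add_im ζ).symm
    conv_lhs => rw [hζ]
    rw [hdet, hnorm1, hnorm2]
    simp [hH, Complex.measurableEquivRealProd]
  simp_rw [e1]
  have e2 : halfStrip = Complex.measurableEquivRealProd ⁻¹'
      (Set.Ioi (0:ℝ) ×ˢ Set.Ioo (-Real.pi) Real.pi) := by
    ext ζ; simp [halfStrip, Complex.measurableEquivRealProd]
  rw [e2, (Complex.volume_preserving_equiv_real_prod.setLIntegral_comp_preimage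
    (measurableSet_Ioi.prod measurableSet_Ioo) hHm), Measure.volume_eq_prod,
    ← Measure.prod_restrict, lintegral_prod _ hHm.aemeasurable]

/-- Polar coordinates centred at `0` for a function of the distances to `0` and `-N`. -/
theorem lintegral_le_polar {N : ℝ} {G : ℝ → ℝ → ENNReal}
    (hG : Measurable fun p : ℝ × ℝ => G p.1 p.2) :
    ∫⁻ z : ℂ, G ‖z‖ ‖(N : ℂ) + z‖ ≤
      ∫⁻ α in Set.Ioo (-Real.pi) Real.pi, ∫⁻ η in Set.Ioi (0 : ℝ),
        ENNReal.ofReal η * G η (Real.sqrt (η ^ 2 + N ^ 2 + 2 * η * N * Real.cos α)) := by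
  rw [← Complex.lintegral_comp_polarCoord_symm]
  set H : ℝ × ℝ → ENNReal := fun p =>
    ENNReal.ofReal p.1 * G p.1 (Real.sqrt (p.1 ^ 2 + N ^ 2 + 2 * p.1 * N * Real.cos p.2)) with hH
  have hHm : Measurable H := by
    apply Measurable.mul
    · exact ENNReal.measurable_ofReal.comp measurable_fst
    · exact hG.comp (by fun_prop : Measurable fun p : ℝ × ℝ =>
        (p.1, Real.sqrt (p.1 ^ 2 + N ^ 2 + 2 * p.1 * N * Real.cos p.2)))
  have e1 : ∀ p ∈ polarCoord.target, ENNReal.ofReal p.1 •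
      G ‖Complex.polarCoord.symm p‖ ‖(N : ℂ) + Complex.polarCoord.symm p‖ = H p := by
    intro p hp
    have hp1 : 0 < p.1 := by
      simp [polarCoord] at hp; exact hp.1
    have h1 : ‖Complex.polarCoord.symm p‖ = p.1 := by
      rw [Complex.norm_polarCoord_symm, abs_of_pos hp1]
    have h2 : ‖(N : ℂ) + Complex.polarCoord.symm p‖ =
        Real.sqrt (p.1 ^ 2 + N ^ 2 + 2 * p.1 * N * Real.cos p.2) := by
      rw [Complex.norm_def, Complex.normSq_apply]
      congr 1
      rw [Complex.polarCoord_symm_apply]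
      have h3 := Real.sin_sq_add_cos_sq p.2
      simp [Complex.cos_ofReal_re, Complex.sin_ofReal_re]
      linear_combination p.1 ^ 2 * h3
    rw [h1, h2, smul_eq_mul]
  rw [setLIntegral_congr_fun polarCoord.open_target.measurableSet e1]
  have : polarCoord.target = Set.Ioi (0:ℝ) ×ˢ Set.Ioo (-Real.pi) Real.pi := rfl
  rw [this, Measure.volume_eq_prod, ← Measure.prod_restrict, lintegral_prod_symm _ hHm.aemeasurable]

theorem lintegral_plane_eq_complex (a : E2) (G : ℝ → ℝ → ENNReal) :
    ∫⁻ ξ : E2, G ‖ξ‖ ‖a + ξ‖ = ∫⁻ z : ℂ, G ‖z‖ ‖(‖a‖ : ℂ) + z‖ := by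
  set w : ℂ := Complex.orthonormalBasisOneI.repr.symm a with hw
  have hwn : ‖w‖ = ‖a‖ := Complex.orthonormalBasisOneI.repr.symm.norm_map a
  set c : Circle := Circle.exp (Complex.arg w) with hc
  have hcw : (c : ℂ) * (‖a‖ : ℂ) = w := by
    rw [← hwn, hc, Circle.coe_exp, mul_comm]
    exact Complex.norm_mul_exp_arg_mul_I w
  set e : ℂ ≃ₗᵢ[ℝ] E2 := (rotation c).trans Complex.orthonormalBasisOneI.repr with he
  have hea : e (‖a‖ : ℂ) = a := by
    simp only [he, LinearIsometryEquiv.trans_apply, rotation_apply, hcw]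
    exact Complex.orthonormalBasisOneI.repr.apply_symm_apply a
  rw [← e.measurePreserving.lintegral_comp_emb e.toHomeomorph.measurableEmbedding]
  refine lintegral_congr fun z => ?_
  have h1 : ‖a + e z‖ = ‖(‖a‖ : ℂ) + z‖ := by
    conv_lhs => rw [← hea, ← map_add]
    exact e.norm_map _
  rw [h1, e.norm_map]

theorem lintegral_mul_le_sqrt_mul_sqrt {α : Type*} [MeasurableSpace α] {μ : Measure α}
    {f g : α → ENNReal} (hf : AEMeasurable f μ) (hg : AEMeasurable g μ) :
    ∫⁻ a, f a * g a ∂μ ≤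
      (∫⁻ a, f a ^ 2 ∂μ) ^ (1 / 2 : ℝ) * (∫⁻ a, g a ^ 2 ∂μ) ^ (1 / 2 : ℝ) := by
  have h := ENNReal.lintegral_mul_le_Lp_mul_Lq μ (p := 2) (q := 2)
    (Real.HolderConjugate.two_two) hf hg
  simpa [ENNReal.rpow_two] using h

/-- The trilinear form with weight `V ^ (1/2)` depending on the lengths of the three frequencies
`a`, `b`, `-(a + b)`. -/
def trilin (V : ℝ → ℝ → ℝ → ENNReal) (f₀ f₁ f₂ : SpaceTime → ENNReal) : ENNReal :=
  ∫⁻ a : SpaceTime, ∫⁻ b : SpaceTime,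
    V ‖a.2‖ ‖b.2‖ ‖a.2 + b.2‖ ^ (1 / 2 : ℝ) * (f₀ a * (f₁ b * f₂ (-(a + b))))

/-- Joint measurability of a weight. -/
def MeasWeight (V : ℝ → ℝ → ℝ → ENNReal) : Prop :=
  Measurable fun p : ℝ × ℝ × ℝ => V p.1 p.2.1 p.2.2

theorem MeasWeight.comp {V : ℝ → ℝ → ℝ → ENNReal} (hV : MeasWeight V) {α : Type*}
    [MeasurableSpace α] {f g h : α → ℝ} (hf : Measurable f) (hg : Measurable g)
    (hh : Measurable h) : Measurable fun x => V (f x) (g x) (h x) :=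
  Measurable.comp (g := fun p : ℝ × ℝ × ℝ => V p.1 p.2.1 p.2.2) hV
    (hf.prodMk (hg.prodMk hh))

theorem measurable_trilin_integrand {V : ℝ → ℝ → ℝ → ENNReal} (hV : MeasWeight V)
    {f₀ f₁ f₂ : SpaceTime → ENNReal} (h₀ : Measurable f₀) (h₁ : Measurable f₁)
    (h₂ : Measurable f₂) :
    Measurable fun p : SpaceTime × SpaceTime =>
      V ‖p.1.2‖ ‖p.2.2‖ ‖p.1.2 + p.2.2‖ ^ (1 / 2 : ℝ) *
        (f₀ p.1 * (f₁ p.2 * f₂ (-(p.1 + p.2)))) := by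
  refine Measurable.mul ?_ ?_
  · exact (hV.comp (by fun_prop) (by fun_prop) (by fun_prop)).pow_const _
  · exact (h₀.comp measurable_fst).mul ((h₁.comp measurable_snd).mul
      (h₂.comp (by fun_prop)))

theorem trilin_swap_left {V : ℝ → ℝ → ℝ → ENNReal} (hV : MeasWeight V)
    {f₀ f₁ f₂ : SpaceTime → ENNReal} (h₀ : Measurable f₀) (h₁ : Measurable f₁)
    (h₂ : Measurable f₂) :
    trilin V f₀ f₁ f₂ = trilin (fun r₁ r₀ r₂ => V r₀ r₁ r₂) f₁ f₀ f₂ := by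
  unfold trilin
  rw [lintegral_lintegral_swap (measurable_trilin_integrand hV h₀ h₁ h₂).aemeasurable]
  refine lintegral_congr fun b => lintegral_congr fun a => ?_
  rw [add_comm a b, add_comm a.2 b.2]
  ring

instance : (volume : Measure SpaceTime).IsAddLeftInvariant :=
  inferInstanceAs ((volume : Measure ℝ).prod (volume : Measure E2)).IsAddLeftInvariant

instance : (volume : Measure SpaceTime).IsNegInvariant :=
  ⟨((Measure.measurePreserving_neg (volume : Measure ℝ)).prod
    (Measure.measurePreserving_neg (volume : Measure E2))).map_eq⟩

theorem trilin_swap_right (V : ℝ → ℝ → ℝ → ENNReal) (f₀ f₁ f₂ : SpaceTime → ENNReal) :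
    trilin V f₀ f₁ f₂ = trilin (fun r₀ r₂ r₁ => V r₀ r₁ r₂) f₀ f₂ f₁ := by
  unfold trilin
  refine lintegral_congr fun a => ?_
  rw [← lintegral_sub_left_eq_self _ (-a)]
  refine lintegral_congr fun b => ?_
  have e1 : -(a + (-a - b)) = b := by abel
  have e2 : -a - b = -(a + b) := by abel
  have e3 : ‖(-a - b).2‖ = ‖a.2 + b.2‖ := by
    rw [e2, Prod.snd_neg, norm_neg, Prod.snd_add]
  have e4 : ‖a.2 + (-a - b).2‖ = ‖b.2‖ := by
    have : a.2 + (-a - b).2 = -b.2 := by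
      rw [Prod.snd_sub, Prod.snd_neg]; abel
    rw [this, norm_neg]
  rw [e1, e3, e4, e2, mul_comm (f₁ _)]

theorem trilin_mono {V W : ℝ → ℝ → ℝ → ENNReal} {f₀ f₁ f₂ : SpaceTime → ENNReal}
    (h : ∀ a b : SpaceTime, f₀ a ≠ 0 → f₁ b ≠ 0 → f₂ (-(a + b)) ≠ 0 →
      V ‖a.2‖ ‖b.2‖ ‖a.2 + b.2‖ ≤ W ‖a.2‖ ‖b.2‖ ‖a.2 + b.2‖) :
    trilin V f₀ f₁ f₂ ≤ trilin W f₀ f₁ f₂ := by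
  refine lintegral_mono fun a => lintegral_mono fun b => ?_
  by_cases h0 : f₀ a = 0
  · simp [h0]
  by_cases h1 : f₁ b = 0
  · simp [h1]
  by_cases h2 : f₂ (-(a + b)) = 0
  · simp only [h2]; simp
  exact mul_le_mul' (ENNReal.rpow_le_rpow (h a b h0 h1 h2) (by norm_num)) le_rfl

theorem trilin_add_le {V W : ℝ → ℝ → ℝ → ENNReal} (hV : MeasWeight V)
    {f₀ f₁ f₂ : SpaceTime → ENNReal} (h₀ : Measurable f₀) (h₁ : Measurable f₁)
    (h₂ : Measurable f₂) :
    trilin (fun r s t => V r s t + W r s t) f₀ f₁ f₂ ≤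
      trilin V f₀ f₁ f₂ + trilin W f₀ f₁ f₂ := by
  have key : ∀ P Q : SpaceTime × SpaceTime → ENNReal, Measurable P →
      ∫⁻ a, ∫⁻ b, (P (a, b) + Q (a, b)) = (∫⁻ a, ∫⁻ b, P (a, b)) + ∫⁻ a, ∫⁻ b, Q (a, b) := by
    intro P Q hP
    rw [← lintegral_add_left hP.lintegral_prod_right']
    refine lintegral_congr fun a => ?_
    exact lintegral_add_left (hP.comp measurable_prodMk_left) _
  refine le_trans ?_ (key _ (fun p => W ‖p.1.2‖ ‖p.2.2‖ ‖p.1.2 + p.2.2‖ ^ (1 / 2 : ℝ) *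
        (f₀ p.1 * (f₁ p.2 * f₂ (-(p.1 + p.2))))) (measurable_trilin_integrand hV h₀ h₁ h₂)).le
  refine lintegral_mono fun a => lintegral_mono fun b => ?_
  simp only
  rw [← add_mul]
  exact mul_le_mul' (ENNReal.rpow_add_le_add_rpow _ _ (by norm_num) (by norm_num)) le_rfl

theorem ae_snd_ne_zero : ∀ᵐ a : SpaceTime, a.2 ≠ 0 := by
  rw [ae_iff]
  have : {a : SpaceTime | ¬ a.2 ≠ 0} = Set.univ ×ˢ {(0 : E2)} := by ext p; simp
  rw [this, Measure.volume_eq_prod, Measure.prod_prod]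
  simp

/-- `L²` norm with values in `[0, ∞]`. -/
def nrm (f : SpaceTime → ENNReal) : ENNReal := (∫⁻ a, f a ^ 2) ^ (1 / 2 : ℝ)

/-- `f` lives within distance `L` of the cone `τ + ε|ξ| = 0`. -/
def NearCone (ε L : ℝ) (f : SpaceTime → ENNReal) : Prop :=
  ∀ a, f a ≠ 0 → |a.1 + ε * ‖a.2‖| ≤ L

theorem volume_two_slabs_le (u v L M w : ℝ) (hw : w = u + v) :
    ∫⁻ τ : ℝ, (if |τ + u| ≤ L ∧ |-τ + v| ≤ M then (1 : ENNReal) else 0) ≤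
      (if |w| ≤ L + M then 1 else 0) * ENNReal.ofReal (2 * min L M) := by
  split_ifs with h
  · rw [one_mul]
    rcases le_total L M with hLM | hLM
    · calc _ ≤ ∫⁻ τ : ℝ, (Set.Icc (-L - u) (L - u)).indicator 1 τ := by
            refine lintegral_mono fun τ => ?_
            split_ifs with h1
            · have := abs_le.1 h1.1
              rw [Set.indicator_of_mem]
              · simp
              · exact ⟨by linarith, by linarith⟩
            · exact zero_le
        _ ≤ _ := by
            rw [lintegral_indicator_one measurableSet_Icc, Real.volume_Icc, min_eq_left hLM]
            exact ENNReal.ofReal_le_ofReal (by linarith)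
    · calc _ ≤ ∫⁻ τ : ℝ, (Set.Icc (v - M) (v + M)).indicator 1 τ := by
            refine lintegral_mono fun τ => ?_
            split_ifs with h1
            · have := abs_le.1 h1.2
              rw [Set.indicator_of_mem]
              · simp
              · exact ⟨by linarith, by linarith⟩
            · exact zero_le
        _ ≤ _ := by
            rw [lintegral_indicator_one measurableSet_Icc, Real.volume_Icc, min_eq_right hLM]
            exact ENNReal.ofReal_le_ofReal (by linarith)
  · have : ∀ τ : ℝ, ¬ (|τ + u| ≤ L ∧ |-τ + v| ≤ M) := by
      rintro τ ⟨h1, h2⟩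
      apply h
      rw [hw]
      calc |u + v| = |(τ + u) + (-τ + v)| := by congr 1; ring
        _ ≤ _ := (abs_add_le _ _).trans (add_le_add h1 h2)
    simp [this]

/-- Bilinear `L²` estimate with the first frequency held fixed. -/
theorem trilin_le_of_fixed {V : ℝ → ℝ → ℝ → ENNReal} (hV : MeasWeight V)
    {f₀ f₁ f₂ : SpaceTime → ENNReal} (h₀ : Measurable f₀) (h₁ : Measurable f₁)
    (h₂ : Measurable f₂) {ε₀ ε₁ ε₂ L₀ L₁ L₂ m : ℝ} (s₀ : NearCone ε₀ L₀ f₀) (s₁ : NearCone ε₁ L₁ f₁)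
    (s₂ : NearCone ε₂ L₂ f₂) (hm : min L₁ L₂ ≤ m) {A : ENNReal}
    (hA : ∀ N c : ℝ, 0 < N → |c + ε₀ * N| ≤ L₀ →
      ∫⁻ z : ℂ, V N ‖z‖ ‖(N : ℂ) + z‖ *
        (if |ε₁ * ‖z‖ + ε₂ * ‖(N : ℂ) + z‖ - c| ≤ L₁ + L₂ then 1 else 0) ≤ A) :
    trilin V f₀ f₁ f₂ ≤
      (ENNReal.ofReal (2 * m) * A) ^ (1 / 2 : ℝ) * (nrm f₀ * (nrm f₁ * nrm f₂)) := by
  set Q : SpaceTime → SpaceTime → ENNReal := fun a b =>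
    if |b.1 + ε₁ * ‖b.2‖| ≤ L₁ ∧ |-b.1 + (ε₂ * ‖a.2 + b.2‖ - a.1)| ≤ L₂ then 1 else 0 with hQ
  have hQsq : ∀ a b, Q a b ^ 2 = Q a b := by
    intro a b; simp only [hQ]; split_ifs <;> simp
  have hQm : ∀ a, Measurable (Q a) := by
    intro a
    refine Measurable.ite ?_ measurable_const measurable_const
    exact (measurableSet_le (by fun_prop : Measurable fun b : SpaceTime => |b.1 + ε₁ * ‖b.2‖|)
      measurable_const).inter (measurableSet_le (by fun_prop : Measurable fun b : SpaceTime =>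
        |-b.1 + (ε₂ * ‖a.2 + b.2‖ - a.1)|) measurable_const)
  have hVa : ∀ a : SpaceTime, Measurable fun b : SpaceTime => V ‖a.2‖ ‖b.2‖ ‖a.2 + b.2‖ :=
    fun a => hV.comp (by fun_prop) (by fun_prop) (by fun_prop)
  have hf2m : ∀ a : SpaceTime, Measurable fun b : SpaceTime => f₂ (-(a + b)) :=
    fun a => h₂.comp (by fun_prop)
  set B : SpaceTime → ENNReal := fun a => ∫⁻ b, f₁ b ^ 2 * f₂ (-(a + b)) ^ 2 with hB
  have hBm2 : Measurable fun p : SpaceTime × SpaceTime => f₁ p.2 ^ 2 * f₂ (-(p.1 + p.2)) ^ 2 :=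
    ((h₁.comp measurable_snd).pow_const 2).mul ((h₂.comp (by fun_prop)).pow_const 2)
  have hBm : Measurable B := hBm2.lintegral_prod_right'
  have hBint : ∫⁻ a, B a = (∫⁻ b, f₁ b ^ 2) * ∫⁻ b, f₂ b ^ 2 := by
    simp only [hB]
    rw [lintegral_lintegral_swap hBm2.aemeasurable,
      ← lintegral_mul_const _ (h₁.pow_const 2)]
    refine lintegral_congr fun b => ?_
    have hm2 : Measurable fun a : SpaceTime => f₂ (-(a + b)) ^ 2 :=
      (h₂.comp (by fun_prop : Measurable fun a : SpaceTime => -(a + b))).pow_const 2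
    rw [lintegral_const_mul _ hm2]
    congr 1
    have e : ∀ a : SpaceTime, f₂ (-(a + b)) ^ 2 = (fun x => f₂ x ^ 2) (-b - a) := by
      intro a
      simp only
      congr 2; abel
    simp_rw [e]
    exact lintegral_sub_left_eq_self (fun x => f₂ x ^ 2) (-b)
  set K : ENNReal := ENNReal.ofReal (2 * m) * A with hK
  have hweight : ∀ a : SpaceTime, a.2 ≠ 0 → f₀ a ≠ 0 →
      ∫⁻ b : SpaceTime, V ‖a.2‖ ‖b.2‖ ‖a.2 + b.2‖ * Q a b ≤ K := by
    intro a ha hfa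
    have hc := s₀ a hfa
    have hVQ : Measurable fun b : SpaceTime => V ‖a.2‖ ‖b.2‖ ‖a.2 + b.2‖ * Q a b :=
      (hVa a).mul (hQm a)
    rw [Measure.volume_eq_prod, lintegral_prod_symm _ hVQ.aemeasurable]
    calc ∫⁻ ξ : E2, ∫⁻ τ : ℝ, V ‖a.2‖ ‖ξ‖ ‖a.2 + ξ‖ * Q a (τ, ξ)
        ≤ ∫⁻ ξ : E2, (V ‖a.2‖ ‖ξ‖ ‖a.2 + ξ‖ *
          (if |ε₁ * ‖ξ‖ + ε₂ * ‖a.2 + ξ‖ - a.1| ≤ L₁ + L₂ then 1 else 0)) *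
            ENNReal.ofReal (2 * m) := by
          refine lintegral_mono fun ξ => ?_
          have hmQ : Measurable fun τ : ℝ => Q a (τ, ξ) := (hQm a).comp measurable_prodMk_right
          rw [lintegral_const_mul _ hmQ, mul_assoc]
          refine mul_le_mul' le_rfl ?_
          refine (volume_two_slabs_le (ε₁ * ‖ξ‖) (ε₂ * ‖a.2 + ξ‖ - a.1) L₁ L₂
            (ε₁ * ‖ξ‖ + ε₂ * ‖a.2 + ξ‖ - a.1) (by ring)).trans ?_
          exact mul_le_mul' le_rfl (ENNReal.ofReal_le_ofReal (by linarith))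
      _ ≤ K := by
          rw [lintegral_mul_const' _ _ ENNReal.ofReal_ne_top, hK, mul_comm]
          refine mul_le_mul' le_rfl ?_
          refine le_trans (le_of_eq ?_) (hA ‖a.2‖ a.1 (norm_pos_iff.2 ha) hc)
          exact lintegral_plane_eq_complex a.2 (fun r s => V ‖a.2‖ r s *
            (if |ε₁ * r + ε₂ * s - a.1| ≤ L₁ + L₂ then 1 else 0))
  calc trilin V f₀ f₁ f₂
      ≤ ∫⁻ a, f₀ a * (K ^ (1 / 2 : ℝ) * B a ^ (1 / 2 : ℝ)) := by
        refine lintegral_mono_ae ?_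
        filter_upwards [ae_snd_ne_zero] with a ha
        by_cases hfa : f₀ a = 0
        · simp [hfa]
        calc ∫⁻ b : SpaceTime, V ‖a.2‖ ‖b.2‖ ‖a.2 + b.2‖ ^ (1 / 2 : ℝ) *
              (f₀ a * (f₁ b * f₂ (-(a + b))))
            ≤ ∫⁻ b : SpaceTime, f₀ a * (((V ‖a.2‖ ‖b.2‖ ‖a.2 + b.2‖ ^ (1 / 2 : ℝ)) * Q a b) *
                (f₁ b * f₂ (-(a + b)))) := by
              refine lintegral_mono fun b => ?_
              by_cases hb : f₁ b = 0
              · simp [hb]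
              by_cases hb2 : f₂ (-(a + b)) = 0
              · simp only [hb2]; simp
              have q1 := s₁ b hb
              have q2 := s₂ _ hb2
              have : Q a b = 1 := by
                simp only [hQ]
                rw [if_pos]
                refine ⟨q1, ?_⟩
                have e : ‖(-(a + b)).2‖ = ‖a.2 + b.2‖ := by
                  rw [Prod.snd_neg, norm_neg, Prod.snd_add]
                rw [e, Prod.fst_neg, Prod.fst_add] at q2
                refine le_trans (le_of_eq ?_) q2
                congr 1; ring
              rw [this, mul_one]
              exact le_of_eq (by ring)
          _ ≤ f₀ a * (K ^ (1 / 2 : ℝ) * B a ^ (1 / 2 : ℝ)) := by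
              have m1 : Measurable fun b : SpaceTime =>
                  V ‖a.2‖ ‖b.2‖ ‖a.2 + b.2‖ ^ (1 / 2 : ℝ) * Q a b :=
                ((hVa a).pow_const _).mul (hQm a)
              have m2 : Measurable fun b : SpaceTime => f₁ b * f₂ (-(a + b)) := h₁.mul (hf2m a)
              have m3 : Measurable fun b : SpaceTime =>
                  V ‖a.2‖ ‖b.2‖ ‖a.2 + b.2‖ ^ (1 / 2 : ℝ) * Q a b * (f₁ b * f₂ (-(a + b))) :=
                m1.mul m2
              rw [lintegral_const_mul _ m3]
              refine mul_le_mul' le_rfl ?_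
              refine (lintegral_mul_le_sqrt_mul_sqrt m1.aemeasurable m2.aemeasurable).trans ?_
              refine mul_le_mul' (ENNReal.rpow_le_rpow ?_ (by norm_num))
                (ENNReal.rpow_le_rpow (le_of_eq ?_) (by norm_num))
              · refine le_trans (le_of_eq ?_) (hweight a ha hfa)
                refine lintegral_congr fun b => ?_
                rw [mul_pow, hQsq, ← ENNReal.rpow_natCast, ← ENNReal.rpow_mul]
                norm_num
              · exact lintegral_congr fun b => mul_pow _ _ _
    _ = K ^ (1 / 2 : ℝ) * ∫⁻ a, f₀ a * B a ^ (1 / 2 : ℝ) := by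
        have m4 : Measurable fun a => f₀ a * B a ^ (1 / 2 : ℝ) := h₀.mul (hBm.pow_const _)
        rw [← lintegral_const_mul _ m4]
        refine lintegral_congr fun a => ?_
        ring
    _ ≤ K ^ (1 / 2 : ℝ) * (nrm f₀ * (nrm f₁ * nrm f₂)) := by
        refine mul_le_mul' le_rfl ?_
        refine (lintegral_mul_le_sqrt_mul_sqrt h₀.aemeasurable
          (hBm.pow_const _).aemeasurable).trans ?_
        refine mul_le_mul' le_rfl ?_
        have : ∀ a, (B a ^ (1 / 2 : ℝ)) ^ 2 = B a := by
          intro a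
          rw [← ENNReal.rpow_natCast, ← ENNReal.rpow_mul]
          norm_num
        simp_rw [this]
        rw [hBint, ENNReal.mul_rpow_of_nonneg _ _ (by norm_num)]
        rfl

/-- Indicator of a proposition, with values in `[0, ∞]`. -/
def ind (P : Prop) [Decidable P] : ENNReal := if P then 1 else 0

theorem lintegral_sinh_mul_ind_le {η δ : ℝ} (c : ℝ) (hη : 0 < η) :
    ∫⁻ μ in Set.Ioi (0 : ℝ), ENNReal.ofReal (η * Real.sinh μ) * ind (|η * Real.cosh μ - c| ≤ δ) ≤
      ENNReal.ofReal (2 * δ) := by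
  have hinj : Set.InjOn (fun μ => η * Real.cosh μ) (Set.Ioi (0 : ℝ)) := by
    intro x hx y hy h
    have h1 := mul_left_cancel₀ hη.ne' h
    exact Real.cosh_strictMonoOn.injOn (Set.mem_Ici.2 (le_of_lt hx)) (Set.mem_Ici.2 (le_of_lt hy)) h1
  have hd : ∀ x ∈ Set.Ioi (0 : ℝ), HasDerivWithinAt (fun μ => η * Real.cosh μ)
      (η * Real.sinh x) (Set.Ioi 0) x := fun x _ =>
    ((Real.hasDerivAt_cosh x).const_mul η).hasDerivWithinAt
  have h := lintegral_image_eq_lintegral_abs_deriv_mul measurableSet_Ioi hd hinj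
    (fun t => ind (|t - c| ≤ δ))
  calc _ = ∫⁻ t in (fun μ => η * Real.cosh μ) '' Set.Ioi 0, ind (|t - c| ≤ δ) := by
        rw [h]
        refine setLIntegral_congr_fun measurableSet_Ioi fun x hx => ?_
        rw [abs_of_nonneg (mul_nonneg hη.le (Real.sinh_nonneg_iff.2 (le_of_lt hx)))]
    _ ≤ ∫⁻ t, ind (|t - c| ≤ δ) := setLIntegral_le_lintegral _ _
    _ ≤ ∫⁻ t, (Set.Icc (c - δ) (c + δ)).indicator 1 t := by
        refine lintegral_mono fun t => ?_
        unfold ind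
        split_ifs with h1
        · have := abs_le.1 h1
          rw [Set.indicator_of_mem]
          · simp
          · exact ⟨by linarith, by linarith⟩
        · exact zero_le
    _ ≤ _ := by
        rw [lintegral_indicator_one measurableSet_Icc, Real.volume_Icc]
        exact ENNReal.ofReal_le_ofReal (by linarith)

theorem setLIntegral_Ioo_neg_pi_pi_le (f : ℝ → ENNReal) :
    ∫⁻ ν in Set.Ioo (-Real.pi) Real.pi, f ν ≤
      (∫⁻ ν in Set.Ioo 0 Real.pi, f (-ν)) + ∫⁻ ν in Set.Ioo 0 Real.pi, f ν := by
  have h1 : Set.Ioo (-Real.pi) Real.pi ⊆ (Set.Ioo (-Real.pi) 0 ∪ {0}) ∪ Set.Ioo 0 Real.pi := by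
    rintro x ⟨h1, h2⟩
    rcases lt_trichotomy x 0 with h | h | h
    · exact Or.inl (Or.inl ⟨h1, h⟩)
    · exact Or.inl (Or.inr h)
    · exact Or.inr ⟨h, h2⟩
  refine (lintegral_mono_set h1).trans ((lintegral_union_le _ _ _).trans ?_)
  refine add_le_add ((lintegral_union_le _ _ _).trans ?_) le_rfl
  rw [Measure.restrict_singleton]
  simp only [Real.volume_singleton, zero_smul, lintegral_zero_measure, add_zero]
  have hp := (Measure.measurePreserving_neg (volume : Measure ℝ)).setLIntegral_comp_preimage_emb
    (MeasurableEquiv.neg ℝ).measurableEmbedding f (Set.Ioo (-Real.pi) 0)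
  rw [← hp]
  refine le_of_eq ?_
  congr 2
  ext x; simp

theorem lintegral_abs_sin_mul_ind_le {η δ : ℝ} (c : ℝ) (hη : 0 < η) (hδ : 0 ≤ δ) :
    ∫⁻ ν in Set.Ioo (-Real.pi) Real.pi,
      ENNReal.ofReal (η * |Real.sin ν|) * ind (|η * Real.cos ν - c| ≤ δ) ≤
      ENNReal.ofReal (4 * δ) := by
  have hinj : Set.InjOn (fun ν => η * Real.cos ν) (Set.Ioo (0 : ℝ) Real.pi) := by
    intro x hx y hy h
    have h1 := mul_left_cancel₀ hη.ne' h
    exact Real.injOn_cos ⟨hx.1.le, hx.2.le⟩ ⟨hy.1.le, hy.2.le⟩ h1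
  have hd : ∀ x ∈ Set.Ioo (0 : ℝ) Real.pi, HasDerivWithinAt (fun ν => η * Real.cos ν)
      (η * -Real.sin x) (Set.Ioo (0 : ℝ) Real.pi) x := fun x _ =>
    ((Real.hasDerivAt_cos x).const_mul η).hasDerivWithinAt
  have h := lintegral_image_eq_lintegral_abs_deriv_mul measurableSet_Ioo hd hinj
    (fun t => ind (|t - c| ≤ δ))
  have half : ∫⁻ ν in Set.Ioo 0 Real.pi,
      ENNReal.ofReal (η * |Real.sin ν|) * ind (|η * Real.cos ν - c| ≤ δ) ≤
      ENNReal.ofReal (2 * δ) := by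
    calc _ = ∫⁻ t in (fun ν => η * Real.cos ν) '' Set.Ioo 0 Real.pi, ind (|t - c| ≤ δ) := by
          rw [h]
          refine setLIntegral_congr_fun measurableSet_Ioo fun x hx => ?_
          rw [abs_mul, abs_neg, abs_of_pos hη]
      _ ≤ ∫⁻ t, ind (|t - c| ≤ δ) := setLIntegral_le_lintegral _ _
      _ ≤ ∫⁻ t, (Set.Icc (c - δ) (c + δ)).indicator 1 t := by
          refine lintegral_mono fun t => ?_
          unfold ind
          split_ifs with h1
          · have := abs_le.1 h1
            rw [Set.indicator_of_mem]
            · simp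
            · exact ⟨by linarith, by linarith⟩
          · exact zero_le
      _ ≤ _ := by
          rw [lintegral_indicator_one measurableSet_Icc, Real.volume_Icc]
          exact ENNReal.ofReal_le_ofReal (by linarith)
  refine (setLIntegral_Ioo_neg_pi_pi_le _).trans ?_
  simp only [Real.sin_neg, abs_neg, Real.cos_neg]
  refine (add_le_add half half).trans ?_
  rw [← ENNReal.ofReal_add (by linarith) (by linarith)]
  exact ENNReal.ofReal_le_ofReal (by linarith)

theorem volume_le_ofReal_of_dist_le {s : Set ℝ} {d : ℝ}
    (h : ∀ x ∈ s, ∀ y ∈ s, y ≤ x → x - y ≤ d) : volume s ≤ ENNReal.ofReal d := by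
  refine (Real.volume_le_diam s).trans (Metric.ediam_le fun x hx y hy => ?_)
  rw [edist_dist, Real.dist_eq]
  refine ENNReal.ofReal_le_ofReal (abs_le.2 ⟨?_, ?_⟩)
  · rcases le_total y x with h1 | h1
    · have := h x hx y hy h1
      linarith [h y hy y hy le_rfl]
    · linarith [h y hy x hx h1]
  · rcases le_total y x with h1 | h1
    · exact h x hx y hy h1
    · linarith [h y hy y hy le_rfl]

theorem sq_le_cosh_sub_cosh {x y : ℝ} (hy : 0 ≤ y) (hxy : y ≤ x) :
    (x - y) ^ 2 / 2 ≤ Real.cosh x - Real.cosh y := by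
  have h1 : Real.cosh x = Real.cosh (x - y) * Real.cosh y + Real.sinh (x - y) * Real.sinh y := by
    rw [← Real.cosh_add]; congr 1; ring
  have h2 : 0 ≤ Real.sinh (x - y) := Real.sinh_nonneg_iff.2 (by linarith)
  have h3 : 0 ≤ Real.sinh y := Real.sinh_nonneg_iff.2 hy
  have h4 := Real.one_le_cosh y
  have h5 : 1 + (x - y) ^ 2 / 2 ≤ Real.cosh (x - y) := by
    have h6 : Real.cosh (x - y) = 2 * Real.sinh ((x - y) / 2) ^ 2 + 1 := by
      have := Real.cosh_two_mul ((x - y) / 2)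
      rw [Real.cosh_sq, mul_div_cancel₀ _ (two_ne_zero)] at this
      linarith
    have h7 : (x - y) / 2 ≤ Real.sinh ((x - y) / 2) := Real.self_le_sinh_iff.2 (by linarith)
    have h8 : ((x - y) / 2) ^ 2 ≤ Real.sinh ((x - y) / 2) ^ 2 :=
      pow_le_pow_left₀ (by linarith) h7 2
    nlinarith
  nlinarith [mul_nonneg h2 h3, Real.one_le_cosh (x - y), sq_nonneg (x - y)]

theorem volume_cosh_sublevel_le {η δ : ℝ} (c : ℝ) (hη : 0 < η) :
    ∫⁻ μ in Set.Ioi (0 : ℝ), ind (|η * Real.cosh μ - c| ≤ δ) ≤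
      ENNReal.ofReal (2 * Real.sqrt (δ / η)) := by
  have hm : MeasurableSet {μ : ℝ | |η * Real.cosh μ - c| ≤ δ} :=
    measurableSet_le (by fun_prop) measurable_const
  have e : ∀ μ : ℝ, ind (|η * Real.cosh μ - c| ≤ δ) =
      {μ : ℝ | |η * Real.cosh μ - c| ≤ δ}.indicator 1 μ := by
    intro μ; unfold ind; simp [Set.indicator]
  simp_rw [e]
  rw [lintegral_indicator_one hm, Measure.restrict_apply hm]
  refine volume_le_ofReal_of_dist_le ?_
  rintro x ⟨hx, hx0⟩ y ⟨hy, hy0⟩ hxy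
  have h1 := sq_le_cosh_sub_cosh (le_of_lt hy0) hxy
  have h2 := abs_le.1 (id hx : |_| ≤ δ)
  have h3 := abs_le.1 (id hy : |_| ≤ δ)
  have h4 : (x - y) ^ 2 ≤ 2 ^ 2 * (δ / η) := by
    rw [mul_div_assoc', le_div_iff₀ hη]
    nlinarith
  have h5 := Real.le_sqrt_of_sq_le h4
  rwa [Real.sqrt_mul (by norm_num), Real.sqrt_sq (by norm_num)] at h5

theorem sq_le_cos_sub_cos {x y : ℝ} (hy : 0 ≤ y) (hxy : y ≤ x) (hx : x ≤ Real.pi) :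
    2 / Real.pi ^ 2 * (x - y) ^ 2 ≤ Real.cos y - Real.cos x := by
  have hpi := Real.pi_pos
  have h1 : Real.cos y - Real.cos x = 2 * Real.sin ((x + y) / 2) * Real.sin ((x - y) / 2) := by
    rw [Real.cos_sub_cos]
    have : (y - x) / 2 = -((x - y) / 2) := by ring
    rw [this, Real.sin_neg, add_comm y x]; ring
  have h2 : 2 / Real.pi * ((x - y) / 2) ≤ Real.sin ((x - y) / 2) :=
    Real.mul_le_sin (by linarith) (by linarith)
  have h3 : 2 / Real.pi * ((x - y) / 2) ≤ Real.sin ((x + y) / 2) := by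
    rcases le_total ((x + y) / 2) (Real.pi / 2) with h | h
    · refine le_trans ?_ (Real.mul_le_sin (by linarith) h)
      gcongr; linarith
    · rw [← Real.sin_pi_sub]
      refine le_trans ?_ (Real.mul_le_sin (by linarith) (by linarith))
      gcongr; linarith
  have h4 : 0 ≤ 2 / Real.pi * ((x - y) / 2) := by
    have : 0 ≤ x - y := by linarith
    positivity
  have h5 := mul_le_mul h3 h2 h4 (h4.trans h3)
  rw [h1]
  have h6 : 2 / Real.pi ^ 2 * (x - y) ^ 2 =
    2 * ((2 / Real.pi * ((x - y) / 2)) * (2 / Real.pi * ((x - y) / 2))) := by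
    field_simp
  rw [h6]; linarith

theorem volume_cos_sublevel_le {η δ : ℝ} (c : ℝ) (hη : 0 < η) :
    ∫⁻ ν in Set.Ioo (-Real.pi) Real.pi, ind (|η * Real.cos ν - c| ≤ δ) ≤
      ENNReal.ofReal (2 * Real.pi * Real.sqrt (δ / η)) := by
  have hpi := Real.pi_pos
  have hm : MeasurableSet {ν : ℝ | |η * Real.cos ν - c| ≤ δ} :=
    measurableSet_le (by fun_prop) measurable_const
  have e : ∀ ν : ℝ, ind (|η * Real.cos ν - c| ≤ δ) =
      {ν : ℝ | |η * Real.cos ν - c| ≤ δ}.indicator 1 ν := by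
    intro μ; unfold ind; simp [Set.indicator]
  have half : ∫⁻ ν in Set.Ioo 0 Real.pi, ind (|η * Real.cos ν - c| ≤ δ) ≤
      ENNReal.ofReal (Real.pi * Real.sqrt (δ / η)) := by
    simp_rw [e]
    rw [lintegral_indicator_one hm, Measure.restrict_apply hm]
    refine volume_le_ofReal_of_dist_le ?_
    rintro x ⟨hx, hx0, hx1⟩ y ⟨hy, hy0, hy1⟩ hxy
    have h1 := sq_le_cos_sub_cos hy0.le hxy hx1.le
    have h2 := abs_le.1 (id hx : |_| ≤ δ)
    have h3 := abs_le.1 (id hy : |_| ≤ δ)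
    have h4 : (x - y) ^ 2 ≤ Real.pi ^ 2 * (δ / η) := by
      rw [mul_div_assoc', le_div_iff₀ hη]
      have h6 : 2 / Real.pi ^ 2 * (x - y) ^ 2 * η ≤ 2 * δ := by nlinarith
      rw [div_mul_eq_mul_div, div_mul_eq_mul_div, div_le_iff₀ (by positivity)] at h6
      linarith
    have h5 := Real.le_sqrt_of_sq_le h4
    rwa [Real.sqrt_mul (by positivity), Real.sqrt_sq hpi.le] at h5
  refine (setLIntegral_Ioo_neg_pi_pi_le _).trans ?_
  simp only [Real.cos_neg]
  refine (add_le_add half half).trans ?_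
  rw [← ENNReal.ofReal_add (by positivity) (by positivity)]
  exact ENNReal.ofReal_le_ofReal (by linarith)

theorem lintegral_cosh_add_one_le (M : ℝ) :
    ∫⁻ μ in Set.Ioi (0 : ℝ), ENNReal.ofReal (Real.cosh μ + 1) * ind (Real.cosh μ ≤ M) ≤
      ENNReal.ofReal (2 * M) := by
  rcases lt_or_ge M 1 with hM | hM
  · have : ∀ μ : ℝ, ind (Real.cosh μ ≤ M) = 0 := by
      intro μ; unfold ind; rw [if_neg]; linarith [Real.one_le_cosh μ]
    simp [this]
  set m := Real.arsinh M with hm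
  have hm0 : 0 ≤ m := Real.arsinh_nonneg_iff.2 (by linarith)
  have hsinh : Real.sinh m = M := Real.sinh_arsinh M
  have hle : ∀ μ : ℝ, 0 < μ → Real.cosh μ ≤ M → μ ≤ m := by
    intro μ h0 h1
    by_contra hc
    push Not at hc
    have := Real.sinh_lt_sinh.2 hc
    linarith [Real.sinh_lt_cosh μ]
  calc _ ≤ ∫⁻ μ in Set.Ioc 0 m, ENNReal.ofReal (Real.cosh μ + 1) := by
        rw [← lintegral_indicator measurableSet_Ioi, ← lintegral_indicator measurableSet_Ioc]
        refine lintegral_mono fun μ => ?_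
        by_cases h0 : μ ∈ Set.Ioi (0:ℝ)
        · rw [Set.indicator_of_mem h0]
          unfold ind
          split_ifs with h1
          · rw [Set.indicator_of_mem (Set.mem_Ioc.2 ⟨h0, hle μ h0 h1⟩), mul_one]
          · simp
        · rw [Set.indicator_of_notMem h0]; exact zero_le
    _ = ENNReal.ofReal (∫ μ in Set.Ioc 0 m, (Real.cosh μ + 1)) := by
        rw [ofReal_integral_eq_lintegral_ofReal]
        · exact (Continuous.integrableOn_Icc (by fun_prop)).mono_set Set.Ioc_subset_Icc_self
        · exact Filter.Eventually.of_forall fun μ => by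
            have := Real.cosh_pos μ
            simp only [Pi.zero_apply]; linarith
    _ ≤ _ := by
        refine ENNReal.ofReal_le_ofReal ?_
        rw [← intervalIntegral.integral_of_le hm0]
        have hd : ∀ x ∈ Set.uIcc 0 m, HasDerivAt (fun μ => Real.sinh μ + μ) (Real.cosh x + 1) x :=
          fun x _ => (Real.hasDerivAt_sinh x).add (hasDerivAt_id x)
        rw [intervalIntegral.integral_eq_sub_of_hasDerivAt hd
          (Continuous.intervalIntegrable (by fun_prop) _ _), hsinh]
        have : m ≤ Real.sinh m := Real.self_le_sinh_iff.2 hm0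
        rw [hsinh] at this
        simp
        linarith

theorem ind_of_true {P : Prop} [Decidable P] (h : P) : ind P = 1 := if_pos h

theorem ind_of_false {P : Prop} [Decidable P] (h : ¬P) : ind P = 0 := if_neg h

theorem ind_le_one (P : Prop) [Decidable P] : ind P ≤ 1 := by
  unfold ind; split_ifs <;> simp

theorem ind_mono {P Q : Prop} [Decidable P] [Decidable Q] (h : P → Q) : ind P ≤ ind Q := by
  by_cases hP : P
  · rw [ind_of_true hP, ind_of_true (h hP)]
  · rw [ind_of_false hP]; exact zero_le

theorem measurable_ind {α : Type*} [MeasurableSpace α] {P : α → Prop} [DecidablePred P]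
    (h : MeasurableSet {x | P x}) : Measurable fun x => ind (P x) :=
  Measurable.ite h measurable_const measurable_const

theorem setLIntegral_Ioo_neg_pi_pi_const (k : ENNReal) :
    ∫⁻ _ν in Set.Ioo (-Real.pi) Real.pi, k = k * ENNReal.ofReal (2 * Real.pi) := by
  rw [setLIntegral_const, Real.volume_Ioo]
  congr 2; ring

theorem lintegral_le_elliptic_of_le {N : ℝ} (hN : 0 < N) {G : ℝ → ℝ → ENNReal}
    (hG : Measurable fun p : ℝ × ℝ => G p.1 p.2) (H : ℝ → ℝ → ENNReal)
    (h : ∀ μ ν r s : ℝ, 0 < μ → 0 < r → 0 < s → r = N / 2 * (Real.cosh μ - Real.cos ν) →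
      s = N / 2 * (Real.cosh μ + Real.cos ν) → ENNReal.ofReal (r * s) * G r s ≤ H μ ν) :
    ∫⁻ z : ℂ, G ‖z‖ ‖(N : ℂ) + z‖ ≤
      ∫⁻ μ in Set.Ioi (0 : ℝ), ∫⁻ ν in Set.Ioo (-Real.pi) Real.pi, H μ ν := by
  refine (lintegral_le_elliptic hN hG).trans ?_
  refine setLIntegral_mono' measurableSet_Ioi fun μ hμ => ?_
  refine lintegral_mono fun ν => ?_
  have h1 : 1 < Real.cosh μ := Real.one_lt_cosh.2 (ne_of_gt hμ)
  have h2 := Real.cos_le_one ν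
  have h3 := Real.neg_one_le_cos ν
  exact h μ ν _ _ hμ (mul_pos (by linarith) (by linarith)) (mul_pos (by linarith) (by linarith))
    rfl rfl

/-- The squared null-form weight divided by the length of the output frequency. -/
def nullWeight (σ r₀ r₁ r₂ : ℝ) : ENNReal :=
  ENNReal.ofReal (|r₀ ^ 2 - (r₁ + σ * r₂) ^ 2| / (r₀ * r₁ * r₂))

theorem measurable_nullWeight {α : Type*} [MeasurableSpace α] {f g h : α → ℝ} (σ : ℝ)
    (hf : Measurable f) (hg : Measurable g) (hh : Measurable h) :
    Measurable fun x => nullWeight σ (f x) (g x) (h x) := by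
  unfold nullWeight
  exact ENNReal.measurable_ofReal.comp (by fun_prop)

theorem measWeight_nullWeight (σ : ℝ) : MeasWeight (nullWeight σ) :=
  measurable_nullWeight σ measurable_fst (measurable_fst.comp measurable_snd)
    (measurable_snd.comp measurable_snd)

theorem ofReal_mul_nullWeight_fst {N r s : ℝ} (σ : ℝ) (hN : 0 < N) (hr : 0 < r) (hs : 0 < s) :
    ENNReal.ofReal (r * s) * nullWeight σ N r s =
      ENNReal.ofReal (|N ^ 2 - (r + σ * s) ^ 2| / N) := by
  unfold nullWeight
  rw [← ENNReal.ofReal_mul (by positivity)]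
  congr 1
  field_simp

theorem ofReal_mul_nullWeight_snd {N r s : ℝ} (σ : ℝ) (hN : 0 < N) (hr : 0 < r) (hs : 0 < s) :
    ENNReal.ofReal (r * s) * nullWeight σ r N s =
      ENNReal.ofReal (|r ^ 2 - (N + σ * s) ^ 2| / N) := by
  unfold nullWeight
  rw [← ENNReal.ofReal_mul (by positivity)]
  congr 1
  field_simp

theorem abs_sub_mul_of_sign {ε : ℝ} (hε : ε = 1 ∨ ε = -1) (x c : ℝ) :
    |ε * x - c| = |x - ε * c| := by
  rcases hε with rfl | rfl
  · simp
  · rw [← abs_neg]; congr 1; ring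

theorem cosh_sub_one_le_sinh {μ : ℝ} (hμ : 0 ≤ μ) : Real.cosh μ - 1 ≤ Real.sinh μ := by
  have := Real.cosh_sub_sinh μ
  have h2 : Real.exp (-μ) ≤ 1 := Real.exp_le_one_iff.2 (by linarith)
  linarith

/-- Output frequency fixed and equal signs. -/
theorem fixed_output_equal_signs {N a b c ε ε₀ δ : ℝ} (hN : 0 < N) (ha : 0 < a) (hab : a ≤ b)
    (hε : ε = 1 ∨ ε = -1) (hε₀ : ε₀ = 1 ∨ ε₀ = -1) (hδ : 0 ≤ δ) (hδ2 : δ ≤ 2 * a ^ 3)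
    (hT : a * b ^ 2 ≤ N) (hc : |c + ε₀ * N| ≤ b ^ 3) :
    ∫⁻ z : ℂ, nullWeight 1 N ‖z‖ ‖(N : ℂ) + z‖ *
      ind (|ε * ‖z‖ + ε * ‖(N : ℂ) + z‖ - c| ≤ δ) ≤
      ENNReal.ofReal (32 * Real.pi * (a * b ^ 2)) := by
  have hb : 0 < b := ha.trans_le hab
  have hpi := Real.pi_pos
  have hGm : Measurable fun p : ℝ × ℝ =>
      nullWeight 1 N p.1 p.2 * ind (|ε * p.1 + ε * p.2 - c| ≤ δ) :=
    (measurable_nullWeight 1 measurable_const measurable_fst measurable_snd).mul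
      (measurable_ind (measurableSet_le (by fun_prop) measurable_const))
  refine (lintegral_le_elliptic_of_le hN (G := fun r s => nullWeight 1 N r s *
    ind (|ε * r + ε * s - c| ≤ δ)) hGm (fun μ _ => ENNReal.ofReal (1 + 3 * b / a) *
    (ENNReal.ofReal (N * Real.sinh μ) * ind (|N * Real.cosh μ - ε * c| ≤ δ))) ?_).trans ?_
  · intro μ ν r s hμ hr hs hr' hs'
    rw [← mul_assoc, ofReal_mul_nullWeight_fst _ hN hr hs, ← mul_assoc,
      ← ENNReal.ofReal_mul (by positivity)]
    have e1 : ε * r + ε * s - c = ε * (N * Real.cosh μ) - c := by rw [hr', hs']; ring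
    rw [e1, abs_sub_mul_of_sign hε]
    by_cases hQ : |N * Real.cosh μ - ε * c| ≤ δ
    · refine mul_le_mul' (ENNReal.ofReal_le_ofReal ?_) le_rfl
      have hsq := Real.cosh_sq μ
      have hsinh : 0 < Real.sinh μ := Real.sinh_pos_iff.2 hμ
      have e2 : |N ^ 2 - (r + 1 * s) ^ 2| / N = N * Real.sinh μ * Real.sinh μ := by
        have : N ^ 2 - (r + 1 * s) ^ 2 = -(N ^ 2 * Real.sinh μ ^ 2) := by
          rw [hr', hs']; linear_combination (-N ^ 2) * hsq
        rw [this, abs_neg, abs_of_nonneg (by positivity)]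
        field_simp
      rw [e2, mul_comm]
      refine mul_le_mul_of_nonneg_right ?_ (by positivity)
      have h1 : N * Real.cosh μ - N ≤ 3 * b ^ 3 := by
        have h2 := abs_le.1 hQ
        have h3 := abs_le.1 hc
        have h4 : a ^ 3 ≤ b ^ 3 := pow_le_pow_left₀ ha.le hab 3
        have h5 : N ≤ N * Real.cosh μ := le_mul_of_one_le_right hN.le (Real.one_le_cosh μ)
        rcases hε with rfl | rfl <;> rcases hε₀ with rfl | rfl <;> linarith
      have h2 : Real.cosh μ - 1 ≤ 3 * b / a := by
        rw [le_div_iff₀ ha]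
        have h3 : a * b ^ 2 * (Real.cosh μ - 1) ≤ N * (Real.cosh μ - 1) :=
          mul_le_mul_of_nonneg_right hT (by linarith [Real.one_le_cosh μ])
        have h4 : b ^ 2 * ((Real.cosh μ - 1) * a) ≤ b ^ 2 * (3 * b) := by nlinarith
        exact le_of_mul_le_mul_left h4 (by positivity)
      linarith [Real.sinh_lt_cosh μ]
    · rw [ind_of_false hQ]; simp
  · simp_rw [setLIntegral_Ioo_neg_pi_pi_const]
    rw [lintegral_mul_const' _ _ ENNReal.ofReal_ne_top,
      lintegral_const_mul' _ _ ENNReal.ofReal_ne_top]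
    refine (mul_le_mul' (mul_le_mul' le_rfl (lintegral_sinh_mul_ind_le (ε * c) hN)) le_rfl).trans ?_
    rw [← ENNReal.ofReal_mul (by positivity), ← ENNReal.ofReal_mul (by positivity)]
    refine ENNReal.ofReal_le_ofReal ?_
    have h1 : (1 + 3 * b / a) ≤ 4 * b / a := by
      rw [le_div_iff₀ ha]; field_simp; linarith
    calc (1 + 3 * b / a) * (2 * δ) * (2 * Real.pi)
        ≤ (4 * b / a) * (2 * (2 * a ^ 3)) * (2 * Real.pi) := by gcongr
      _ = 32 * Real.pi * (a * b * a) := by field_simp; ring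
      _ ≤ 32 * Real.pi * (a * b ^ 2) := by
        refine mul_le_mul_of_nonneg_left ?_ (by positivity)
        nlinarith [mul_le_mul_of_nonneg_left hab (mul_pos ha hb).le]

/-- Output frequency fixed and opposite signs, away from small output frequencies. -/
theorem fixed_output_opposite_signs {N a b c ε δ : ℝ} (hN : 0 < N) (ha : 0 < a) (hab : a ≤ b)
    (hε : ε = 1 ∨ ε = -1) (hδ : 0 ≤ δ) (hδ2 : δ ≤ 2 * a ^ 3) :
    ∫⁻ z : ℂ, nullWeight (-1) N ‖z‖ ‖(N : ℂ) + z‖ *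
      ind (a * (‖z‖ + ‖(N : ℂ) + z‖) ≤ 8 * b * N) *
      ind (|ε * ‖z‖ + -ε * ‖(N : ℂ) + z‖ - c| ≤ δ) ≤
      ENNReal.ofReal (128 * (a * b ^ 2)) := by
  have hb : 0 < b := ha.trans_le hab
  have hGm : Measurable fun p : ℝ × ℝ =>
      nullWeight (-1) N p.1 p.2 * ind (a * (p.1 + p.2) ≤ 8 * b * N) *
        ind (|ε * p.1 + -ε * p.2 - c| ≤ δ) :=
    ((measurable_nullWeight (-1) measurable_const measurable_fst measurable_snd).mul
      (measurable_ind (measurableSet_le (by fun_prop) measurable_const))).mul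
      (measurable_ind (measurableSet_le (by fun_prop) measurable_const))
  refine (lintegral_le_elliptic_of_le hN (G := fun r s => nullWeight (-1) N r s *
    ind (a * (r + s) ≤ 8 * b * N) *
    ind (|ε * r + -ε * s - c| ≤ δ)) hGm (fun μ ν =>
    (ENNReal.ofReal (Real.cosh μ + 1) * ind (Real.cosh μ ≤ 8 * b / a)) *
    (ENNReal.ofReal (N * |Real.sin ν|) * ind (|N * Real.cos ν - -ε * c| ≤ δ))) ?_).trans ?_
  · intro μ ν r s hμ hr hs hr' hs'
    rw [← mul_assoc, ← mul_assoc, ofReal_mul_nullWeight_fst _ hN hr hs]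
    have e1 : ε * r + -ε * s - c = -ε * (N * Real.cos ν) - c := by rw [hr', hs']; ring
    have hε' : -ε = 1 ∨ -ε = -1 := by rcases hε with rfl | rfl <;> simp
    rw [e1, abs_sub_mul_of_sign hε', ← mul_assoc]
    refine mul_le_mul' ?_ le_rfl
    rw [mul_comm (_ * _) (ENNReal.ofReal (N * |Real.sin ν|)), ← mul_assoc]
    refine mul_le_mul' ?_ (ind_mono fun h => ?_)
    · rw [← ENNReal.ofReal_mul (by positivity)]
      refine ENNReal.ofReal_le_ofReal ?_
      have hsq := Real.sin_sq_add_cos_sq ν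
      have e2 : |N ^ 2 - (r + -1 * s) ^ 2| / N = N * |Real.sin ν| * |Real.sin ν| := by
        have : N ^ 2 - (r + -1 * s) ^ 2 = N ^ 2 * |Real.sin ν| ^ 2 := by
          rw [hr', hs', sq_abs]; linear_combination (-N ^ 2) * hsq
        rw [this, abs_of_nonneg (by positivity)]
        field_simp
      rw [e2]
      refine mul_le_mul_of_nonneg_left ?_ (by positivity)
      linarith [Real.abs_sin_le_one ν, Real.cosh_pos μ]
    · rw [le_div_iff₀ ha]
      have h2 : N * (Real.cosh μ * a) ≤ N * (8 * b) := by
        have : r + s = N * Real.cosh μ := by rw [hr', hs']; ring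
        rw [this] at h; linarith
      exact le_of_mul_le_mul_left h2 hN
  · have h1 := lintegral_abs_sin_mul_ind_le (-ε * c) hN hδ
    have h2 := lintegral_cosh_add_one_le (8 * b / a)
    calc _ ≤ ∫⁻ μ in Set.Ioi (0 : ℝ),
          (ENNReal.ofReal (Real.cosh μ + 1) * ind (Real.cosh μ ≤ 8 * b / a)) *
            ENNReal.ofReal (4 * δ) := by
          refine lintegral_mono fun μ => ?_
          simp only
          rw [lintegral_const_mul']
          · exact mul_le_mul' le_rfl h1
          · exact ENNReal.mul_ne_top ENNReal.ofReal_ne_top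
              (ne_top_of_le_ne_top ENNReal.one_ne_top (ind_le_one _))
      _ ≤ _ := by
          rw [lintegral_mul_const' _ _ ENNReal.ofReal_ne_top]
          refine (mul_le_mul' h2 le_rfl).trans ?_
          rw [← ENNReal.ofReal_mul (by positivity)]
          refine ENNReal.ofReal_le_ofReal ?_
          calc 2 * (8 * b / a) * (4 * δ) ≤ 2 * (8 * b / a) * (4 * (2 * a ^ 3)) := by gcongr
            _ = 128 * (a * b * a) := by field_simp; ring
            _ ≤ 128 * (a * b ^ 2) := by
              nlinarith [mul_le_mul_of_nonneg_left hab (mul_pos ha hb).le]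

theorem abs_sq_sub_sq_le_four_mul {σ r₀ r₁ r₂ : ℝ} (hσ : σ = 1 ∨ σ = -1) (h₁ : 0 ≤ r₁) (h₂ : 0 ≤ r₂)
    (h₀ : 0 ≤ r₀) (ha : r₀ ≤ r₁ + r₂) (hb : r₁ ≤ r₀ + r₂) (hc : r₂ ≤ r₀ + r₁) :
    |r₀ ^ 2 - (r₁ + σ * r₂) ^ 2| ≤ 4 * (r₁ * r₂) := by
  rw [abs_le]
  rcases hσ with rfl | rfl <;> constructor <;>
    nlinarith [mul_nonneg h₁ h₂, mul_nonneg (sub_nonneg.2 hb) (sub_nonneg.2 hc),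
      mul_nonneg (sub_nonneg.2 ha) (add_nonneg h₀ (add_nonneg h₁ h₂))]

theorem triangle_complex {N : ℝ} (hN : 0 < N) (z : ℂ) :
    ‖z‖ ≤ N + ‖(N : ℂ) + z‖ ∧ N ≤ ‖z‖ + ‖(N : ℂ) + z‖ ∧ ‖(N : ℂ) + z‖ ≤ ‖z‖ + N := by
  have hn : ‖(N : ℂ)‖ = N := by rw [Complex.norm_real, Real.norm_of_nonneg hN.le]
  refine ⟨?_, ?_, ?_⟩
  · have : z = ((N : ℂ) + z) - (N : ℂ) := by ring
    calc ‖z‖ = ‖((N : ℂ) + z) - (N : ℂ)‖ := by rw [← this]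
      _ ≤ _ := (norm_sub_le _ _).trans (by rw [hn]; linarith)
  · have : (N : ℂ) = ((N : ℂ) + z) - z := by ring
    calc N = ‖((N : ℂ) + z) - z‖ := by rw [← this, hn]
      _ ≤ _ := (norm_sub_le _ _).trans (by linarith)
  · refine (norm_add_le _ _).trans (by rw [hn]; linarith)

theorem lintegral_inv_norm_le {T : ℝ} :
    ∫⁻ z : ℂ, ENNReal.ofReal (4 / ‖z‖) * ind (‖z‖ ≤ T) ≤ ENNReal.ofReal (8 * Real.pi * T) := by
  have hpi := Real.pi_pos
  rcases lt_or_ge T 0 with hT | hT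
  · have : ∀ z : ℂ, ind (‖z‖ ≤ T) = 0 := fun z => ind_of_false (by linarith [norm_nonneg z])
    simp [this]
  have hGm : Measurable fun p : ℝ × ℝ => ENNReal.ofReal (4 / p.1) * ind (p.1 ≤ T) :=
    (ENNReal.measurable_ofReal.comp (by fun_prop)).mul
      (measurable_ind (measurableSet_le measurable_fst measurable_const))
  refine (lintegral_le_polar (N := 0) (G := fun r _ => ENNReal.ofReal (4 / r) * ind (r ≤ T)) hGm).trans ?_
  have h1 : ∀ α : ℝ, ∫⁻ η in Set.Ioi (0 : ℝ), ENNReal.ofReal η *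
      (ENNReal.ofReal (4 / η) * ind (η ≤ T)) ≤ ENNReal.ofReal (4 * T) := by
    intro _
    calc _ ≤ ∫⁻ η, (Set.Ioc 0 T).indicator (fun _ => ENNReal.ofReal 4) η := by
          rw [← lintegral_indicator measurableSet_Ioi]
          refine lintegral_mono fun η => ?_
          by_cases h0 : η ∈ Set.Ioi (0 : ℝ)
          · have h0' : 0 < η := h0
            rw [Set.indicator_of_mem h0]
            by_cases h2 : η ≤ T
            · rw [Set.indicator_of_mem (Set.mem_Ioc.2 ⟨h0, h2⟩), ind_of_true h2, mul_one,
                ← ENNReal.ofReal_mul h0'.le, mul_div_cancel₀ _ h0'.ne']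
            · rw [ind_of_false h2]; simp
          · rw [Set.indicator_of_notMem h0]; exact zero_le
      _ = _ := by
          rw [lintegral_indicator_const measurableSet_Ioc, Real.volume_Ioc,
            ← ENNReal.ofReal_mul (by norm_num), sub_zero]
  refine (lintegral_mono h1).trans ?_
  rw [setLIntegral_Ioo_neg_pi_pi_const, ← ENNReal.ofReal_mul (by positivity)]
  exact ENNReal.ofReal_le_ofReal (by linarith)

/-- An input frequency fixed, small output frequencies, equal signs. -/
theorem fixed_input_small_output_equal_signs {N T : ℝ} (hN : 0 < N) :
    ∫⁻ z : ℂ, nullWeight 1 ‖z‖ N ‖(N : ℂ) + z‖ * ind (‖z‖ ≤ T) ≤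
      ENNReal.ofReal (8 * Real.pi * T) := by
  refine (lintegral_mono fun z => mul_le_mul' ?_ le_rfl).trans lintegral_inv_norm_le
  refine ENNReal.ofReal_le_ofReal ?_
  obtain ⟨h1, h2, h3⟩ := triangle_complex hN z
  have h4 := abs_sq_sub_sq_le_four_mul (Or.inl rfl) hN.le (norm_nonneg ((N : ℂ) + z)) (norm_nonneg z)
    h1 h2 h3
  rcases (norm_nonneg z).eq_or_lt with hz | hz
  · simp [← hz]
  rcases (norm_nonneg ((N : ℂ) + z)).eq_or_lt with hw | hw
  · rw [← hw]; simp only [mul_zero, div_zero]; positivity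
  rw [div_le_div_iff₀ (by positivity) hz]
  nlinarith

/-- An input frequency fixed, relatively small output frequencies, opposite signs. -/
theorem fixed_input_small_output_opposite_signs {N a b c ε ε₀ δ L : ℝ} (hN : 0 < N) (ha : 0 < a)
    (hab : a ≤ b) (hε : ε = 1 ∨ ε = -1) (hε₀ : ε₀ = 1 ∨ ε₀ = -1) (hδ : L + δ ≤ 3 * b ^ 3)
    (hc : |c + ε * N| ≤ L) :
    ∫⁻ z : ℂ, nullWeight (-1) ‖z‖ N ‖(N : ℂ) + z‖ *
      ind (8 * b * ‖z‖ ≤ a * (N + ‖(N : ℂ) + z‖)) *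
      ind (|ε₀ * ‖z‖ + -ε * ‖(N : ℂ) + z‖ - c| ≤ δ) ≤
      ENNReal.ofReal (3 * Real.pi * (a * b ^ 2)) := by
  have hb : 0 < b := ha.trans_le hab
  have hpi := Real.pi_pos
  set R := a / (2 * b) * N with hR
  have hR0 : 0 ≤ R := by positivity
  calc _ ≤ ∫⁻ z : ℂ, (Metric.closedBall (0 : ℂ) R).indicator
        (fun _ => ENNReal.ofReal (12 * b ^ 3 / N ^ 2)) z := by
        refine lintegral_mono fun z => ?_
        obtain ⟨h1, h2, h3⟩ := triangle_complex hN z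
        set r := ‖z‖ with hr
        set s := ‖(N : ℂ) + z‖ with hs
        have hr0 : 0 ≤ r := norm_nonneg z
        have hs0 : 0 ≤ s := norm_nonneg _
        by_cases hP : 8 * b * r ≤ a * (N + s)
        swap
        · rw [ind_of_false hP]; simp
        by_cases hQ : |ε₀ * r + -ε * s - c| ≤ δ
        swap
        · rw [ind_of_false hQ]; simp
        have h8 : 8 * r ≤ N + s := by
          have : b * (8 * r) ≤ b * (N + s) := by nlinarith
          exact le_of_mul_le_mul_left this hb
        have hs1 : N / 2 ≤ s := by linarith
        have hs2 : s ≤ 2 * N := by linarith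
        have hrR : r ≤ R := by
          rw [hR, div_mul_eq_mul_div, le_div_iff₀ (by positivity)]
          nlinarith
        have hmem : z ∈ Metric.closedBall (0 : ℂ) R := by simpa using hrR
        rw [Set.indicator_of_mem hmem, ind_of_true hP, ind_of_true hQ, mul_one, mul_one]
        refine ENNReal.ofReal_le_ofReal ?_
        rcases hr0.eq_or_lt with hz | hz
        · rw [← hz]; simp only [zero_mul, div_zero]; positivity
        have hs' : 0 < s := by linarith
        have hres : |ε₀ * r + ε * (N - s)| ≤ 3 * b ^ 3 := by
          have : ε₀ * r + ε * (N - s) = (ε₀ * r + -ε * s - c) + (c + ε * N) := by ring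
          rw [this]
          exact (abs_add_le _ _).trans (by linarith)
        have hkey : |r ^ 2 - (N + -1 * s) ^ 2| ≤ 3 * b ^ 3 * (2 * r) := by
          have e : r ^ 2 - (N + -1 * s) ^ 2 = (r - (N - s)) * (r + (N - s)) := by ring
          rw [e, abs_mul, abs_of_nonneg (by linarith : 0 ≤ r - (N - s)),
            abs_of_nonneg (by linarith : 0 ≤ r + (N - s))]
          have h5 := abs_le.1 hres
          have h6 : r - (N - s) ≤ 3 * b ^ 3 ∨ r + (N - s) ≤ 3 * b ^ 3 := by
            rcases hε with rfl | rfl <;> rcases hε₀ with rfl | rfl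
            · right; linarith
            · left; linarith
            · left; linarith
            · right; linarith
          rcases h6 with h6 | h6
          · exact mul_le_mul h6 (by linarith) (by linarith) (by positivity)
          · rw [mul_comm]
            exact mul_le_mul h6 (by linarith) (by linarith) (by positivity)
        calc |r ^ 2 - (N + -1 * s) ^ 2| / (r * N * s) ≤ 3 * b ^ 3 * (2 * r) / (r * N * (N / 2)) := by
              gcongr
          _ = 12 * b ^ 3 / N ^ 2 := by field_simp; ring
    _ = ENNReal.ofReal (12 * b ^ 3 / N ^ 2 * (R ^ 2 * Real.pi)) := by
        rw [lintegral_indicator_const Metric.isClosed_closedBall.measurableSet,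
          Complex.volume_closedBall, ← ENNReal.ofReal_pow hR0]
        have : ((NNReal.pi : NNReal) : ENNReal) = ENNReal.ofReal Real.pi := by
          rw [ENNReal.ofReal, ← NNReal.coe_real_pi, Real.toNNReal_coe]
        rw [this, ← ENNReal.ofReal_mul (by positivity), ← ENNReal.ofReal_mul (by positivity)]
    _ ≤ _ := by
        refine ENNReal.ofReal_le_ofReal (le_of_eq_of_le
          (?_ : _ = 3 * Real.pi * (a * b * a)) ?_)
        · rw [hR]; field_simp; ring
        · refine mul_le_mul_of_nonneg_left ?_ (by positivity)
          nlinarith [mul_le_mul_of_nonneg_left hab (mul_pos ha hb).le]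

/-- The input frequency of largest modulation fixed, sum of the two other lengths thin. -/
theorem fixed_input_same_signs {N a b c ε ε₁ δ : ℝ} (hN : 0 < N) (ha : 0 < a) (hab : a ≤ b)
    (hε : ε = 1 ∨ ε = -1) (hε₁ : ε₁ = 1 ∨ ε₁ = -1) (hδ : 0 ≤ δ) (hδ2 : δ ≤ 2 * a ^ 3)
    (hc : |c + ε₁ * N| ≤ b ^ 3) :
    ∫⁻ z : ℂ, nullWeight (ε₁ * ε) ‖z‖ N ‖(N : ℂ) + z‖ *
      ind (|ε * ‖z‖ + ε * ‖(N : ℂ) + z‖ - c| ≤ δ) ≤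
      ENNReal.ofReal (64 * Real.pi * (a * b ^ 2)) := by
  have hb : 0 < b := ha.trans_le hab
  have hpi := Real.pi_pos
  have hσ : ε₁ * ε = 1 ∨ ε₁ * ε = -1 := by
    rcases hε with rfl | rfl <;> rcases hε₁ with rfl | rfl <;> simp
  have hGm : Measurable fun p : ℝ × ℝ =>
      nullWeight (ε₁ * ε) p.1 N p.2 * ind (|ε * p.1 + ε * p.2 - c| ≤ δ) :=
    (measurable_nullWeight _ measurable_fst measurable_const measurable_snd).mul
      (measurable_ind (measurableSet_le (by fun_prop) measurable_const))
  refine (lintegral_le_elliptic_of_le hN (G := fun r s => nullWeight (ε₁ * ε) r N s *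
    ind (|ε * r + ε * s - c| ≤ δ)) hGm (fun μ _ => ENNReal.ofReal 2 *
    (ENNReal.ofReal (N * Real.sinh μ) * ind (|N * Real.cosh μ - ε * c| ≤ δ)) +
    ENNReal.ofReal (4 * N * (if N ≤ 2 * b ^ 3 then 1 else 0)) *
      ind (|N * Real.cosh μ - ε * c| ≤ δ)) ?_).trans ?_
  · intro μ ν r s hμ hr hs hr' hs'
    rw [← mul_assoc, ofReal_mul_nullWeight_snd _ hN hr hs, ← mul_assoc, ← add_mul,
      ← ENNReal.ofReal_mul (by positivity)]
    have e1 : ε * r + ε * s - c = ε * (N * Real.cosh μ) - c := by rw [hr', hs']; ring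
    rw [e1, abs_sub_mul_of_sign hε]
    by_cases hQ : |N * Real.cosh μ - ε * c| ≤ δ
    swap
    · rw [ind_of_false hQ]; simp
    refine mul_le_mul' ?_ le_rfl
    have hsinh : 0 < Real.sinh μ := Real.sinh_pos_iff.2 hμ
    have hC := cosh_sub_one_le_sinh hμ.le
    have hC1 := Real.one_le_cosh μ
    have hk1 := Real.cos_le_one ν
    have hk2 := Real.neg_one_le_cos ν
    rcases hσ with h | h
    · have hε' : ε₁ = ε := by rcases hε with rfl | rfl <;> rcases hε₁ with rfl | rfl <;>
        first | rfl | norm_num at h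
      have hNb : N ≤ 2 * b ^ 3 := by
        have h2 := abs_le.1 hQ
        have h3 := abs_le.1 hc
        have h4 : a ^ 3 ≤ b ^ 3 := pow_le_pow_left₀ ha.le hab 3
        have h5 : N ≤ N * Real.cosh μ := le_mul_of_one_le_right hN.le hC1
        rcases hε with rfl | rfl <;> rw [hε'] at h3 <;> linarith
      rw [if_pos hNb, h, ← ENNReal.ofReal_add (by positivity) (by positivity)]
      refine ENNReal.ofReal_le_ofReal ?_
      have e2 : r ^ 2 - (N + 1 * s) ^ 2 = -(N ^ 2 * ((1 + Real.cos ν) * (Real.cosh μ + 1))) := by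
        rw [hr', hs']; ring
      rw [e2, abs_neg, abs_of_nonneg (mul_nonneg (sq_nonneg _) (mul_nonneg (by linarith) (by linarith)))]
      have e3 : N ^ 2 * ((1 + Real.cos ν) * (Real.cosh μ + 1)) / N =
          N * ((1 + Real.cos ν) * (Real.cosh μ + 1)) := by field_simp
      rw [e3]
      have : (1 + Real.cos ν) * (Real.cosh μ + 1) ≤ 2 * (Real.sinh μ + 2) :=
        mul_le_mul (by linarith) (by linarith) (by linarith) (by norm_num)
      nlinarith
    · refine le_add_right (ENNReal.ofReal_le_ofReal ?_)
      have e2 : r ^ 2 - (N + -1 * s) ^ 2 = N ^ 2 * ((1 - Real.cos ν) * (Real.cosh μ - 1)) := by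
        rw [hr', hs']; ring
      rw [h, e2, abs_of_nonneg (mul_nonneg (sq_nonneg _) (mul_nonneg (by linarith) (by linarith)))]
      have e3 : N ^ 2 * ((1 - Real.cos ν) * (Real.cosh μ - 1)) / N =
          N * ((1 - Real.cos ν) * (Real.cosh μ - 1)) := by field_simp
      rw [e3]
      have : (1 - Real.cos ν) * (Real.cosh μ - 1) ≤ 2 * Real.sinh μ :=
        mul_le_mul (by linarith) (by linarith) (by linarith) (by norm_num)
      nlinarith
  · simp_rw [setLIntegral_Ioo_neg_pi_pi_const]
    rw [lintegral_mul_const' _ _ ENNReal.ofReal_ne_top]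
    have hm : Measurable fun μ : ℝ => ENNReal.ofReal 2 *
        (ENNReal.ofReal (N * Real.sinh μ) * ind (|N * Real.cosh μ - ε * c| ≤ δ)) := by
      refine measurable_const.mul (Measurable.mul ?_ ?_)
      · exact ENNReal.measurable_ofReal.comp (by fun_prop)
      · exact measurable_ind (measurableSet_le (by fun_prop) measurable_const)
    rw [lintegral_add_left hm, lintegral_const_mul' _ _ ENNReal.ofReal_ne_top,
      lintegral_const_mul' _ _ ENNReal.ofReal_ne_top]
    refine (mul_le_mul' (add_le_add
      (mul_le_mul' le_rfl (lintegral_sinh_mul_ind_le (ε * c) hN))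
      (mul_le_mul' le_rfl (volume_cosh_sublevel_le (ε * c) hN))) le_rfl).trans ?_
    have hif : (0 : ℝ) ≤ 4 * N * (if N ≤ 2 * b ^ 3 then 1 else 0) := by
      split_ifs <;> positivity
    rw [← ENNReal.ofReal_mul (by norm_num), ← ENNReal.ofReal_mul hif,
      ← ENNReal.ofReal_add (by positivity) (by positivity), ← ENNReal.ofReal_mul (by positivity)]
    refine ENNReal.ofReal_le_ofReal ?_
    have ha3 : a ^ 3 ≤ a * b ^ 2 := by nlinarith [mul_le_mul hab hab ha.le hb.le]
    have hfin : 4 * N * (if N ≤ 2 * b ^ 3 then 1 else 0) * (2 * Real.sqrt (δ / N)) ≤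
        16 * (a * b ^ 2) := by
      split_ifs with hNb
      · have h1 : N * Real.sqrt (δ / N) = Real.sqrt (N * δ) := by
          rw [← Real.sqrt_sq hN.le, ← Real.sqrt_mul (sq_nonneg N), Real.sqrt_sq hN.le]
          congr 1; field_simp
        have h2 : Real.sqrt (N * δ) ≤ 2 * (a * b ^ 2) := by
          rw [Real.sqrt_le_left (by positivity)]
          calc N * δ ≤ (2 * b ^ 3) * (2 * a ^ 3) := mul_le_mul hNb hδ2 hδ (by positivity)
            _ = 4 * (a ^ 2 * b ^ 3) * a := by ring
            _ ≤ 4 * (a ^ 2 * b ^ 3) * b := by gcongr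
            _ = _ := by ring
        nlinarith
      · simp; positivity
    nlinarith

/-- The region of an interaction where the angular variable of elliptic coordinates with foci at
distance `N` dominates. The lengths of the two remaining frequencies are `r` and `s`. -/
def AngularRegion (a N r s : ℝ) : Prop :=
  r + s ≤ 9 * N ∨
    (r + s) * a ^ 2 ≤ N * (N ^ (1 / 3 : ℝ)) ^ 2 * Real.sqrt (1 - ((s - r) / N) ^ 2)

theorem measurableSet_angularRegion {α : Type*} [MeasurableSpace α] {f g h : α → ℝ} (a : ℝ)
    (hf : Measurable f) (hg : Measurable g) (hh : Measurable h) :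
    MeasurableSet {x | AngularRegion a (f x) (g x) (h x)} := by
  refine MeasurableSet.union (measurableSet_le (hg.add hh) (measurable_const.mul hf))
    (measurableSet_le ((hg.add hh).mul_const _) ?_)
  exact (hf.mul ((hf.pow_const _).pow_const _)).mul
    (measurable_const.sub (((hh.sub hg).div hf).pow_const _)).sqrt

open scoped Classical in
/-- The input frequency of largest modulation fixed, difference of the two other lengths thin, on
the angular region. -/
theorem fixed_input_opposite_signs {N a b c ε ε₁ δ : ℝ} (hN : 0 < N) (ha : 0 < a) (hab : a ≤ b)
    (hε : ε = 1 ∨ ε = -1) (hε₁ : ε₁ = 1 ∨ ε₁ = -1) (hδ : 0 ≤ δ) (hδ2 : δ ≤ 2 * a ^ 3)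
    (hc : |c + ε₁ * N| ≤ b ^ 3) :
    ∫⁻ z : ℂ, nullWeight (ε₁ * -ε) ‖z‖ N ‖(N : ℂ) + z‖ *
      ind (AngularRegion a N ‖z‖ ‖(N : ℂ) + z‖) *
      ind (|ε * ‖z‖ + -ε * ‖(N : ℂ) + z‖ - c| ≤ δ) ≤
      ENNReal.ofReal (200 * Real.pi * (a * b ^ 2)) := by
  have hb : 0 < b := ha.trans_le hab
  have hpi := Real.pi_pos
  set h := N ^ (1 / 3 : ℝ) with hh
  have hh0 : 0 < h := Real.rpow_pos_of_pos hN _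
  have hh3 : h ^ 3 = N := by
    rw [hh, ← Real.rpow_natCast, ← Real.rpow_mul hN.le]; norm_num
  set σ := ε₁ * -ε with hσd
  have hσ : σ = 1 ∨ σ = -1 := by
    rcases hε with rfl | rfl <;> rcases hε₁ with rfl | rfl <;> simp [hσd]
  have hGm : Measurable fun p : ℝ × ℝ =>
      nullWeight σ p.1 N p.2 * ind (AngularRegion a N p.1 p.2) *
        ind (|ε * p.1 + -ε * p.2 - c| ≤ δ) :=
    ((measurable_nullWeight _ measurable_fst measurable_const measurable_snd).mul
      (measurable_ind (measurableSet_angularRegion a measurable_const measurable_fst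
        measurable_snd))).mul
      (measurable_ind (measurableSet_le (by fun_prop) measurable_const))
  set D : ℝ → ℝ := fun ν => N * (1 + σ * Real.cos ν) with hD
  have hDm : Measurable D := by fun_prop
  have hD0 : ∀ ν, 0 ≤ D ν := by
    intro ν
    have h1 := Real.cos_le_one ν
    have h2 := Real.neg_one_le_cos ν
    refine mul_nonneg hN.le ?_
    rcases hσ with h | h <;> rw [h] <;> linarith
  have hD2 : ∀ ν, D ν ≤ 2 * N := by
    intro ν
    have h1 := Real.cos_le_one ν
    have h2 := Real.neg_one_le_cos ν
    rw [mul_comm 2]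
    refine mul_le_mul_of_nonneg_left ?_ hN.le
    rcases hσ with h | h <;> rw [h] <;> linarith
  set P : ℝ → ENNReal := fun ν => ENNReal.ofReal (D ν) * ind (D ν ≤ 3 * b ^ 3) *
    ind (|N * Real.cos ν - -ε * c| ≤ δ) with hP
  have hPm : Measurable P :=
    ((ENNReal.measurable_ofReal.comp hDm).mul
      (measurable_ind (measurableSet_le hDm measurable_const))).mul
      (measurable_ind (measurableSet_le (by fun_prop) measurable_const))
  set R : ℝ → ℝ := fun ν => h ^ 2 / a ^ 2 * |Real.sin ν| with hR
  have hRm : Measurable R := by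
    simp only [hR]; exact measurable_const.mul (by fun_prop : Measurable fun ν : ℝ => |Real.sin ν|)
  have hA : Measurable fun p : ℝ × ℝ =>
      ENNReal.ofReal (Real.cosh p.1 + 1) * ind (Real.cosh p.1 ≤ 9) :=
    (ENNReal.measurable_ofReal.comp (by fun_prop)).mul
      (measurable_ind (measurableSet_le (by fun_prop) measurable_const))
  have hB : Measurable fun p : ℝ × ℝ =>
      ENNReal.ofReal (Real.cosh p.1 + 1) * ind (Real.cosh p.1 ≤ R p.2) :=
    (ENNReal.measurable_ofReal.comp (by fun_prop)).mul
      (measurable_ind (measurableSet_le (by fun_prop) (hRm.comp measurable_snd)))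
  have hHm : Measurable fun p : ℝ × ℝ => P p.2 *
      (ENNReal.ofReal (Real.cosh p.1 + 1) * ind (Real.cosh p.1 ≤ 9) +
        ENNReal.ofReal (Real.cosh p.1 + 1) * ind (Real.cosh p.1 ≤ R p.2)) :=
    (hPm.comp measurable_snd).mul (hA.add hB)
  refine (lintegral_le_elliptic_of_le hN (G := fun r s => nullWeight σ r N s *
    ind (AngularRegion a N r s) * ind (|ε * r + -ε * s - c| ≤ δ)) hGm (fun μ ν => P ν *
      (ENNReal.ofReal (Real.cosh μ + 1) * ind (Real.cosh μ ≤ 9) +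
        ENNReal.ofReal (Real.cosh μ + 1) * ind (Real.cosh μ ≤ R ν))) ?_).trans ?_
  · intro μ ν r s hμ hr hs hr' hs'
    rw [← mul_assoc, ← mul_assoc, ofReal_mul_nullWeight_snd _ hN hr hs]
    have e1 : ε * r + -ε * s - c = -ε * (N * Real.cos ν) - c := by rw [hr', hs']; ring
    have hε' : -ε = 1 ∨ -ε = -1 := by rcases hε with rfl | rfl <;> simp
    have hsum : r + s = N * Real.cosh μ := by rw [hr', hs']; ring
    have hdiff : (s - r) / N = Real.cos ν := by rw [hr', hs']; field_simp; ring
    rw [e1, abs_sub_mul_of_sign hε']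
    by_cases hQ : |N * Real.cos ν - -ε * c| ≤ δ
    swap
    · rw [ind_of_false hQ]; simp
    by_cases hO : AngularRegion a N r s
    swap
    · rw [ind_of_false hO]; simp
    have hC1 := Real.one_le_cosh μ
    have hDb : D ν ≤ 3 * b ^ 3 := by
      have h2 := abs_le.1 hQ
      have h3 := abs_le.1 hc
      have h4 : a ^ 3 ≤ b ^ 3 := pow_le_pow_left₀ ha.le hab 3
      simp only [hD, hσd]
      rcases hε with rfl | rfl <;> rcases hε₁ with rfl | rfl <;> linarith
    have hw : |r ^ 2 - (N + σ * s) ^ 2| / N ≤ D ν * (Real.cosh μ + 1) := by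
      rw [div_le_iff₀ hN]
      have hk1 := Real.cos_le_one ν
      have hk2 := Real.neg_one_le_cos ν
      rcases hσ with h | h
      · have e2 : r ^ 2 - (N + σ * s) ^ 2 =
            -(N ^ 2 * ((1 + Real.cos ν) * (Real.cosh μ + 1))) := by
          rw [hr', hs', h]; ring
        rw [e2, abs_neg, abs_of_nonneg
          (mul_nonneg (sq_nonneg _) (mul_nonneg (by linarith) (by linarith)))]
        simp only [hD, h]
        exact le_of_eq (by ring)
      · have e2 : r ^ 2 - (N + σ * s) ^ 2 = N ^ 2 * ((1 - Real.cos ν) * (Real.cosh μ - 1)) := by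
          rw [hr', hs', h]; ring
        rw [e2, abs_of_nonneg
          (mul_nonneg (sq_nonneg _) (mul_nonneg (by linarith) (by linarith)))]
        have : N ^ 2 * ((1 - Real.cos ν) * (Real.cosh μ - 1)) ≤
            N ^ 2 * ((1 - Real.cos ν) * (Real.cosh μ + 1)) :=
          mul_le_mul_of_nonneg_left (mul_le_mul_of_nonneg_left (by linarith) (by linarith))
            (sq_nonneg N)
        refine this.trans (le_of_eq ?_)
        simp only [hD, h]; ring
    simp only [hP]
    rw [ind_of_true hQ, ind_of_true hO, ind_of_true hDb, mul_one, mul_one, mul_one, mul_one]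
    refine (ENNReal.ofReal_le_ofReal hw).trans ?_
    rw [ENNReal.ofReal_mul (hD0 ν)]
    refine mul_le_mul' le_rfl ?_
    rcases hO with hO | hO
    · have : Real.cosh μ ≤ 9 := by
        rw [hsum, mul_comm 9] at hO
        exact le_of_mul_le_mul_left hO hN
      rw [ind_of_true this, mul_one]
      exact le_add_right le_rfl
    · have : Real.cosh μ ≤ R ν := by
        rw [hsum, hdiff, ← Real.abs_sin_eq_sqrt_one_sub_cos_sq, ← hh] at hO
        have h2 : N * (Real.cosh μ * a ^ 2) ≤ N * (h ^ 2 * |Real.sin ν|) := by linarith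
        have h3 := le_of_mul_le_mul_left h2 hN
        simp only [hR]
        rw [div_mul_eq_mul_div, le_div_iff₀ (by positivity)]
        exact h3
      rw [ind_of_true this, mul_one]
      exact le_add_left le_rfl
  rw [lintegral_lintegral_swap hHm.aemeasurable]
  have hinner : ∀ ν : ℝ, ∫⁻ μ in Set.Ioi (0 : ℝ), P ν *
      (ENNReal.ofReal (Real.cosh μ + 1) * ind (Real.cosh μ ≤ 9) +
        ENNReal.ofReal (Real.cosh μ + 1) * ind (Real.cosh μ ≤ R ν)) ≤
      ENNReal.ofReal (18 * Real.sqrt (6 * b ^ 3 * N)) * ind (|N * Real.cos ν - -ε * c| ≤ δ) +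
      ENNReal.ofReal (6 * b ^ 2 / a ^ 2) *
        (ENNReal.ofReal (N * |Real.sin ν|) * ind (|N * Real.cos ν - -ε * c| ≤ δ)) := by
    intro ν
    have hAm : Measurable fun μ : ℝ =>
        ENNReal.ofReal (Real.cosh μ + 1) * ind (Real.cosh μ ≤ 9) :=
      (ENNReal.measurable_ofReal.comp (by fun_prop)).mul
        (measurable_ind (measurableSet_le (by fun_prop) measurable_const))
    have hBm : Measurable fun μ : ℝ =>
        ENNReal.ofReal (Real.cosh μ + 1) * ind (Real.cosh μ ≤ R ν) :=
      (ENNReal.measurable_ofReal.comp (by fun_prop)).mul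
        (measurable_ind (measurableSet_le (by fun_prop) measurable_const))
    have hABm : Measurable fun μ : ℝ =>
        ENNReal.ofReal (Real.cosh μ + 1) * ind (Real.cosh μ ≤ 9) +
        ENNReal.ofReal (Real.cosh μ + 1) * ind (Real.cosh μ ≤ R ν) := hAm.add hBm
    rw [lintegral_const_mul _ hABm, lintegral_add_left hAm]
    refine (mul_le_mul' le_rfl (add_le_add (lintegral_cosh_add_one_le 9)
      (lintegral_cosh_add_one_le (R ν)))).trans ?_
    simp only [hP]
    by_cases hQ : |N * Real.cos ν - -ε * c| ≤ δ
    swap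
    · rw [ind_of_false hQ]; simp
    by_cases hDb : D ν ≤ 3 * b ^ 3
    swap
    · rw [ind_of_false hDb]; simp
    rw [ind_of_true hQ, ind_of_true hDb, mul_one, mul_one, mul_one, mul_one]
    have hR0 : 0 ≤ R ν := by simp only [hR]; positivity
    rw [mul_add, ← ENNReal.ofReal_mul (hD0 ν), ← ENNReal.ofReal_mul (hD0 ν),
      ← ENNReal.ofReal_mul (by positivity)]
    have hd1 : D ν ≤ Real.sqrt (6 * b ^ 3 * N) := by
      refine Real.le_sqrt_of_sq_le ?_
      nlinarith [mul_le_mul hDb (hD2 ν) (hD0 ν) (by positivity)]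
    have hd2 : D ν ≤ 3 * b ^ 2 * h := by
      refine le_of_pow_le_pow_left₀ (n := 3) (by norm_num) (by positivity) ?_
      have h1 : D ν * D ν ≤ (3 * b ^ 3) * (3 * b ^ 3) :=
        mul_le_mul hDb hDb (hD0 ν) (by positivity)
      have h2 := mul_le_mul h1 (hD2 ν) (hD0 ν) (by positivity)
      have h3 : 0 ≤ b ^ 6 * N := by positivity
      calc D ν ^ 3 = D ν * D ν * D ν := by ring
        _ ≤ 3 * b ^ 3 * (3 * b ^ 3) * (2 * N) := h2
        _ = 18 * (b ^ 6 * N) := by ring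
        _ ≤ 27 * (b ^ 6 * N) := by linarith
        _ = (3 * b ^ 2 * h) ^ 3 := by rw [← hh3]; ring
    refine add_le_add (ENNReal.ofReal_le_ofReal (by linarith)) (ENNReal.ofReal_le_ofReal ?_)
    calc D ν * (2 * R ν) ≤ 3 * b ^ 2 * h * (2 * R ν) := by gcongr
      _ = 6 * b ^ 2 / a ^ 2 * (h ^ 3 * |Real.sin ν|) := by simp only [hR]; field_simp; ring
      _ = _ := by rw [hh3]
  refine (lintegral_mono hinner).trans ?_
  have hIm : Measurable fun ν : ℝ => ENNReal.ofReal (18 * Real.sqrt (6 * b ^ 3 * N)) *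
      ind (|N * Real.cos ν - -ε * c| ≤ δ) :=
    measurable_const.mul (measurable_ind (measurableSet_le (by fun_prop) measurable_const))
  rw [lintegral_add_left hIm, lintegral_const_mul' _ _ ENNReal.ofReal_ne_top,
    lintegral_const_mul' _ _ ENNReal.ofReal_ne_top]
  refine (add_le_add (mul_le_mul' le_rfl (volume_cos_sublevel_le (-ε * c) hN))
    (mul_le_mul' le_rfl (lintegral_abs_sin_mul_ind_le (-ε * c) hN hδ))).trans ?_
  rw [← ENNReal.ofReal_mul (by positivity), ← ENNReal.ofReal_mul (by positivity),
    ← ENNReal.ofReal_add (by positivity) (by positivity)]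
  refine ENNReal.ofReal_le_ofReal ?_
  have h1 : Real.sqrt (6 * b ^ 3 * N) * Real.sqrt (δ / N) ≤ 4 * (a * b ^ 2) := by
    rw [← Real.sqrt_mul (by positivity), Real.sqrt_le_left (by positivity)]
    calc 6 * b ^ 3 * N * (δ / N) = 6 * b ^ 3 * δ := by field_simp
      _ ≤ 6 * b ^ 3 * (2 * a ^ 3) := by gcongr
      _ = 12 * (a ^ 2 * b ^ 3) * a := by ring
      _ ≤ 16 * (a ^ 2 * b ^ 3) * b := by gcongr; norm_num
      _ = _ := by ring
  have h2 : 6 * b ^ 2 / a ^ 2 * (4 * δ) ≤ 48 * (a * b ^ 2) := by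
    calc 6 * b ^ 2 / a ^ 2 * (4 * δ) ≤ 6 * b ^ 2 / a ^ 2 * (4 * (2 * a ^ 3)) := by gcongr
      _ = _ := by field_simp; ring
  have h3 := Real.pi_gt_three
  have h4 : 0 < a * b ^ 2 := by positivity
  nlinarith

theorem lintegral_rpow_abs_sin_lt_top :
    ∫⁻ α in Set.Ioo (-Real.pi) Real.pi, ENNReal.ofReal |Real.sin α| ^ (-(1 / 2) : ℝ) < ⊤ := by
  have hpi := Real.pi_pos
  have half : ∫⁻ α in Set.Ioo 0 Real.pi, ENNReal.ofReal |Real.sin α| ^ (-(1 / 2) : ℝ) < ⊤ := by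
    have h1 : IntervalIntegrable (fun x : ℝ => x ^ (-(1 / 2) : ℝ)) volume 0 Real.pi :=
      intervalIntegral.intervalIntegrable_rpow' (by norm_num)
    have h2 : IntervalIntegrable (fun x : ℝ => (Real.pi - x) ^ (-(1 / 2) : ℝ)) volume 0 Real.pi := by
      have := (h1.comp_sub_left Real.pi).symm
      simpa using this
    have h3 := ((h1.add h2).const_mul ((2 / Real.pi) ^ (-(1 / 2) : ℝ)))
    rw [intervalIntegrable_iff_integrableOn_Ioo_of_le hpi.le] at h3
    refine lt_of_le_of_lt (setLIntegral_mono' measurableSet_Ioo fun x hx => ?_)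
      h3.lintegral_lt_top
    have hs : 0 < Real.sin x := Real.sin_pos_of_pos_of_lt_pi hx.1 hx.2
    rw [abs_of_pos hs, ENNReal.ofReal_rpow_of_pos hs]
    refine ENNReal.ofReal_le_ofReal ?_
    have hx1 := hx.1
    have hx2 : 0 < Real.pi - x := by linarith [hx.2]
    have key : ∀ y, 0 < y → 2 / Real.pi * y ≤ Real.sin x →
        Real.sin x ^ (-(1 / 2) : ℝ) ≤ (2 / Real.pi) ^ (-(1 / 2) : ℝ) * y ^ (-(1 / 2) : ℝ) := by
      intro y hy h
      rw [← Real.mul_rpow (by positivity) hy.le]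
      exact Real.rpow_le_rpow_of_nonpos (by positivity) h (by norm_num)
    have hc : 0 ≤ (2 / Real.pi) ^ (-(1 / 2) : ℝ) := by positivity
    have p1 : 0 ≤ x ^ (-(1 / 2) : ℝ) := by positivity
    have p2 : 0 ≤ (Real.pi - x) ^ (-(1 / 2) : ℝ) := Real.rpow_nonneg hx2.le _
    rcases le_total x (Real.pi / 2) with h | h
    · have := key x hx1 (Real.mul_le_sin hx1.le h)
      nlinarith [mul_nonneg hc p2]
    · have h4 := Real.mul_le_sin hx2.le (by linarith)
      rw [Real.sin_pi_sub] at h4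
      have := key _ hx2 h4
      nlinarith [mul_nonneg hc p1]
  refine lt_of_le_of_lt (setLIntegral_Ioo_neg_pi_pi_le _) ?_
  simp only [Real.sin_neg, abs_neg]
  exact ENNReal.add_lt_top.2 ⟨half, half⟩

theorem lintegral_cube_root_le {X : ℝ} (hX : 0 ≤ X) :
    ∫⁻ η in Set.Ioi (0 : ℝ), ENNReal.ofReal (η ^ (1 / 3 : ℝ)) *
      ind ((η ^ (1 / 3 : ℝ)) ^ 4 ≤ X) ≤ ENNReal.ofReal X := by
  set Y := X ^ (1 / 4 : ℝ) with hY
  have hY0 : 0 ≤ Y := Real.rpow_nonneg hX _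
  have hY4 : Y ^ 4 = X := by
    rw [hY, ← Real.rpow_natCast, ← Real.rpow_mul hX]; norm_num
  calc _ ≤ ∫⁻ η, (Set.Ioc 0 (Y ^ 3)).indicator (fun _ => ENNReal.ofReal Y) η := by
        rw [← lintegral_indicator measurableSet_Ioi]
        refine lintegral_mono fun η => ?_
        by_cases h0 : η ∈ Set.Ioi (0 : ℝ)
        swap
        · rw [Set.indicator_of_notMem h0]; exact zero_le
        have h0' : 0 < η := h0
        rw [Set.indicator_of_mem h0]
        by_cases h2 : (η ^ (1 / 3 : ℝ)) ^ 4 ≤ X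
        swap
        · rw [ind_of_false h2]; simp
        have h3 : η ^ (1 / 3 : ℝ) ≤ Y := by
          rw [← hY4] at h2
          exact le_of_pow_le_pow_left₀ (by norm_num) hY0 h2
        have h4 : η ≤ Y ^ 3 := by
          calc η = (η ^ (1 / 3 : ℝ)) ^ 3 := by
                rw [← Real.rpow_natCast, ← Real.rpow_mul h0'.le]; norm_num
            _ ≤ Y ^ 3 := pow_le_pow_left₀ (by positivity) h3 3
        rw [Set.indicator_of_mem (Set.mem_Ioc.2 ⟨h0', h4⟩), ind_of_true h2, mul_one]
        exact ENNReal.ofReal_le_ofReal h3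
    _ = ENNReal.ofReal X := by
        rw [lintegral_indicator_const measurableSet_Ioc, Real.volume_Ioc,
          ← ENNReal.ofReal_mul hY0, sub_zero, ← hY4]
        congr 1; ring

theorem angularRegion_comm {a N r s : ℝ} : AngularRegion a N r s ↔ AngularRegion a N s r := by
  unfold AngularRegion
  rw [add_comm r s]
  have : ((s - r) / N) ^ 2 = ((r - s) / N) ^ 2 := by
    rw [div_pow, div_pow]; congr 1; ring
  rw [this]

/-- Pointwise bound of the weight when the two long frequencies carry opposite signs. -/
theorem nullWeight_le_of_resonance {r₀ r₁ r₂ N b ε₀ ε₁ : ℝ} (h₀ : 0 < r₀) (h₁ : 0 < r₁)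
    (h₂ : 0 < r₂) (hb : 0 < b) (hN : 0 < N) (hN2 : N ≤ 2 * r₀) (h12 : r₁ ≤ r₂)
    (t₀ : r₀ ≤ r₁ + r₂) (t₁ : r₁ ≤ r₀ + r₂) (t₂ : r₂ ≤ r₀ + r₁)
    (hε₀ : ε₀ = 1 ∨ ε₀ = -1) (hε₁ : ε₁ = 1 ∨ ε₁ = -1)
    (hres : |ε₀ * r₀ + ε₁ * r₁ + -ε₀ * r₂| ≤ 3 * b ^ 3) :
    nullWeight (ε₁ * -ε₀) r₀ r₁ r₂ ≤
      ENNReal.ofReal (24 * b ^ 2 / ((r₁ ^ (1 / 3 : ℝ)) ^ 2 * N)) := by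
  refine ENNReal.ofReal_le_ofReal ?_
  set h := r₁ ^ (1 / 3 : ℝ) with hh
  have hh0 : 0 < h := Real.rpow_pos_of_pos h₁ _
  have hh3 : h ^ 3 = r₁ := by
    rw [hh, ← Real.rpow_natCast, ← Real.rpow_mul h₁.le]; norm_num
  have hσ : ε₁ * -ε₀ = 1 ∨ ε₁ * -ε₀ = -1 := by
    rcases hε₀ with rfl | rfl <;> rcases hε₁ with rfl | rfl <;> simp
  have hA := abs_sq_sub_sq_le_four_mul hσ h₁.le h₂.le h₀.le t₀ t₁ t₂
  have hB : |r₀ ^ 2 - (r₁ + ε₁ * -ε₀ * r₂) ^ 2| ≤ 12 * b ^ 3 * r₂ := by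
    have hr := abs_le.1 hres
    rcases hσ with h | h
    · have h5 : r₁ + r₂ - r₀ ≤ 3 * b ^ 3 := by
        rcases hε₀ with rfl | rfl <;> rcases hε₁ with rfl | rfl <;>
          linarith
      rw [h]
      have : r₀ ^ 2 - (r₁ + 1 * r₂) ^ 2 = -((r₁ + r₂ - r₀) * (r₀ + r₁ + r₂)) := by ring
      rw [this, abs_neg, abs_of_nonneg (mul_nonneg (by linarith) (by linarith))]
      calc (r₁ + r₂ - r₀) * (r₀ + r₁ + r₂) ≤ (3 * b ^ 3) * (4 * r₂) :=
            mul_le_mul h5 (by linarith) (by linarith) (by positivity)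
        _ = _ := by ring
    · have h5 : r₀ + r₁ - r₂ ≤ 3 * b ^ 3 := by
        rcases hε₀ with rfl | rfl <;> rcases hε₁ with rfl | rfl <;>
          linarith
      rw [h]
      have : r₀ ^ 2 - (r₁ + -1 * r₂) ^ 2 = (r₀ + r₁ - r₂) * (r₀ + r₂ - r₁) := by ring
      rw [this, abs_of_nonneg (mul_nonneg (by linarith) (by linarith))]
      calc (r₀ + r₁ - r₂) * (r₀ + r₂ - r₁) ≤ (3 * b ^ 3) * (4 * r₂) :=
            mul_le_mul h5 (by linarith) (by linarith) (by positivity)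
        _ = _ := by ring
  rw [div_le_div_iff₀ (by positivity) (by positivity)]
  set W := |r₀ ^ 2 - (r₁ + ε₁ * -ε₀ * r₂) ^ 2| with hW
  have hW0 : 0 ≤ W := abs_nonneg _
  have hmain : W * h ^ 2 ≤ 12 * b ^ 2 * (r₁ * r₂) := by
    rcases le_total h b with hhb | hhb
    · have : h ^ 2 ≤ b ^ 2 := pow_le_pow_left₀ hh0.le hhb 2
      have := mul_le_mul hA this (by positivity) (by positivity)
      have h6 : 0 ≤ b ^ 2 * (r₁ * r₂) := by positivity
      linarith
    · calc W * h ^ 2 ≤ 12 * b ^ 3 * r₂ * h ^ 2 := by gcongr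
        _ = 12 * b ^ 2 * r₂ * h ^ 2 * b := by ring
        _ ≤ 12 * b ^ 2 * r₂ * h ^ 2 * h := by gcongr
        _ = 12 * b ^ 2 * (h ^ 3 * r₂) := by ring
        _ = _ := by rw [hh3]
  calc W * (h ^ 2 * N) = W * h ^ 2 * N := by ring
    _ ≤ 12 * b ^ 2 * (r₁ * r₂) * (2 * r₀) := mul_le_mul hmain hN2 hN.le (by positivity)
    _ = _ := by ring

theorem lt_div_four_of_not_angularRegion {a η N t : ℝ} (ht : t ≤ N + η)
    (hn : ¬AngularRegion a η N t) : η < N / 4 := by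
  unfold AngularRegion at hn
  push Not at hn
  linarith [hn.1]

theorem sin_bound_of_not_angularRegion {a N η α : ℝ} (hN : 0 < N) (ha : 0 < a) (hη : 0 < η)
    (hn : ¬AngularRegion a η N (Real.sqrt (η ^ 2 + N ^ 2 + 2 * η * N * Real.cos α))) :
    (η ^ (1 / 3 : ℝ)) ^ 5 * |Real.sin α| ≤ 4 * N * a ^ 2 ∧ η < N / 4 := by
  set t := Real.sqrt (η ^ 2 + N ^ 2 + 2 * η * N * Real.cos α) with ht
  set h := η ^ (1 / 3 : ℝ) with hh
  have hh0 : 0 < h := Real.rpow_pos_of_pos hη _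
  have hh3 : h ^ 3 = η := by
    rw [hh, ← Real.rpow_natCast, ← Real.rpow_mul hη.le]; norm_num
  have hk1 := Real.cos_le_one α
  have hk2 := Real.neg_one_le_cos α
  have hηN : 0 < η * N := mul_pos hη hN
  have hrad : 0 ≤ η ^ 2 + N ^ 2 + 2 * η * N * Real.cos α := by
    nlinarith [sq_nonneg (η - N)]
  have ht2 : t ^ 2 = η ^ 2 + N ^ 2 + 2 * η * N * Real.cos α := Real.sq_sqrt hrad
  have ht0 : 0 ≤ t := Real.sqrt_nonneg _
  have htu : t ≤ N + η := by
    refine abs_le_of_sq_le_sq' (b := N + η) ?_ (by positivity) |>.2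
    nlinarith
  have hq := lt_div_four_of_not_angularRegion htu hn
  have htl : N - η ≤ t := by
    refine abs_le_of_sq_le_sq' (a := N - η) ?_ ht0 |>.2
    nlinarith
  refine ⟨?_, hq⟩
  unfold AngularRegion at hn
  push Not at hn
  have hn2 := hn.2
  rw [← hh] at hn2
  set κ := (t - N) / η with hκ
  have htκ : t = N + η * κ := by rw [hκ]; field_simp; ring
  have hκ1 : κ ≤ 1 := by rw [hκ, div_le_one hη]; linarith
  have hκ2 : -1 ≤ κ := by rw [hκ, le_div_iff₀ hη]; linarith
  set e := η / (2 * N) with he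
  have he0 : 0 < e := by positivity
  have he1 : e ≤ 1 / 8 := by rw [he, div_le_iff₀ (by positivity)]; linarith
  have hcos : Real.cos α = κ - e * (1 - κ ^ 2) := by
    have h1 : 2 * η * N * Real.cos α = 2 * η * N * (κ - e * (1 - κ ^ 2)) := by
      have : 2 * η * N * Real.cos α = t ^ 2 - η ^ 2 - N ^ 2 := by linarith
      rw [this, htκ, he]; field_simp; ring
    exact mul_left_cancel₀ (by positivity) h1
  set w := 1 - κ ^ 2 with hw
  have hw0 : 0 ≤ w := by nlinarith
  have hsin2 : Real.sin α ^ 2 ≤ (3 / 2) ^ 2 * w := by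
    have : Real.sin α ^ 2 = w + 2 * κ * e * w - e ^ 2 * w ^ 2 := by
      have := Real.sin_sq_add_cos_sq α
      rw [hcos] at this
      linear_combination this
    rw [this]
    have h1 : κ * e ≤ 1 / 8 := by nlinarith
    nlinarith [sq_nonneg (e * w), mul_le_mul_of_nonneg_right h1 hw0]
  have hsin : |Real.sin α| ≤ 3 / 2 * Real.sqrt w := by
    rw [← Real.sqrt_sq_eq_abs]
    refine (Real.sqrt_le_sqrt hsin2).trans ?_
    rw [Real.sqrt_mul (by positivity), Real.sqrt_sq (by norm_num)]
  have hsw : h ^ 5 * Real.sqrt w ≤ 9 / 4 * N * a ^ 2 := by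
    have h1 : h ^ 5 * Real.sqrt w = η * h ^ 2 * Real.sqrt w := by rw [← hh3]; ring
    rw [h1]
    refine hn2.le.trans ?_
    refine mul_le_mul_of_nonneg_right ?_ (sq_nonneg a)
    linarith
  have h5 : 0 < N * a ^ 2 := by positivity
  calc h ^ 5 * |Real.sin α| ≤ h ^ 5 * (3 / 2 * Real.sqrt w) := by gcongr
    _ = 3 / 2 * (h ^ 5 * Real.sqrt w) := by ring
    _ ≤ _ := by linarith

open scoped Classical in
/-- Off the angular region, polar coordinates around the short frequency. -/
theorem lintegral_radialRegion_le {N a b : ℝ} (hN : 0 < N) (ha : 0 < a) :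
    ∫⁻ z : ℂ, ENNReal.ofReal (24 * b ^ 2 / ((‖z‖ ^ (1 / 3 : ℝ)) ^ 2 * N)) *
      ind (¬AngularRegion a ‖z‖ N ‖(N : ℂ) + z‖) ≤
      ENNReal.ofReal (24 * (a * b ^ 2)) *
        ∫⁻ α in Set.Ioo (-Real.pi) Real.pi, ENNReal.ofReal |Real.sin α| ^ (-(1 / 2) : ℝ) := by
  have hGm : Measurable fun p : ℝ × ℝ =>
      ENNReal.ofReal (24 * b ^ 2 / ((p.1 ^ (1 / 3 : ℝ)) ^ 2 * N)) *
        ind (¬AngularRegion a p.1 N p.2) := by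
    refine Measurable.mul (ENNReal.measurable_ofReal.comp ?_) (measurable_ind
      (measurableSet_angularRegion a measurable_fst measurable_const measurable_snd).compl)
    exact measurable_const.div (((measurable_fst.pow_const _).pow_const _).mul_const _)
  refine (lintegral_le_polar (N := N) (G := fun η t =>
    ENNReal.ofReal (24 * b ^ 2 / ((η ^ (1 / 3 : ℝ)) ^ 2 * N)) *
        ind (¬AngularRegion a η N t)) hGm).trans ?_
  rw [← lintegral_const_mul' _ _ ENNReal.ofReal_ne_top]
  refine lintegral_mono fun α => ?_
  have hab : 0 ≤ a * b ^ 2 := by positivity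
  rcases (abs_nonneg (Real.sin α)).eq_or_lt with hs | hs
  · rcases hab.eq_or_lt with h0 | h0
    · have hb : b = 0 := by
        rcases mul_eq_zero.1 h0.symm with h | h
        · exact absurd h ha.ne'
        · exact pow_eq_zero_iff (two_ne_zero) |>.1 h
      simp [hb]
    · rw [← hs, ENNReal.ofReal_zero, ENNReal.zero_rpow_of_neg (by norm_num), ENNReal.mul_top]
      · exact le_top
      · simpa using h0
  set X := N * a * |Real.sin α| ^ (-(1 / 2) : ℝ) with hX
  have hX0 : 0 ≤ X := by positivity
  calc _ ≤ ∫⁻ η in Set.Ioi (0 : ℝ), ENNReal.ofReal (24 * b ^ 2 / N) *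
        (ENNReal.ofReal (η ^ (1 / 3 : ℝ)) * ind ((η ^ (1 / 3 : ℝ)) ^ 4 ≤ X)) := by
        refine setLIntegral_mono' measurableSet_Ioi fun η hη => ?_
        have hη' : 0 < η := hη
        by_cases hA : AngularRegion a η N (Real.sqrt (η ^ 2 + N ^ 2 + 2 * η * N * Real.cos α))
        · rw [ind_of_false (not_not.2 hA)]; simp
        obtain ⟨h1, h2⟩ := sin_bound_of_not_angularRegion hN ha hη' hA
        set h := η ^ (1 / 3 : ℝ) with hh
        have hh0 : 0 < h := Real.rpow_pos_of_pos hη' _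
        have hh3 : h ^ 3 = η := by
          rw [hh, ← Real.rpow_natCast, ← Real.rpow_mul hη'.le]; norm_num
        have h4 : h ^ 4 ≤ X := by
          refine abs_le_of_sq_le_sq' (a := h ^ 4) (b := X) ?_ hX0 |>.2
          have hXs : X ^ 2 = N ^ 2 * a ^ 2 / |Real.sin α| := by
            rw [hX, mul_pow, mul_pow, ← Real.rpow_natCast (_ ^ _), ← Real.rpow_mul hs.le]
            have : (-(1 / 2) : ℝ) * ((2 : ℕ) : ℝ) = -1 := by norm_num
            rw [this, Real.rpow_neg_one, div_eq_mul_inv]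
          rw [hXs, le_div_iff₀ hs]
          calc (h ^ 4) ^ 2 * |Real.sin α| = h ^ 5 * |Real.sin α| * h ^ 3 := by ring
            _ ≤ 4 * N * a ^ 2 * (N / 4) := by
              rw [hh3]; exact mul_le_mul h1 h2.le hη'.le (by positivity)
            _ = _ := by ring
        rw [ind_of_true hA, ind_of_true h4, mul_one, mul_one, ← ENNReal.ofReal_mul hη'.le,
          ← ENNReal.ofReal_mul (by positivity)]
        refine ENNReal.ofReal_le_ofReal (le_of_eq ?_)
        rw [← hh3]; field_simp
    _ ≤ ENNReal.ofReal (24 * b ^ 2 / N) * ENNReal.ofReal X := by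
        rw [lintegral_const_mul' _ _ ENNReal.ofReal_ne_top]
        exact mul_le_mul' le_rfl (lintegral_cube_root_le hX0)
    _ = _ := by
        rw [ENNReal.ofReal_rpow_of_pos hs, ← ENNReal.ofReal_mul (by positivity),
          ← ENNReal.ofReal_mul (by positivity), hX]
        congr 1; field_simp

theorem MeasWeight.mul_ind {V : ℝ → ℝ → ℝ → ENNReal} (hV : MeasWeight V)
    {P : ℝ → ℝ → ℝ → Prop} [∀ r s t, Decidable (P r s t)]
    (hP : MeasurableSet {p : ℝ × ℝ × ℝ | P p.1 p.2.1 p.2.2}) :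
    MeasWeight fun r s t => V r s t * ind (P r s t) :=
  Measurable.mul hV (measurable_ind hP)

open scoped Classical in
theorem trilin_le_split {V : ℝ → ℝ → ℝ → ENNReal} (hV : MeasWeight V) (P : ℝ → ℝ → ℝ → Prop)
    (hP : MeasurableSet {p : ℝ × ℝ × ℝ | P p.1 p.2.1 p.2.2})
    {f₀ f₁ f₂ : SpaceTime → ENNReal} (h₀ : Measurable f₀) (h₁ : Measurable f₁)
    (h₂ : Measurable f₂) :
    trilin V f₀ f₁ f₂ ≤ trilin (fun r s t => V r s t * ind (P r s t)) f₀ f₁ f₂ +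
      trilin (fun r s t => V r s t * ind (¬P r s t)) f₀ f₁ f₂ := by
  refine le_trans (trilin_mono fun a b _ _ _ => ?_) (trilin_add_le (hV.mul_ind hP) h₀ h₁ h₂)
  by_cases h : P ‖a.2‖ ‖b.2‖ ‖a.2 + b.2‖
  · rw [ind_of_true h, mul_one]; exact le_add_right le_rfl
  · rw [ind_of_true h, mul_one]; exact le_add_left le_rfl

theorem trilin_le_of_fixed_cubes {V : ℝ → ℝ → ℝ → ENNReal} (hV : MeasWeight V)
    {f₀ f₁ f₂ : SpaceTime → ENNReal} (h₀ : Measurable f₀) (h₁ : Measurable f₁)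
    (h₂ : Measurable f₂) {ε₀ ε₁ ε₂ L₀ L₁ L₂ d a b K : ℝ} (s₀ : NearCone ε₀ L₀ f₀)
    (s₁ : NearCone ε₁ L₁ f₁) (s₂ : NearCone ε₂ L₂ f₂) (hd : 0 < d) (hda : d ≤ a) (hab : a ≤ b)
    (hK : 0 ≤ K) (hm : min L₁ L₂ ≤ d ^ 3)
    (hA : ∀ N c : ℝ, 0 < N → |c + ε₀ * N| ≤ L₀ →
      ∫⁻ z : ℂ, V N ‖z‖ ‖(N : ℂ) + z‖ *
        ind (|ε₁ * ‖z‖ + ε₂ * ‖(N : ℂ) + z‖ - c| ≤ L₁ + L₂) ≤ ENNReal.ofReal (K * (a * b ^ 2))) :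
    trilin V f₀ f₁ f₂ ≤
      ENNReal.ofReal (Real.sqrt (2 * K) * (d * a * b)) * (nrm f₀ * (nrm f₁ * nrm f₂)) := by
  have ha : 0 < a := hd.trans_le hda
  have hb : 0 < b := ha.trans_le hab
  refine (trilin_le_of_fixed hV h₀ h₁ h₂ s₀ s₁ s₂ hm hA).trans (mul_le_mul' ?_ le_rfl)
  rw [← ENNReal.ofReal_mul (by positivity),
    ENNReal.ofReal_rpow_of_nonneg (by positivity) (by norm_num), ← Real.sqrt_eq_rpow]
  refine ENNReal.ofReal_le_ofReal ?_
  rw [← Real.sqrt_sq (by positivity : 0 ≤ d * a * b), ← Real.sqrt_mul (by positivity)]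
  refine Real.sqrt_le_sqrt ?_
  calc 2 * d ^ 3 * (K * (a * b ^ 2)) = 2 * K * (d ^ 2 * a * b ^ 2) * d := by ring
    _ ≤ 2 * K * (d ^ 2 * a * b ^ 2) * a := by gcongr
    _ = _ := by ring

theorem trilin_nullWeight_swap {σ : ℝ} (hσ : σ = 1 ∨ σ = -1) (f₀ f₁ f₂ : SpaceTime → ENNReal) :
    trilin (nullWeight σ) f₀ f₁ f₂ = trilin (nullWeight σ) f₀ f₂ f₁ := by
  rw [trilin_swap_right]
  congr 1
  funext r₀ r₂ r₁
  unfold nullWeight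
  congr 2
  · congr 2
    rcases hσ with rfl | rfl <;> ring
  · ring

theorem mul_ind_mul_ind_le (x : ENNReal) (P Q : Prop) [Decidable P] [Decidable Q] :
    x * ind P * ind Q ≤ x * ind P :=
  mul_le_of_le_one_right' (ind_le_one Q)

/-- A bound, up to a multiple of `a * b ^ 2`, for all the integrals of weights over level sets. -/
def weightConst : ℝ :=
  200 * Real.pi + 24 * (∫⁻ α in Set.Ioo (-Real.pi) Real.pi,
    ENNReal.ofReal |Real.sin α| ^ (-(1 / 2) : ℝ)).toReal

theorem le_weightConst : 200 * Real.pi ≤ weightConst :=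
  le_add_of_nonneg_right (by positivity)

theorem weightConst_nonneg : 0 ≤ weightConst :=
  le_trans (by positivity) le_weightConst

theorem ofReal_mul_le_weightConst {k x : ℝ} (hk : k ≤ 200 * Real.pi) (hx : 0 ≤ x) :
    ENNReal.ofReal (k * x) ≤ ENNReal.ofReal (weightConst * x) :=
  ENNReal.ofReal_le_ofReal (mul_le_mul_of_nonneg_right (hk.trans le_weightConst) hx)

open scoped Classical in
theorem lintegral_radialRegion_le_weightConst {N a b : ℝ} (hN : 0 < N) (ha : 0 < a) :
    ∫⁻ z : ℂ, ENNReal.ofReal (24 * b ^ 2 / ((‖z‖ ^ (1 / 3 : ℝ)) ^ 2 * N)) *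
      ind (¬AngularRegion a ‖z‖ N ‖(N : ℂ) + z‖) ≤ ENNReal.ofReal (weightConst * (a * b ^ 2)) := by
  refine (lintegral_radialRegion_le hN ha).trans ?_
  rw [← ENNReal.ofReal_toReal lintegral_rpow_abs_sin_lt_top.ne,
    ← ENNReal.ofReal_mul (by positivity)]
  refine ENNReal.ofReal_le_ofReal ?_
  unfold weightConst
  have h1 := Real.pi_pos
  have h2 : 0 ≤ a * b ^ 2 := by positivity
  nlinarith [mul_nonneg h1.le h2]

open scoped Classical in
/-- The output modulation is the largest, the second input modulation the smallest. -/
theorem trilin_le_of_output_max {ε₀ ε₁ ε₂ l₀ l₁ l₂ : ℝ} (hε₀ : ε₀ = 1 ∨ ε₀ = -1)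
    (hε₁ : ε₁ = 1 ∨ ε₁ = -1) (hε₂ : ε₂ = 1 ∨ ε₂ = -1) (hl₂ : 0 < l₂) (h21 : l₂ ≤ l₁)
    (h10 : l₁ ≤ l₀) {f₀ f₁ f₂ : SpaceTime → ENNReal} (h₀ : Measurable f₀) (h₁ : Measurable f₁)
    (h₂ : Measurable f₂) (s₀ : NearCone ε₀ (l₀ ^ 3) f₀) (s₁ : NearCone ε₁ (l₁ ^ 3) f₁)
    (s₂ : NearCone ε₂ (l₂ ^ 3) f₂) :
    trilin (nullWeight (ε₁ * ε₂)) f₀ f₁ f₂ ≤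
      ENNReal.ofReal (2 * Real.sqrt (2 * weightConst) * (l₀ * l₁ * l₂)) *
        (nrm f₀ * (nrm f₁ * nrm f₂)) := by
  have hl₁ : 0 < l₁ := hl₂.trans_le h21
  have hl₀ : 0 < l₀ := hl₁.trans_le h10
  have hpi := Real.pi_gt_three
  have c21 : l₂ ^ 3 ≤ l₁ ^ 3 := pow_le_pow_left₀ hl₂.le h21 3
  have c10 : l₁ ^ 3 ≤ l₀ ^ 3 := pow_le_pow_left₀ hl₁.le h10 3
  have p2 : 0 < l₂ ^ 3 := by positivity
  have p1 : 0 < l₁ ^ 3 := by positivity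
  have hx : 0 ≤ l₁ * l₀ ^ 2 := by positivity
  have hV : MeasWeight (nullWeight (ε₁ * ε₂)) := measWeight_nullWeight _
  have hsplit : ∃ P : ℝ → ℝ → ℝ → Prop, MeasurableSet {p : ℝ × ℝ × ℝ | P p.1 p.2.1 p.2.2} ∧
      (∀ N c : ℝ, 0 < N → |c + ε₁ * N| ≤ l₁ ^ 3 →
        ∫⁻ z : ℂ, nullWeight (ε₁ * ε₂) ‖z‖ N ‖(N : ℂ) + z‖ * ind (P ‖z‖ N ‖(N : ℂ) + z‖) *
          ind (|ε₀ * ‖z‖ + ε₂ * ‖(N : ℂ) + z‖ - c| ≤ l₀ ^ 3 + l₂ ^ 3) ≤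
          ENNReal.ofReal (weightConst * (l₁ * l₀ ^ 2))) ∧
      (∀ N c : ℝ, 0 < N → |c + ε₀ * N| ≤ l₀ ^ 3 →
        ∫⁻ z : ℂ, nullWeight (ε₁ * ε₂) N ‖z‖ ‖(N : ℂ) + z‖ * ind (¬P N ‖z‖ ‖(N : ℂ) + z‖) *
          ind (|ε₁ * ‖z‖ + ε₂ * ‖(N : ℂ) + z‖ - c| ≤ l₁ ^ 3 + l₂ ^ 3) ≤
          ENNReal.ofReal (weightConst * (l₁ * l₀ ^ 2))) := by
    by_cases hε : ε₂ = ε₁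
    · have hσ : ε₁ * ε₂ = 1 := by rw [hε]; rcases hε₁ with rfl | rfl <;> norm_num
      rw [hσ, hε]
      refine ⟨fun r _ _ => r ≤ l₁ * l₀ ^ 2, measurableSet_le measurable_fst measurable_const,
        fun N c hN _ => ?_, fun N c hN hc => ?_⟩
      · refine (lintegral_mono fun z => mul_ind_mul_ind_le _ _ _).trans ?_
        exact (fixed_input_small_output_equal_signs hN).trans
          (ofReal_mul_le_weightConst (by linarith) hx)
      · by_cases hT : l₁ * l₀ ^ 2 ≤ N
        · refine (lintegral_mono fun z => ?_).trans
            ((fixed_output_equal_signs (δ := l₁ ^ 3 + l₂ ^ 3) hN hl₁ h10 hε₁ hε₀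
            (by positivity) (by linarith) hT hc).trans (ofReal_mul_le_weightConst (by linarith) hx))
          exact mul_le_mul' (mul_le_of_le_one_right' (ind_le_one _)) le_rfl
        · have hz := ind_of_false (not_not.2 (not_le.1 hT).le)
          simp only [hz, mul_zero, zero_mul, lintegral_zero, zero_le]
    · have hε' : ε₂ = -ε₁ := by
        rcases hε₁ with rfl | rfl <;> rcases hε₂ with rfl | rfl <;> first | exact absurd rfl hε | norm_num
      have hσ : ε₁ * ε₂ = -1 := by rw [hε']; rcases hε₁ with rfl | rfl <;> norm_num
      rw [hσ, hε']
      refine ⟨fun r₀ r₁ r₂ => 8 * l₀ * r₀ ≤ l₁ * (r₁ + r₂),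
        measurableSet_le (by fun_prop) (by fun_prop), fun N c hN hc => ?_, fun N c hN hc => ?_⟩
      · exact (fixed_input_small_output_opposite_signs (δ := l₀ ^ 3 + l₂ ^ 3) hN hl₁ h10 hε₁ hε₀
            (by linarith) hc).trans (ofReal_mul_le_weightConst (by linarith) hx)
      · refine (lintegral_mono fun z => ?_).trans
            ((fixed_output_opposite_signs (c := c) (δ := l₁ ^ 3 + l₂ ^ 3) hN hl₁ h10 hε₁
            (by positivity) (by linarith)).trans (ofReal_mul_le_weightConst (by linarith) hx))
        refine mul_le_mul' (mul_le_mul' le_rfl (ind_mono fun h => ?_)) le_rfl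
        push Not at h
        exact h.le
  obtain ⟨P, hP, hP1, hP2⟩ := hsplit
  refine (trilin_le_split hV P hP h₀ h₁ h₂).trans ?_
  have hV1 := hV.mul_ind hP
  have hV2 := hV.mul_ind (P := fun r s t => ¬P r s t) hP.compl
  have b2 := trilin_le_of_fixed_cubes hV2 h₀ h₁ h₂ s₀ s₁ s₂ hl₂ h21 h10 weightConst_nonneg
    (min_le_right _ _) hP2
  have b1 := trilin_le_of_fixed_cubes
    (V := fun r₁ r₀ r₂ => nullWeight (ε₁ * ε₂) r₀ r₁ r₂ * ind (P r₀ r₁ r₂))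
    (hV1.comp (measurable_fst.comp measurable_snd) measurable_fst
      (measurable_snd.comp measurable_snd)) h₁ h₀ h₂ s₁ s₀ s₂ hl₂ h21 h10 weightConst_nonneg
    (min_le_right _ _) hP1
  rw [trilin_swap_left hV1 h₀ h₁ h₂]
  refine (add_le_add b1 b2).trans (le_of_eq ?_)
  rw [mul_left_comm (nrm f₁), ← add_mul, ← ENNReal.ofReal_add (by positivity) (by positivity)]
  congr 2; ring

open scoped Classical in
/-- The first input modulation is the largest. -/
theorem trilin_le_of_input_max {ε₀ ε₁ ε₂ l₀ l₁ l₂ : ℝ} (hε₀ : ε₀ = 1 ∨ ε₀ = -1)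
    (hε₁ : ε₁ = 1 ∨ ε₁ = -1) (hε₂ : ε₂ = 1 ∨ ε₂ = -1) (hl₀ : 0 < l₀) (hl₂ : 0 < l₂)
    (h01 : l₀ ≤ l₁) (h21 : l₂ ≤ l₁) {f₀ f₁ f₂ : SpaceTime → ENNReal} (h₀ : Measurable f₀)
    (h₁ : Measurable f₁) (h₂ : Measurable f₂) (s₀ : NearCone ε₀ (l₀ ^ 3) f₀)
    (s₁ : NearCone ε₁ (l₁ ^ 3) f₁) (s₂ : NearCone ε₂ (l₂ ^ 3) f₂) :
    trilin (nullWeight (ε₁ * ε₂)) f₀ f₁ f₂ ≤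
      ENNReal.ofReal (2 * Real.sqrt (2 * weightConst) * (l₀ * l₁ * l₂)) *
        (nrm f₀ * (nrm f₁ * nrm f₂)) := by
  have hl₁ : 0 < l₁ := hl₂.trans_le h21
  have hpi := Real.pi_gt_three
  set d := min l₀ l₂ with hd
  set a := max l₀ l₂ with ha
  have hd0 : 0 < d := lt_min hl₀ hl₂
  have hda : d ≤ a := min_le_max
  have ha0 : 0 < a := hd0.trans_le hda
  have ha1 : a ≤ l₁ := max_le h01 h21
  have hdal : d * a * l₁ = l₀ * l₁ * l₂ := by rw [hd, ha, min_mul_max]; ring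
  have c0 : l₀ ^ 3 ≤ a ^ 3 := pow_le_pow_left₀ hl₀.le (le_max_left _ _) 3
  have c2 : l₂ ^ 3 ≤ a ^ 3 := pow_le_pow_left₀ hl₂.le (le_max_right _ _) 3
  have ca : a ^ 3 ≤ l₁ ^ 3 := pow_le_pow_left₀ ha0.le ha1 3
  have p0 : 0 < l₀ ^ 3 := by positivity
  have p2 : 0 < l₂ ^ 3 := by positivity
  have hx : 0 ≤ a * l₁ ^ 2 := by positivity
  have hmin : min (l₀ ^ 3) (l₂ ^ 3) ≤ d ^ 3 := by
    rcases le_total l₀ l₂ with h | h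
    · rw [hd, min_eq_left h]; exact min_le_left _ _
    · rw [hd, min_eq_right h]; exact min_le_right _ _
  have hV : MeasWeight (nullWeight (ε₁ * ε₂)) := measWeight_nullWeight _
  have hk : 0 ≤ Real.sqrt (2 * weightConst) := Real.sqrt_nonneg _
  by_cases hε : ε₂ = ε₀
  · rw [trilin_swap_left hV h₀ h₁ h₂]
    have hB := trilin_le_of_fixed_cubes
      (V := fun r₁ r₀ r₂ => nullWeight (ε₁ * ε₂) r₀ r₁ r₂)
      (hV.comp (measurable_fst.comp measurable_snd) measurable_fst
        (measurable_snd.comp measurable_snd)) h₁ h₀ h₂ s₁ s₀ s₂ hd0 hda ha1 weightConst_nonneg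
      hmin (fun N c hN hc => ?_)
    · refine hB.trans ?_
      rw [mul_left_comm (nrm f₁), hdal]
      refine mul_le_mul' (ENNReal.ofReal_le_ofReal ?_) le_rfl
      refine mul_le_mul_of_nonneg_right (by linarith) (by positivity)
    · rw [hε]
      exact (fixed_input_same_signs hN ha0 ha1 hε₀ hε₁ (by positivity) (by linarith) hc).trans
        (ofReal_mul_le_weightConst (by linarith) hx)
  have hε' : ε₂ = -ε₀ := by
    rcases hε₀ with rfl | rfl <;> rcases hε₂ with rfl | rfl <;> first | exact absurd rfl hε | norm_num
  set P : ℝ → ℝ → ℝ → Prop := fun r₀ r₁ r₂ => AngularRegion a r₁ r₀ r₂ with hPd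
  have hP : MeasurableSet {p : ℝ × ℝ × ℝ | P p.1 p.2.1 p.2.2} :=
    measurableSet_angularRegion a (measurable_fst.comp measurable_snd) measurable_fst
      (measurable_snd.comp measurable_snd)
  have hV1 := hV.mul_ind hP
  have hV2 := hV.mul_ind (P := fun r s t => ¬P r s t) hP.compl
  have b1 : trilin (fun r s t => nullWeight (ε₁ * ε₂) r s t * ind (P r s t)) f₀ f₁ f₂ ≤
      ENNReal.ofReal (Real.sqrt (2 * weightConst) * (d * a * l₁)) *
        (nrm f₀ * (nrm f₁ * nrm f₂)) := by
    rw [trilin_swap_left hV1 h₀ h₁ h₂, mul_left_comm (nrm f₀)]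
    refine trilin_le_of_fixed_cubes
      (V := fun r₁ r₀ r₂ => nullWeight (ε₁ * ε₂) r₀ r₁ r₂ * ind (P r₀ r₁ r₂))
      (hV1.comp (measurable_fst.comp measurable_snd) measurable_fst
        (measurable_snd.comp measurable_snd)) h₁ h₀ h₂ s₁ s₀ s₂ hd0 hda ha1 weightConst_nonneg
      hmin (fun N c hN hc => ?_)
    rw [hε']
    exact (fixed_input_opposite_signs hN ha0 ha1 hε₀ hε₁ (by positivity) (by linarith) hc).trans
        (ofReal_mul_le_weightConst (by linarith) hx)
  have b2 : trilin (fun r s t => nullWeight (ε₁ * ε₂) r s t * ind (¬P r s t)) f₀ f₁ f₂ ≤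
      ENNReal.ofReal (Real.sqrt (2 * weightConst) * (d * a * l₁)) *
        (nrm f₀ * (nrm f₁ * nrm f₂)) := by
    rcases le_total l₂ l₀ with h | h
    · have hdl : d = l₂ := min_eq_right h
      refine trilin_le_of_fixed_cubes hV2 h₀ h₁ h₂ s₀ s₁ s₂ hd0 hda ha1 weightConst_nonneg
        (by rw [hdl]; exact min_le_right _ _) (fun N c hN hc => ?_)
      refine le_trans (lintegral_mono fun z => ?_) (lintegral_radialRegion_le_weightConst hN ha0)
      by_cases hA : AngularRegion a ‖z‖ N ‖(N : ℂ) + z‖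
      · have : ¬¬P N ‖z‖ ‖(N : ℂ) + z‖ := not_not.2 hA
        rw [ind_of_false this]; simp
      by_cases hQ : |ε₁ * ‖z‖ + ε₂ * ‖(N : ℂ) + z‖ - c| ≤ l₁ ^ 3 + l₂ ^ 3
      swap
      · rw [ind_of_false hQ]; simp
      rw [hε'] at hQ
      have hA' : ¬P N ‖z‖ ‖(N : ℂ) + z‖ := hA
      simp only [ind_of_true hA, ind_of_true hA', mul_one]
      refine (mul_le_of_le_one_right' (ind_le_one _)).trans ?_
      rcases (norm_nonneg z).eq_or_lt with hz | hz
      · unfold nullWeight; rw [← hz]; simp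
      obtain ⟨t1, t2, t3⟩ := triangle_complex hN z
      have hq := lt_div_four_of_not_angularRegion (by linarith) hA
      rw [hε']
      refine nullWeight_le_of_resonance hN hz (by linarith) hl₁ hN (by linarith) (by linarith)
        (by linarith) (by linarith) (by linarith) hε₀ hε₁ ?_
      have e : ε₀ * N + ε₁ * ‖z‖ + -ε₀ * ‖(N : ℂ) + z‖ =
        (c + ε₀ * N) + (ε₁ * ‖z‖ + -ε₀ * ‖(N : ℂ) + z‖ - c) := by ring
      rw [e]
      exact (abs_add_le _ _).trans (by linarith)
    · have hdl : d = l₀ := min_eq_left h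
      rw [trilin_swap_left hV2 h₀ h₁ h₂, trilin_swap_right, trilin_swap_left
        (V := fun r₁ r₂ r₀ => nullWeight (ε₁ * ε₂) r₀ r₁ r₂ * ind (¬P r₀ r₁ r₂))
        (hV2.comp (measurable_snd.comp measurable_snd) measurable_fst
          (measurable_fst.comp measurable_snd)) h₁ h₂ h₀]
      have e : nrm f₀ * (nrm f₁ * nrm f₂) = nrm f₂ * (nrm f₁ * nrm f₀) := by ring
      rw [e]
      refine trilin_le_of_fixed_cubes
        (V := fun r₂ r₁ r₀ => nullWeight (ε₁ * ε₂) r₀ r₁ r₂ * ind (¬P r₀ r₁ r₂))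
        (hV2.comp (measurable_snd.comp measurable_snd) (measurable_fst.comp measurable_snd)
          measurable_fst) h₂ h₁ h₀ s₂ s₁ s₀ hd0 hda ha1 weightConst_nonneg
        (by rw [hdl]; exact min_le_right _ _) (fun N c hN hc => ?_)
      refine le_trans (lintegral_mono fun z => ?_) (lintegral_radialRegion_le_weightConst hN ha0)
      by_cases hA : AngularRegion a ‖z‖ N ‖(N : ℂ) + z‖
      · have : ¬¬P ‖(N : ℂ) + z‖ ‖z‖ N := not_not.2 (angularRegion_comm.1 hA)
        simp only [ind_of_false this]; simp
      by_cases hQ : |ε₁ * ‖z‖ + ε₀ * ‖(N : ℂ) + z‖ - c| ≤ l₁ ^ 3 + l₀ ^ 3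
      swap
      · rw [ind_of_false hQ]; simp
      have hA' : ¬P ‖(N : ℂ) + z‖ ‖z‖ N := fun h => hA (angularRegion_comm.1 h)
      simp only [ind_of_true hA, ind_of_true hA', mul_one]
      refine (mul_le_of_le_one_right' (ind_le_one _)).trans ?_
      rcases (norm_nonneg z).eq_or_lt with hz | hz
      · unfold nullWeight; rw [← hz]; simp
      obtain ⟨t1, t2, t3⟩ := triangle_complex hN z
      have hq := lt_div_four_of_not_angularRegion (by linarith) hA
      rw [hε'] at hc ⊢
      refine nullWeight_le_of_resonance (by linarith) hz hN hl₁ hN (by linarith) (by linarith)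
        (by linarith) (by linarith) (by linarith) hε₀ hε₁ ?_
      have e : ε₀ * ‖(N : ℂ) + z‖ + ε₁ * ‖z‖ + -ε₀ * N =
        (c + -ε₀ * N) + (ε₁ * ‖z‖ + ε₀ * ‖(N : ℂ) + z‖ - c) := by ring
      rw [e]
      exact (abs_add_le _ _).trans (by linarith)
  refine (trilin_le_split hV P hP h₀ h₁ h₂).trans ((add_le_add b1 b2).trans (le_of_eq ?_))
  rw [← add_mul, ← ENNReal.ofReal_add (by positivity) (by positivity), hdal]
  congr 2; ring

/-- The trilinear estimate for functions near the cones. -/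
theorem trilin_nullWeight_le {ε₀ ε₁ ε₂ l₀ l₁ l₂ : ℝ} (hε₀ : ε₀ = 1 ∨ ε₀ = -1)
    (hε₁ : ε₁ = 1 ∨ ε₁ = -1) (hε₂ : ε₂ = 1 ∨ ε₂ = -1) (hl₀ : 0 < l₀) (hl₁ : 0 < l₁)
    (hl₂ : 0 < l₂) {f₀ f₁ f₂ : SpaceTime → ENNReal} (h₀ : Measurable f₀)
    (h₁ : Measurable f₁) (h₂ : Measurable f₂) (s₀ : NearCone ε₀ (l₀ ^ 3) f₀)
    (s₁ : NearCone ε₁ (l₁ ^ 3) f₁) (s₂ : NearCone ε₂ (l₂ ^ 3) f₂) :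
    trilin (nullWeight (ε₁ * ε₂)) f₀ f₁ f₂ ≤
      ENNReal.ofReal (2 * Real.sqrt (2 * weightConst) * (l₀ * l₁ * l₂)) *
        (nrm f₀ * (nrm f₁ * nrm f₂)) := by
  have hσ : ε₁ * ε₂ = 1 ∨ ε₁ * ε₂ = -1 := by
    rcases hε₁ with rfl | rfl <;> rcases hε₂ with rfl | rfl <;> norm_num
  have swap : trilin (nullWeight (ε₂ * ε₁)) f₀ f₂ f₁ ≤
      ENNReal.ofReal (2 * Real.sqrt (2 * weightConst) * (l₀ * l₂ * l₁)) *
        (nrm f₀ * (nrm f₂ * nrm f₁)) → trilin (nullWeight (ε₁ * ε₂)) f₀ f₁ f₂ ≤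
      ENNReal.ofReal (2 * Real.sqrt (2 * weightConst) * (l₀ * l₁ * l₂)) *
        (nrm f₀ * (nrm f₁ * nrm f₂)) := by
    intro h
    rw [trilin_nullWeight_swap hσ, mul_comm ε₁, mul_comm (nrm f₁), mul_right_comm l₀]
    exact h
  rcases le_total l₁ l₂ with h12 | h12
  · rcases le_total l₂ l₀ with h20 | h20
    · exact swap (trilin_le_of_output_max hε₀ hε₂ hε₁ hl₁ h12 h20 h₀ h₂ h₁ s₀ s₂ s₁)
    · exact swap (trilin_le_of_input_max hε₀ hε₂ hε₁ hl₀ hl₁ h20 h12 h₀ h₂ h₁ s₀ s₂ s₁)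
  · rcases le_total l₁ l₀ with h10 | h10
    · exact trilin_le_of_output_max hε₀ hε₁ hε₂ hl₂ h12 h10 h₀ h₁ h₂ s₀ s₁ s₂
    · exact trilin_le_of_input_max hε₀ hε₁ hε₂ hl₀ hl₂ h10 h12 h₀ h₁ h₂ s₀ s₁ s₂

/-- The bilinear convolution `∫ V^{1/2} F(b) G(a + b) db`. -/
def bilinConv (V : ℝ → ℝ → ℝ → ENNReal) (F G : SpaceTime → ENNReal) (a : SpaceTime) : ENNReal :=
  ∫⁻ b : SpaceTime, V ‖a.2‖ ‖b.2‖ ‖a.2 + b.2‖ ^ (1 / 2 : ℝ) * (F b * G (a + b))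

theorem measurable_bilinConv {V : ℝ → ℝ → ℝ → ENNReal} (hV : MeasWeight V)
    {F G : SpaceTime → ENNReal} (hF : Measurable F) (hG : Measurable G) :
    Measurable (bilinConv V F G) := by
  have h := measurable_trilin_integrand hV (measurable_const (a := (1 : ENNReal))) hF
    (hG.comp measurable_neg)
  simp only [Function.comp_def, neg_neg, one_mul] at h
  exact Measurable.lintegral_prod_right' h

theorem lintegral_mul_bilinConv {V : ℝ → ℝ → ℝ → ENNReal} (hV : MeasWeight V)
    {f F G : SpaceTime → ENNReal} (hF : Measurable F) (hG : Measurable G) :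
    ∫⁻ a, f a * bilinConv V F G a = trilin V f F fun q => G (-q) := by
  unfold trilin bilinConv
  refine lintegral_congr fun a => ?_
  have hm : Measurable fun b : SpaceTime =>
      V ‖a.2‖ ‖b.2‖ ‖a.2 + b.2‖ ^ (1 / 2 : ℝ) * (F b * G (a + b)) :=
    ((hV.comp (by fun_prop) (by fun_prop) (by fun_prop)).pow_const _).mul
      (hF.mul (hG.comp (by fun_prop)))
  rw [← lintegral_const_mul _ hm]
  refine lintegral_congr fun b => ?_
  simp only [neg_neg]
  ring

theorem lintegral_lintegral_tsum {α β : Type*} [MeasurableSpace α] [MeasurableSpace β]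
    {μ : Measure α} {ν : Measure β} [SFinite ν] {K : ℕ → α × β → ENNReal}
    (hK : ∀ k, Measurable (K k)) :
    ∫⁻ a, ∫⁻ b, ∑' k, K k (a, b) ∂ν ∂μ = ∑' k, ∫⁻ a, ∫⁻ b, K k (a, b) ∂ν ∂μ := by
  rw [← lintegral_tsum fun k => (hK k).lintegral_prod_right'.aemeasurable]
  exact lintegral_congr fun a =>
    lintegral_tsum fun k => ((hK k).comp measurable_prodMk_left).aemeasurable

theorem trilin_tsum_middle {V : ℝ → ℝ → ℝ → ENNReal} (hV : MeasWeight V)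
    {f₀ f₂ : SpaceTime → ENNReal} {f₁ : ℕ → SpaceTime → ENNReal} (h₀ : Measurable f₀)
    (h₁ : ∀ k, Measurable (f₁ k)) (h₂ : Measurable f₂) :
    trilin V f₀ (fun b => ∑' k, f₁ k b) f₂ = ∑' k, trilin V f₀ (f₁ k) f₂ := by
  unfold trilin
  simp only [← ENNReal.tsum_mul_left, ← ENNReal.tsum_mul_right]
  exact lintegral_lintegral_tsum fun k => measurable_trilin_integrand hV h₀ (h₁ k) h₂

/-- The part of `F` at modulation about `2 ^ k` relative to the cone `τ + s|ξ| = 0`. -/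
def lpPart (φ : ℝ → ℝ) (s : ℝ) (k : ℕ) (F : SpaceTime → ENNReal) (a : SpaceTime) : ENNReal :=
  ENNReal.ofReal (lpPiece φ k (a.1 + s * ‖a.2‖)) * F a

theorem IsLPBump.measurable_lpPart {φ : ℝ → ℝ} (hφ : IsLPBump φ) (s : ℝ)
    {F : SpaceTime → ENNReal} (k : ℕ) (hF : Measurable F) :
    Measurable (lpPart φ s k F) :=
  (((hφ.measurable_lpPiece k).comp
    (by fun_prop : Measurable fun a : SpaceTime => a.1 + s * ‖a.2‖)).ennreal_ofReal).mul hF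

theorem IsLPBump.tsum_lpPart {φ : ℝ → ℝ} (hφ : IsLPBump φ) (s : ℝ)
    (F : SpaceTime → ENNReal) (a : SpaceTime) :
    ∑' k, lpPart φ s k F a = F a := by
  unfold lpPart
  rw [ENNReal.tsum_mul_right, ← ENNReal.ofReal_tsum_of_nonneg (fun k => hφ.lpPiece_nonneg k _)
    (hφ.hasSum_lpPiece _).summable, (hφ.hasSum_lpPiece _).tsum_eq, ENNReal.ofReal_one, one_mul]

theorem IsLPBump.nearCone_lpPart {φ : ℝ → ℝ} (hφ : IsLPBump φ) (s : ℝ) (k : ℕ)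
    (F : SpaceTime → ENNReal) :
    NearCone s (2 ^ (k + 1)) (lpPart φ s k F) := by
  intro a ha
  refine hφ.abs_le_of_lpPiece_ne_zero fun h => ha ?_
  simp [lpPart, h]

/-- The cube root of `2 ^ (k + 1)`. -/
def dyadicRoot (k : ℕ) : ℝ := (2 : ℝ) ^ (((k : ℝ) + 1) / 3)

theorem dyadicRoot_pos (k : ℕ) : 0 < dyadicRoot k := Real.rpow_pos_of_pos two_pos _

theorem dyadicRoot_pow (k : ℕ) : dyadicRoot k ^ 3 = 2 ^ (k + 1) := by
  unfold dyadicRoot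
  rw [← Real.rpow_natCast, ← Real.rpow_mul two_pos.le, ← Real.rpow_natCast]
  congr 1; push_cast; ring

theorem dyadicRoot_eq (k : ℕ) : dyadicRoot k = 2 ^ (1 / 3 : ℝ) * (2 : ℝ) ^ (1 / 3 * k : ℝ) := by
  unfold dyadicRoot
  rw [← Real.rpow_add two_pos]
  congr 1; ring

theorem nrm_comp_neg (f : SpaceTime → ENNReal) : nrm (fun q => f (-q)) = nrm f := by
  unfold nrm
  rw [lintegral_neg_eq_self (μ := (volume : Measure SpaceTime)) fun q => f q ^ 2]

/-- An `L²` bound by testing against truncations of the function. -/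
theorem nrm_le_of_forall_lintegral_mul_le {g : SpaceTime → ENNReal} (hg : Measurable g)
    {M : ENNReal} (hM : ∀ f : SpaceTime → ENNReal, Measurable f → (∀ a, f a ≠ 0 → g a ≠ 0) →
      ∫⁻ a, f a * g a ≤ M * nrm f) : nrm g ≤ M := by
  set S := spanningSets (volume : Measure SpaceTime) with hS
  set f : ℕ → SpaceTime → ENNReal := fun n => (S n).indicator fun a => min (g a) n with hf
  have hfm : ∀ n, Measurable (f n) := fun n =>
    (hg.min measurable_const).indicator (measurableSet_spanningSets _ n)
  have hfg : ∀ n a, f n a ≤ g a := fun n a => by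
    by_cases h : a ∈ S n <;> simp [hf, h]
  have hmono : Monotone f := fun m n hmn a => by
    by_cases h : a ∈ S m
    · have h' : a ∈ S n := monotone_spanningSets _ hmn h
      simp only [hf, Set.indicator_of_mem h, Set.indicator_of_mem h']
      exact min_le_min le_rfl (by exact_mod_cast hmn)
    · simp [hf, h]
  have hsup : ∀ a, ⨆ n, f n a = g a := fun a => by
    refine le_antisymm (iSup_le fun n => hfg n a) ?_
    obtain ⟨m, hm⟩ := Set.mem_iUnion.1
      ((iUnion_spanningSets (volume : Measure SpaceTime)).symm ▸ Set.mem_univ a :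
        a ∈ ⋃ i, spanningSets (volume : Measure SpaceTime) i)
    refine le_of_forall_lt fun (c : ENNReal) hc => ?_
    obtain ⟨N, hN⟩ := ENNReal.exists_nat_gt (hc.trans_le le_top).ne
    refine lt_of_lt_of_le ?_ (le_iSup (fun n => f n a) (max m N))
    have h' : a ∈ S (max m N) := monotone_spanningSets _ (le_max_left _ _) hm
    simp only [hf, Set.indicator_of_mem h']
    exact lt_min hc (hN.trans_le (Nat.mono_cast (le_max_right m N)))
  have hfin : ∀ n, ∫⁻ a, f n a ^ 2 ≠ ⊤ := fun n => by
    have : ∫⁻ a, f n a ^ 2 ≤ (n : ENNReal) ^ 2 * volume (S n) := by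
      rw [← lintegral_indicator_const (measurableSet_spanningSets _ n)]
      refine lintegral_mono fun a => ?_
      by_cases h : a ∈ S n
      · simp only [hf, Set.indicator_of_mem h]
        rw [hS] at h
        rw [Set.indicator_of_mem h]
        exact pow_le_pow_left' (min_le_right (g a) (n : ENNReal)) 2
      · simp [hf, h]
    refine ne_top_of_le_ne_top (ENNReal.mul_ne_top (by simp) ?_) this
    exact (measure_spanningSets_lt_top _ n).ne
  have hbd : ∀ n, ∫⁻ a, f n a ^ 2 ≤ M ^ 2 := fun n => by
    have h1 : ∫⁻ a, f n a ^ 2 ≤ M * nrm (f n) := by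
      refine (lintegral_mono fun a => ?_).trans (hM (f n) (hfm n) fun a ha h0 => ha ?_)
      · rw [sq]
        exact mul_le_mul' le_rfl (hfg n a)
      · exact le_antisymm (h0 ▸ hfg n a) zero_le
    have hsq : ∫⁻ a, f n a ^ 2 = nrm (f n) * nrm (f n) := by
      unfold nrm
      rw [← ENNReal.rpow_add_of_nonneg _ _ (by norm_num) (by norm_num)]
      norm_num
    have hnt : nrm (f n) ≠ ⊤ := ENNReal.rpow_ne_top_of_nonneg (by norm_num) (hfin n)
    rw [hsq] at h1 ⊢
    rcases eq_or_ne (nrm (f n)) 0 with h0 | h0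
    · simp [h0]
    · have := (ENNReal.mul_le_mul_iff_left h0 hnt).1 h1
      rw [sq]
      exact mul_le_mul' this this
  have hlim : ∫⁻ a, g a ^ 2 = ⨆ n, ∫⁻ a, f n a ^ 2 := by
    rw [← lintegral_iSup (fun n => (hfm n).pow_const 2)
      fun m n hmn a => pow_le_pow_left' (hmono hmn a) 2]
    refine lintegral_congr fun a => ?_
    rw [← hsup a]
    exact ENNReal.iSup_pow_of_ne_zero two_ne_zero _
  have : ∫⁻ a, g a ^ 2 ≤ M ^ 2 := hlim ▸ iSup_le hbd
  refine (ENNReal.rpow_le_rpow this (by norm_num : (0 : ℝ) ≤ 1 / 2)).trans (le_of_eq ?_)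
  rw [← ENNReal.rpow_natCast, ← ENNReal.rpow_mul]
  norm_num

/-- The bilinear estimate for nonnegative functions on the Fourier side. -/
theorem IsLPBump.nrm_lpPart_bilinConv_le {φ : ℝ → ℝ} (hφ : IsLPBump φ) {s₁ s₂ s₃ : ℝ}
    (h1 : s₁ = 1 ∨ s₁ = -1) (h2 : s₂ = 1 ∨ s₂ = -1) (h3 : s₃ = 1 ∨ s₃ = -1)
    {F G : SpaceTime → ENNReal} (hF : Measurable F) (hG : Measurable G) (k : ℕ) :
    nrm (lpPart φ s₃ k (bilinConv (nullWeight (s₁ * -s₂)) F G)) ≤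
      ENNReal.ofReal (2 * Real.sqrt (2 * weightConst) * dyadicRoot k) *
        ((∑' i, ENNReal.ofReal (dyadicRoot i) * nrm (lpPart φ s₁ i F)) *
          ∑' j, ENNReal.ofReal (dyadicRoot j) * nrm (lpPart φ s₂ j G)) := by
  have h2' : -s₂ = 1 ∨ -s₂ = -1 := by rcases h2 with rfl | rfl <;> norm_num
  set V := nullWeight (s₁ * -s₂) with hVd
  have hV : MeasWeight V := measWeight_nullWeight _
  have hB := measurable_bilinConv hV hF hG
  have hFm := fun i => hφ.measurable_lpPart s₁ i hF
  have hGm : ∀ j, Measurable fun q => lpPart φ s₂ j G (-q) := fun j =>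
    (hφ.measurable_lpPart s₂ j hG).comp measurable_neg
  refine nrm_le_of_forall_lintegral_mul_le (hφ.measurable_lpPart s₃ k hB) fun f hf hfg => ?_
  have hfc : NearCone s₃ (dyadicRoot k ^ 3) f := by
    rw [dyadicRoot_pow]
    exact fun a ha => hφ.nearCone_lpPart s₃ k _ a (hfg a ha)
  calc ∫⁻ a, f a * lpPart φ s₃ k (bilinConv V F G) a
      ≤ ∫⁻ a, f a * bilinConv V F G a := by
        refine lintegral_mono fun a => mul_le_mul' le_rfl (mul_le_of_le_one_left' ?_)
        exact ENNReal.ofReal_le_one.2 (hφ.lpPiece_le_one _ _)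
    _ = ∑' i, ∑' j, trilin V f (lpPart φ s₁ i F) (fun q => lpPart φ s₂ j G (-q)) := by
        rw [lintegral_mul_bilinConv hV hF hG]
        have hGn : Measurable fun q => G (-q) := hG.comp measurable_neg
        have e1 : F = fun b => ∑' i, lpPart φ s₁ i F b := funext fun b =>
          (hφ.tsum_lpPart s₁ F b).symm
        have e2 : (fun q => G (-q)) = fun q => ∑' j, lpPart φ s₂ j G (-q) := funext fun b =>
          (hφ.tsum_lpPart s₂ G (-b)).symm
        conv_lhs => rw [e1]
        rw [trilin_tsum_middle hV hf hFm hGn]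
        refine tsum_congr fun i => ?_
        rw [e2, trilin_swap_right, trilin_tsum_middle (V := fun r₀ r₂ r₁ => V r₀ r₁ r₂)
          (hV.comp measurable_fst (measurable_snd.comp measurable_snd)
            (measurable_fst.comp measurable_snd)) hf hGm (hFm i)]
        refine tsum_congr fun j => ?_
        rw [trilin_swap_right]
    _ ≤ ∑' i, ∑' j, ENNReal.ofReal (2 * Real.sqrt (2 * weightConst) * dyadicRoot k) * nrm f *
          ((ENNReal.ofReal (dyadicRoot i) * nrm (lpPart φ s₁ i F)) *
            (ENNReal.ofReal (dyadicRoot j) * nrm (lpPart φ s₂ j G))) := by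
        refine ENNReal.tsum_le_tsum fun i => ENNReal.tsum_le_tsum fun j => ?_
        refine (trilin_nullWeight_le h3 h1 h2' (dyadicRoot_pos k) (dyadicRoot_pos i)
          (dyadicRoot_pos j) hf (hFm i) (hGm j) hfc ?_ ?_).trans (le_of_eq ?_)
        · rw [dyadicRoot_pow]
          exact hφ.nearCone_lpPart s₁ i F
        · rw [dyadicRoot_pow]
          intro q hq
          have := hφ.nearCone_lpPart s₂ j G (-q) hq
          rw [Prod.fst_neg, Prod.snd_neg, norm_neg] at this
          rw [← abs_neg, show -(q.1 + -s₂ * ‖q.2‖) = -q.1 + s₂ * ‖q.2‖ by ring]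
          exact this
        · have d0 := (dyadicRoot_pos k).le
          have d1 := (dyadicRoot_pos i).le
          rw [nrm_comp_neg, show 2 * Real.sqrt (2 * weightConst) *
            (dyadicRoot k * dyadicRoot i * dyadicRoot j) = 2 * Real.sqrt (2 * weightConst) *
            dyadicRoot k * (dyadicRoot i * dyadicRoot j) by ring,
            ENNReal.ofReal_mul (by positivity), ENNReal.ofReal_mul d1]
          ring
    _ = _ := by
        simp only [ENNReal.tsum_mul_left, ENNReal.tsum_mul_right]
        ring

/-- The symbol of the null form. -/
def nullSymbol (s₁ s₂ : ℝ) (ξ η : E2) (z w : Fin 2 → ℂ) : ℂ :=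
  ∑ i : Fin 2, (starRingEnd ℂ) (betaM.mulVec ((diracProj s₁ ξ).mulVec z) i) *
    (diracProj s₂ η).mulVec w i

/-- The Euclidean length of a vector in `ℂ²`. -/
def len2 (z : Fin 2 → ℂ) : ℝ := Real.sqrt (∑ i : Fin 2, ‖z i‖ ^ 2)

/-- The signed direction of `ξ` as a complex number. -/
def dirC (s : ℝ) (ξ : E2) : ℂ := ((s / ‖ξ‖ : ℝ) : ℂ) * ((ξ 0 : ℂ) + (ξ 1 : ℂ) * I)

theorem norm_sq_E2 (ξ : E2) : ‖ξ‖ ^ 2 = ξ 0 ^ 2 + ξ 1 ^ 2 := by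
  rw [EuclideanSpace.norm_sq_eq]
  simp

theorem inner_E2 (ξ η : E2) : ⟪ξ, η⟫ = ξ 0 * η 0 + ξ 1 * η 1 := by
  simp [PiLp.inner_apply, Fin.sum_univ_two, mul_comm]

theorem normSq_dirC {s : ℝ} (hs : s = 1 ∨ s = -1) {ξ : E2} (hξ : ξ ≠ 0) :
    normSq (dirC s ξ) = 1 := by
  have h0 : 0 < ‖ξ‖ := norm_pos_iff.2 hξ
  have h1 := norm_sq_E2 ξ
  have hs2 : s ^ 2 = 1 := by rcases hs with rfl | rfl <;> norm_num
  unfold dirC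
  rw [normSq_mul, normSq_ofReal, normSq_add_mul_I, ← h1]
  field_simp
  rw [hs2]

theorem norm_dirC_le {s : ℝ} (hs : s = 1 ∨ s = -1) (ξ : E2) : ‖dirC s ξ‖ ≤ 1 := by
  rcases eq_or_ne ξ 0 with rfl | hξ
  · simp [dirC]
  · have h := normSq_dirC hs hξ
    rw [normSq_eq_norm_sq] at h
    exact ((pow_eq_one_iff_of_nonneg (norm_nonneg _) two_ne_zero).1 h).le

theorem diracProj_mulVec_zero (s : ℝ) (ξ : E2) (z : Fin 2 → ℂ) :
    (diracProj s ξ).mulVec z 0 = 1 / 2 * (z 0 + (starRingEnd ℂ) (dirC s ξ) * z 1) := by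
  have hc : (starRingEnd ℂ) (dirC s ξ) =
      ((s / ‖ξ‖ : ℝ) : ℂ) * ((ξ 0 : ℂ) - (ξ 1 : ℂ) * I) := by
    unfold dirC
    simp only [map_mul, map_add, conj_ofReal, conj_I]
    ring
  rw [hc]
  simp [diracProj, alpha1, alpha2, Matrix.mulVec, dotProduct, Fin.sum_univ_two]
  ring

theorem diracProj_mulVec_one (s : ℝ) (ξ : E2) (z : Fin 2 → ℂ) :
    (diracProj s ξ).mulVec z 1 = 1 / 2 * (dirC s ξ * z 0 + z 1) := by
  unfold dirC
  simp [diracProj, alpha1, alpha2, Matrix.mulVec, dotProduct, Fin.sum_univ_two]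
  ring

theorem diracProj_mulVec_one_eq {s : ℝ} (hs : s = 1 ∨ s = -1) {ξ : E2} (hξ : ξ ≠ 0)
    (z : Fin 2 → ℂ) : (diracProj s ξ).mulVec z 1 =
      dirC s ξ * (1 / 2 * (z 0 + (starRingEnd ℂ) (dirC s ξ) * z 1)) := by
  have h := mul_conj (dirC s ξ)
  rw [normSq_dirC hs hξ, ofReal_one] at h
  rw [diracProj_mulVec_one]
  linear_combination (-(1 / 2) * z 1) * h

theorem betaM_mulVec_zero (z : Fin 2 → ℂ) : betaM.mulVec z 0 = z 0 := by
  simp [betaM, Matrix.mulVec, dotProduct, Fin.sum_univ_two]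

theorem betaM_mulVec_one (z : Fin 2 → ℂ) : betaM.mulVec z 1 = -z 1 := by
  simp [betaM, Matrix.mulVec, dotProduct, Fin.sum_univ_two]

theorem nullSymbol_eq (s₁ s₂ : ℝ) (ξ η : E2) (z w : Fin 2 → ℂ) :
    nullSymbol s₁ s₂ ξ η z w =
      (starRingEnd ℂ) ((diracProj s₁ ξ).mulVec z 0) * (diracProj s₂ η).mulVec w 0 -
      (starRingEnd ℂ) ((diracProj s₁ ξ).mulVec z 1) * (diracProj s₂ η).mulVec w 1 := by
  unfold nullSymbol
  rw [Fin.sum_univ_two, betaM_mulVec_zero, betaM_mulVec_one, map_neg]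
  ring

theorem norm_add_conj_mul_le {e : ℂ} (he : normSq e = 1) (z : Fin 2 → ℂ) :
    ‖z 0 + (starRingEnd ℂ) e * z 1‖ ≤ Real.sqrt 2 * len2 z := by
  have h1 : ‖e‖ = 1 := by
    rw [normSq_eq_norm_sq] at he
    exact (pow_eq_one_iff_of_nonneg (norm_nonneg e) two_ne_zero).1 he
  have h2 : ‖z 0 + (starRingEnd ℂ) e * z 1‖ ≤ ‖z 0‖ + ‖z 1‖ := by
    refine (norm_add_le _ _).trans ?_
    rw [norm_mul, RCLike.norm_conj, h1, one_mul]
  unfold len2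
  rw [← Real.sqrt_mul two_pos.le]
  refine h2.trans (Real.le_sqrt_of_sq_le ?_)
  rw [Fin.sum_univ_two]
  nlinarith [sq_nonneg (‖z 0‖ - ‖z 1‖)]

/-- The null structure: the symbol vanishes when `ξ` and `η` are aligned in accordance with
the signs. -/
theorem norm_nullSymbol_le {s₁ s₂ : ℝ} (h1 : s₁ = 1 ∨ s₁ = -1) (h2 : s₂ = 1 ∨ s₂ = -1)
    {ξ η : E2} (hξ : ξ ≠ 0) (hη : η ≠ 0) (z w : Fin 2 → ℂ) :
    ‖nullSymbol s₁ s₂ ξ η z w‖ ≤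
      Real.sqrt (|‖η - ξ‖ ^ 2 - (‖ξ‖ + s₁ * -s₂ * ‖η‖) ^ 2| / (‖ξ‖ * ‖η‖)) *
        (len2 z * len2 w) := by
  set e := dirC s₁ ξ with he
  set f := dirC s₂ η with hf
  have hne := normSq_dirC h1 hξ
  have hnf := normSq_dirC h2 hη
  have hr : 0 < ‖ξ‖ := norm_pos_iff.2 hξ
  have hs : 0 < ‖η‖ := norm_pos_iff.2 hη
  have hform : nullSymbol s₁ s₂ ξ η z w = 1 / 4 * (1 - (starRingEnd ℂ) e * f) *
      ((starRingEnd ℂ) (z 0 + (starRingEnd ℂ) e * z 1) * (w 0 + (starRingEnd ℂ) f * w 1)) := by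
    rw [nullSymbol_eq, diracProj_mulVec_zero, diracProj_mulVec_zero,
      diracProj_mulVec_one_eq h1 hξ, diracProj_mulVec_one_eq h2 hη, ← he, ← hf]
    simp only [map_mul, map_div₀, map_one, map_ofNat]
    ring
  have hsq : ‖1 - (starRingEnd ℂ) e * f‖ ^ 2 =
      |‖η - ξ‖ ^ 2 - (‖ξ‖ + s₁ * -s₂ * ‖η‖) ^ 2| / (‖ξ‖ * ‖η‖) := by
    have hin := inner_E2 η ξ
    have hre : ((starRingEnd ℂ) e * f).re = s₁ * s₂ * ⟪η, ξ⟫ / (‖ξ‖ * ‖η‖) := by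
      rw [hin, he, hf]
      unfold dirC
      simp
      field_simp
    have hn1 : normSq ((starRingEnd ℂ) e * f) = 1 := by
      rw [normSq_mul, normSq_conj, hne, hnf, one_mul]
    have hN : ‖1 - (starRingEnd ℂ) e * f‖ ^ 2 = 2 - 2 * (s₁ * s₂ * ⟪η, ξ⟫ / (‖ξ‖ * ‖η‖)) := by
      rw [← normSq_eq_norm_sq, normSq_sub, normSq_one, hn1, one_mul, conj_re, hre]
      ring
    have hC := abs_real_inner_le_norm η ξ
    have hC1 := (abs_le.1 hC).1
    have hC2 := (abs_le.1 hC).2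
    rw [hN, norm_sub_sq_real]
    rcases h1 with rfl | rfl <;> rcases h2 with rfl | rfl
    · rw [abs_of_nonneg (by nlinarith)]; field_simp; ring
    · rw [abs_of_nonpos (by nlinarith)]; field_simp; ring
    · rw [abs_of_nonpos (by nlinarith)]; field_simp; ring
    · rw [abs_of_nonneg (by nlinarith)]; field_simp; ring
  rw [← hsq, Real.sqrt_sq (norm_nonneg _), hform, norm_mul, norm_mul, norm_mul, RCLike.norm_conj]
  have k1 := norm_add_conj_mul_le hne z
  have k2 := norm_add_conj_mul_le hnf w
  have hz : 0 ≤ len2 z := Real.sqrt_nonneg _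
  have hw : 0 ≤ len2 w := Real.sqrt_nonneg _
  have k3 := mul_le_mul k1 k2 (norm_nonneg _) (by positivity)
  have e2 : Real.sqrt 2 * len2 z * (Real.sqrt 2 * len2 w) = 2 * (len2 z * len2 w) := by
    rw [mul_mul_mul_comm, Real.mul_self_sqrt two_pos.le]
  rw [e2] at k3
  have hT := norm_nonneg (1 - (starRingEnd ℂ) e * f)
  have h4 : ‖(1 / 4 : ℂ)‖ = 1 / 4 := by norm_num
  rw [h4]
  have := mul_le_mul_of_nonneg_left k3 hT
  nlinarith [mul_nonneg hT (mul_nonneg hz hw)]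

open scoped FourierTransform in
/-- Fourier inversion almost everywhere for integrable functions. -/
theorem ae_fourier_fourierInv_eq {V : Type*} [NormedAddCommGroup V] [InnerProductSpace ℝ V]
    [MeasurableSpace V] [BorelSpace V] [FiniteDimensional ℝ V] {W : V → ℂ} (hW : Integrable W)
    (hh : Integrable (𝓕⁻ W)) : ∀ᵐ w, 𝓕 (𝓕⁻ W) w = W w := by
  have hL : Continuous fun p : V × V => innerₗ V p.1 p.2 := continuous_inner
  have hflip : ∀ {f g : V → ℂ}, Integrable f → Integrable g →
      ∫ ξ, 𝓕 f ξ * g ξ = ∫ x, f x * 𝓕 g x := by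
    intro f g hf hg
    have h := VectorFourier.integral_fourierIntegral_smul_eq_flip (μ := volume) (ν := volume)
      (L := innerₗ V) Real.continuous_fourierChar hL hf hg
    rw [flip_innerₗ] at h
    exact h
  have hcont : Continuous (𝓕 (𝓕⁻ W)) :=
    VectorFourier.fourierIntegral_continuous Real.continuous_fourierChar hL hh
  refine ae_eq_of_integral_contDiff_smul_eq hcont.locallyIntegrable hW.locallyIntegrable
    fun g hg hgs => ?_
  have hs : HasCompactSupport fun x => (g x : ℂ) := hgs.comp_left (g := ofReal) ofReal_zero
  set G : SchwartzMap V ℂ := hs.toSchwartzMap (ofRealCLM.contDiff.comp hg) with hG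
  have hGx : ∀ x, G x = (g x : ℂ) := fun x => rfl
  have h1 : ∫ x, g x • 𝓕 (𝓕⁻ W) x = ∫ x, 𝓕 (𝓕⁻ W) x * G x := by
    refine integral_congr_ae (.of_forall fun x => ?_)
    simp [hGx, mul_comm]
  have h2 : ∫ x, g x • W x = ∫ x, W x * G x := by
    refine integral_congr_ae (.of_forall fun x => ?_)
    simp [hGx, mul_comm]
  rw [h1, h2, hflip hh G.integrable, ← integral_neg_eq_self]
  have h3 : ∀ x, 𝓕⁻ W (-x) * 𝓕 (G : V → ℂ) (-x) = 𝓕 W x * (𝓕⁻ G : SchwartzMap V ℂ) x := by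
    intro x
    rw [Real.fourierInv_eq_fourier_neg, neg_neg, SchwartzMap.fourierInv_coe,
      Real.fourierInv_eq_fourier_neg]
  rw [integral_congr_ae (.of_forall h3), hflip hW (𝓕⁻ G : SchwartzMap V ℂ).integrable,
    ← SchwartzMap.fourier_coe, FourierTransform.fourier_fourierInv_eq]

/-- The unnormalized inverse space–time Fourier transform. -/
def invST (W : SpaceTime → ℂ) (p : SpaceTime) : ℂ :=
  ∫ a : SpaceTime, Complex.exp (Complex.I * ((p.1 * a.1 + ⟪p.2, a.2⟫ : ℝ) : ℂ)) * W a

/-- Space-time with its Euclidean structure. -/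
abbrev SpaceTimeL2 : Type := WithLp 2 (ℝ × E2)

/-- The linear identification of the two models of space-time. -/
def toL2 : SpaceTime ≃L[ℝ] SpaceTimeL2 := (WithLp.prodContinuousLinearEquiv 2 ℝ ℝ E2).symm

theorem integral_toL2 (f : SpaceTimeL2 → ℂ) : ∫ a : SpaceTime, f (toL2 a) = ∫ x, f x :=
  (WithLp.volume_preserving_symm_measurableEquiv_toLp_prod ℝ E2).symm.integral_comp'
    (f := MeasurableEquiv.toLp 2 (ℝ × E2)) f

theorem inner_toL2 (p a : SpaceTime) :
    ⟪toL2 p, toL2 a⟫ = p.1 * a.1 + ⟪p.2, a.2⟫ := by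
  rw [WithLp.prod_inner_apply]
  simp [toL2, mul_comm]

open scoped FourierTransform in
theorem ftST_eq_fourier (f : SpaceTime → ℂ) (a : SpaceTime) :
    ftST f a.1 a.2 = 𝓕 (f ∘ toL2.symm) ((2 * Real.pi)⁻¹ • toL2 a) := by
  rw [Real.fourier_eq', ← integral_toL2]
  unfold ftST
  refine integral_congr_ae (.of_forall fun p => ?_)
  have hpi := Real.pi_pos.ne'
  simp only [Function.comp_apply, ContinuousLinearEquiv.symm_apply_apply, inner_smul_right,
    inner_toL2, smul_eq_mul]
  congr 2
  push_cast
  field_simp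

open scoped FourierTransform in
theorem invST_eq_fourierInv (f : SpaceTime → ℂ) (a : SpaceTime) :
    invST f a = 𝓕⁻ (f ∘ toL2.symm) ((2 * Real.pi)⁻¹ • toL2 a) := by
  rw [Real.fourierInv_eq', ← integral_toL2]
  unfold invST
  refine integral_congr_ae (.of_forall fun p => ?_)
  have hpi := Real.pi_pos.ne'
  simp only [Function.comp_apply, ContinuousLinearEquiv.symm_apply_apply, inner_smul_right,
    inner_toL2, smul_eq_mul]
  congr 2
  rw [real_inner_comm, mul_comm a.1]
  push_cast
  field_simp

open scoped FourierTransform in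
theorem exists_schwartz_ftST (ψ : SchwartzMap SpaceTime ℂ) :
    ∃ Ψ : SchwartzMap SpaceTime ℂ, ∀ τ ξ, ftST (fun q => ψ q) τ ξ = Ψ (τ, ξ) := by
  have hpi : (2 * Real.pi)⁻¹ ≠ 0 := by have := Real.pi_pos; positivity
  set g : SchwartzMap SpaceTimeL2 ℂ :=
    𝓕 (SchwartzMap.compCLMOfContinuousLinearEquiv ℂ toL2.symm ψ) with hg
  refine ⟨SchwartzMap.compCLMOfContinuousLinearEquiv ℂ
    (toL2.trans (ContinuousLinearEquiv.smulLeft (Units.mk0 _ hpi))) g, fun τ ξ => ?_⟩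
  rw [ftST_eq_fourier (fun q => ψ q) (τ, ξ)]
  rfl

open scoped FourierTransform in
/-- The Fourier transform of the inverse transform is controlled by the original function. -/
theorem norm_ftST_invST_le {W : SpaceTime → ℂ} (hW : Integrable W) :
    ∀ᵐ a : SpaceTime, ‖ftST (invST W) a.1 a.2‖ ≤
      |(2 * Real.pi) ^ Module.finrank ℝ SpaceTimeL2| * ‖W a‖ := by
  have hpi : (2 * Real.pi) ≠ 0 := by have := Real.pi_pos; positivity
  set U : SpaceTimeL2 → ℂ := W ∘ toL2.symm with hU
  have hmp : MeasurePreserving (toL2 : SpaceTime → SpaceTimeL2) :=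
    WithLp.volume_preserving_toLp ℝ E2
  have hUi : Integrable U :=
    (WithLp.volume_preserving_ofLp ℝ E2).integrable_comp_of_integrable hW
  have hft : ∀ a : SpaceTime, ftST (invST W) a.1 a.2 =
      |(2 * Real.pi) ^ Module.finrank ℝ SpaceTimeL2| • 𝓕 (𝓕⁻ U) (toL2 a) := by
    intro a
    have e : invST W ∘ toL2.symm = fun x => 𝓕⁻ U ((2 * Real.pi)⁻¹ • x) := by
      funext x
      simp [invST_eq_fourierInv, hU]
    rw [ftST_eq_fourier, e, Real.fourier_eq', Real.fourier_eq']
    rw [← Measure.integral_comp_inv_smul]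
    refine integral_congr_ae (.of_forall fun x => ?_)
    simp only [inner_smul_left, inner_smul_right]
    rfl
  by_cases hh : Integrable (𝓕⁻ U)
  · filter_upwards [hmp.quasiMeasurePreserving.ae (ae_fourier_fourierInv_eq hUi hh)] with a ha
    rw [hft, ha, norm_smul, Real.norm_eq_abs, abs_abs]
    simp [hU]
  · refine .of_forall fun a => ?_
    have h0 : 𝓕 (𝓕⁻ U) (toL2 a) = 0 := by
      rw [Real.fourier_eq]
      exact integral_undef fun h => hh ((Real.fourierIntegral_convergent_iff _).1 h)
    rw [hft, h0]
    simp only [smul_zero, norm_zero]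
    positivity

instance : (volume : Measure SpaceTime).HasTemperateGrowth :=
  inferInstanceAs ((volume : Measure ℝ).prod (volume : Measure E2)).HasTemperateGrowth

/-- The correlation of two functions. -/
def corrST (u v : SpaceTime → ℂ) (a : SpaceTime) : ℂ :=
  ∫ b : SpaceTime, (starRingEnd ℂ) (u b) * v (a + b)

theorem integrable_conj_mul_shear {u v : SpaceTime → ℂ} (hu : Integrable u) (hv : Integrable v) :
    Integrable fun z : SpaceTime × SpaceTime => (starRingEnd ℂ) (u z.2) * v (z.1 + z.2) := by
  have hu' : Integrable fun b => (starRingEnd ℂ) (u b) := by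
    have h := (integrable_norm_iff
      ((continuous_star.comp_aestronglyMeasurable hu.1 :
        AEStronglyMeasurable (fun b => (starRingEnd ℂ) (u b)) volume))).1
      (by simpa using hu.norm)
    exact h
  have h := hu'.mul_prod hv
  have hmp : MeasurePreserving (fun z : SpaceTime × SpaceTime => (z.1, z.1 + z.2))
      (volume.prod volume) (volume.prod volume) :=
    measurePreserving_prod_add volume volume
  have h1 := hmp.integrable_comp_of_integrable h
  have h2 := h1.swap
  refine h2.congr (.of_forall fun z => ?_)
  simp [add_comm]

theorem integrable_corrST {u v : SpaceTime → ℂ} (hu : Integrable u) (hv : Integrable v) :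
    Integrable (corrST u v) :=
  (integrable_conj_mul_shear hu hv).integral_prod_left

/-- The character appearing in `invST`. -/
theorem norm_cexp_char (p a : SpaceTime) :
    ‖Complex.exp (Complex.I * ((p.1 * a.1 + ⟪p.2, a.2⟫ : ℝ) : ℂ))‖ = 1 := by
  rw [mul_comm, Complex.norm_exp_ofReal_mul_I]

theorem integrable_char_mul {W : SpaceTime → ℂ} (hW : Integrable W) (p : SpaceTime) :
    Integrable fun a : SpaceTime =>
      Complex.exp (Complex.I * ((p.1 * a.1 + ⟪p.2, a.2⟫ : ℝ) : ℂ)) * W a := by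
  refine hW.bdd_mul (c := 1) ?_ (.of_forall fun a => (norm_cexp_char p a).le)
  exact (by fun_prop : Continuous fun a : SpaceTime =>
    Complex.exp (Complex.I * ((p.1 * a.1 + ⟪p.2, a.2⟫ : ℝ) : ℂ))).aestronglyMeasurable

theorem conj_invST_mul_invST {u v : SpaceTime → ℂ} (hu : Integrable u) (hv : Integrable v)
    (p : SpaceTime) :
    (starRingEnd ℂ) (invST u p) * invST v p = invST (corrST u v) p := by
  set e : SpaceTime → ℂ := fun a =>
    Complex.exp (Complex.I * ((p.1 * a.1 + ⟪p.2, a.2⟫ : ℝ) : ℂ)) with he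
  have hadd : ∀ a b, e (a + b) = e a * e b := by
    intro a b
    simp only [he, ← Complex.exp_add, Prod.fst_add, Prod.snd_add, inner_add_right]
    congr 1; push_cast; ring
  have hconj : ∀ b, (starRingEnd ℂ) (e b) * e b = 1 := by
    intro b
    rw [← normSq_eq_conj_mul_self, normSq_eq_norm_sq, he]
    simp only [norm_cexp_char]
    norm_num
  have hprod := integrable_conj_mul_shear (integrable_char_mul hu p) (integrable_char_mul hv p)
  have hR : invST (corrST u v) p = ∫ a, ∫ b, (starRingEnd ℂ) (e b * u b) * (e (a + b) * v (a + b)) := by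
    unfold invST corrST
    refine integral_congr_ae (.of_forall fun a => ?_)
    simp only
    rw [← integral_const_mul]
    refine integral_congr_ae (.of_forall fun b => ?_)
    simp only
    change e a * _ = _
    rw [hadd, map_mul]
    linear_combination (-(e a) * (starRingEnd ℂ) (u b) * v (a + b)) * hconj b
  rw [hR, integral_integral_swap hprod]
  have hI : ∀ b, ∫ a, (starRingEnd ℂ) (e b * u b) * (e (a + b) * v (a + b)) =
      (starRingEnd ℂ) (e b * u b) * invST v p := by
    intro b
    rw [integral_const_mul]
    congr 1
    exact integral_add_right_eq_self (fun a => e a * v a) b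
  rw [integral_congr_ae (.of_forall hI), integral_mul_const, integral_conj]
  rfl

theorem measurable_dirC (s : ℝ) : Measurable (dirC s) := by
  unfold dirC
  fun_prop

theorem measurable_diracProj_mulVec (s : ℝ) {Ψ : Fin 2 → SpaceTime → ℂ}
    (hΨ : ∀ j, Measurable (Ψ j)) (i : Fin 2) :
    Measurable fun a : SpaceTime => (diracProj s a.2).mulVec (fun j => Ψ j a) i := by
  have hd : Measurable fun a : SpaceTime => dirC s a.2 := (measurable_dirC s).comp measurable_snd
  have hc : Measurable fun a : SpaceTime => (starRingEnd ℂ) (dirC s a.2) :=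
    continuous_star.measurable.comp hd
  have h0 := hΨ 0
  have h1 := hΨ 1
  fin_cases i
  · simp only [Fin.zero_eta, diracProj_mulVec_zero]
    fun_prop
  · simp only [Fin.mk_one, diracProj_mulVec_one]
    fun_prop

theorem norm_diracProj_mulVec_le {s : ℝ} (hs : s = 1 ∨ s = -1) (ξ : E2) (z : Fin 2 → ℂ)
    (i : Fin 2) : ‖(diracProj s ξ).mulVec z i‖ ≤ ‖z 0‖ + ‖z 1‖ := by
  have hd := norm_dirC_le hs ξ
  have h2 : ‖(1 / 2 : ℂ)‖ = 1 / 2 := by norm_num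
  have a0 := norm_nonneg (z 0)
  have a1 := norm_nonneg (z 1)
  fin_cases i
  · simp only [Fin.zero_eta, diracProj_mulVec_zero, norm_mul, h2]
    have h := norm_add_le (z 0) ((starRingEnd ℂ) (dirC s ξ) * z 1)
    rw [norm_mul, RCLike.norm_conj] at h
    nlinarith [mul_le_mul_of_nonneg_right hd a1]
  · simp only [Fin.mk_one, diracProj_mulVec_one, norm_mul, h2]
    have h := norm_add_le (dirC s ξ * z 0) (z 1)
    rw [norm_mul] at h
    nlinarith [mul_le_mul_of_nonneg_right hd a0]

theorem integrable_diracProj_mulVec {s : ℝ} (hs : s = 1 ∨ s = -1)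
    (Ψ : Fin 2 → SchwartzMap SpaceTime ℂ) (i : Fin 2) :
    Integrable fun a : SpaceTime => (diracProj s a.2).mulVec (fun j => Ψ j a) i := by
  refine ((Ψ 0).integrable.norm.add (Ψ 1).integrable.norm).mono'
    (measurable_diracProj_mulVec s (fun j => (Ψ j).continuous.measurable) i).aestronglyMeasurable
    (.of_forall fun a => norm_diracProj_mulVec_le hs a.2 _ i)

theorem exists_schwartz_ftST_comp (ψ : SchwartzMap SpaceTime C2) :
    ∃ Ψ : Fin 2 → SchwartzMap SpaceTime ℂ,
      ∀ j τ ξ, ftST (fun q => ψ q j) τ ξ = Ψ j (τ, ξ) := by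
  choose Ψ hΨ using fun j : Fin 2 => exists_schwartz_ftST
    (SchwartzMap.postcompCLM (EuclideanSpace.proj j : C2 →L[ℂ] ℂ) ψ)
  exact ⟨Ψ, fun j τ ξ => hΨ j τ ξ⟩

theorem diracProjD_eq {s : ℝ} (hs : s = 1 ∨ s = -1) {ψ : SpaceTime → C2}
    {Ψ : Fin 2 → SchwartzMap SpaceTime ℂ}
    (hΨ : ∀ j τ ξ, ftST (fun q => ψ q j) τ ξ = Ψ j (τ, ξ)) (p : SpaceTime) (i : Fin 2) :
    diracProjD s ψ p i = (((2 * Real.pi) ^ (-3 : ℝ) : ℝ) : ℂ) *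
      invST (fun a => (diracProj s a.2).mulVec (fun j => Ψ j a) i) p := by
  unfold diracProjD invST
  simp only [hΨ]
  rw [real_smul]
  congr 1
  exact (integral_prod _ (integrable_char_mul (integrable_diracProj_mulVec hs Ψ i) p)).symm

theorem invST_const_mul (c : ℂ) (u : SpaceTime → ℂ) (p : SpaceTime) :
    invST (fun a => c * u a) p = c * invST u p := by
  unfold invST
  rw [← integral_const_mul]
  refine integral_congr_ae (.of_forall fun a => ?_)
  simp only
  ring

theorem invST_sub {u v : SpaceTime → ℂ} (hu : Integrable u) (hv : Integrable v) (p : SpaceTime) :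
    invST (fun a => u a - v a) p = invST u p - invST v p := by
  unfold invST
  rw [← integral_sub (integrable_char_mul hu p) (integrable_char_mul hv p)]
  simp only [mul_sub]

/-- The Fourier side of the null form. -/
theorem exists_nullForm_eq_invST {s₁ s₂ : ℝ} (h1 : s₁ = 1 ∨ s₁ = -1) (h2 : s₂ = 1 ∨ s₂ = -1)
    {ψ ψ' : SpaceTime → C2} {Ψ Ψ' : Fin 2 → SchwartzMap SpaceTime ℂ}
    (hΨ : ∀ j τ ξ, ftST (fun q => ψ q j) τ ξ = Ψ j (τ, ξ))
    (hΨ' : ∀ j τ ξ, ftST (fun q => ψ' q j) τ ξ = Ψ' j (τ, ξ)) :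
    ∃ W : SpaceTime → ℂ, Integrable W ∧ nullForm s₁ s₂ ψ ψ' = invST W ∧
      ∀ᵐ a : SpaceTime, W a = (((2 * Real.pi) ^ (-3 : ℝ) : ℝ) : ℂ) ^ 2 *
        ∫ b : SpaceTime, nullSymbol s₁ s₂ b.2 (a.2 + b.2) (fun j => Ψ j b)
          (fun j => Ψ' j (a + b)) := by
  set c : ℂ := (((2 * Real.pi) ^ (-3 : ℝ) : ℝ) : ℂ) with hc
  have hcc : (starRingEnd ℂ) c = c := conj_ofReal _
  set u : Fin 2 → SpaceTime → ℂ := fun i a => (diracProj s₁ a.2).mulVec (fun j => Ψ j a) i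
    with hu
  set v : Fin 2 → SpaceTime → ℂ := fun i a => (diracProj s₂ a.2).mulVec (fun j => Ψ' j a) i
    with hv
  have hui : ∀ i, Integrable (u i) := integrable_diracProj_mulVec h1 Ψ
  have hvi : ∀ i, Integrable (v i) := integrable_diracProj_mulVec h2 Ψ'
  have hw := fun i => integrable_corrST (hui i) (hvi i)
  refine ⟨fun a => c ^ 2 * (corrST (u 0) (v 0) a - corrST (u 1) (v 1) a),
    ((hw 0).sub (hw 1)).const_mul _, ?_, ?_⟩
  · funext p
    rw [invST_const_mul, invST_sub (hw 0) (hw 1), ← conj_invST_mul_invST (hui 0) (hvi 0),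
      ← conj_invST_mul_invST (hui 1) (hvi 1)]
    unfold nullForm
    rw [Fin.sum_univ_two, betaM_mulVec_zero, betaM_mulVec_one, diracProjD_eq h1 hΨ,
      diracProjD_eq h1 hΨ, diracProjD_eq h2 hΨ', diracProjD_eq h2 hΨ', map_neg, map_mul, map_mul,
      ← hc, hcc]
    ring
  · have hs := fun i => (integrable_conj_mul_shear (hui i) (hvi i)).prod_right_ae
    filter_upwards [hs 0, hs 1] with a h0 h1'
    congr 1
    unfold corrST
    rw [← integral_sub h0 h1']
    refine integral_congr_ae (.of_forall fun b => ?_)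
    simp only [nullSymbol_eq]
    rfl

theorem measurable_len2 {Ψ : Fin 2 → SchwartzMap SpaceTime ℂ} :
    Measurable fun b : SpaceTime => len2 fun j => Ψ j b := by
  have h : Continuous fun b : SpaceTime => len2 fun j => Ψ j b := by
    unfold len2
    have := fun j => (Ψ j).continuous
    fun_prop
  exact h.measurable

theorem ofReal_sqrt_eq_rpow (x : ℝ) :
    ENNReal.ofReal (Real.sqrt x) = ENNReal.ofReal x ^ (1 / 2 : ℝ) := by
  rcases le_total 0 x with hx | hx
  · rw [Real.sqrt_eq_rpow, ENNReal.ofReal_rpow_of_nonneg hx (by norm_num)]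
  · rw [Real.sqrt_eq_zero_of_nonpos hx, ENNReal.ofReal_of_nonpos hx, ENNReal.ofReal_zero,
      ENNReal.zero_rpow_of_pos (by norm_num)]

/-- The constant relating the transform of the null form to the bilinear convolution. -/
def nullFormConst : ℝ :=
  |(2 * Real.pi) ^ Module.finrank ℝ SpaceTimeL2| * ((2 * Real.pi) ^ (-3 : ℝ)) ^ 2

theorem nullFormConst_pos : 0 < nullFormConst := by
  have := Real.pi_pos
  unfold nullFormConst
  positivity

theorem enorm_ftST_nullForm_le {s₁ s₂ : ℝ} (h1 : s₁ = 1 ∨ s₁ = -1) (h2 : s₂ = 1 ∨ s₂ = -1)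
    {ψ ψ' : SpaceTime → C2} {Ψ Ψ' : Fin 2 → SchwartzMap SpaceTime ℂ}
    (hΨ : ∀ j τ ξ, ftST (fun q => ψ q j) τ ξ = Ψ j (τ, ξ))
    (hΨ' : ∀ j τ ξ, ftST (fun q => ψ' q j) τ ξ = Ψ' j (τ, ξ)) :
    ∀ᵐ a : SpaceTime, ‖ftST (nullForm s₁ s₂ ψ ψ') a.1 a.2‖ₑ ≤
      ENNReal.ofReal nullFormConst * (ENNReal.ofReal (Real.sqrt ‖a.2‖) *
        bilinConv (nullWeight (s₁ * -s₂)) (fun b => ENNReal.ofReal (len2 fun j => Ψ j b))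
          (fun b => ENNReal.ofReal (len2 fun j => Ψ' j b)) a) := by
  obtain ⟨W, hW, hN, hWe⟩ := exists_nullForm_eq_invST h1 h2 hΨ hΨ'
  rw [hN]
  filter_upwards [norm_ftST_invST_le hW, hWe, ae_snd_ne_zero] with a ha hWa ha0
  have hpt : ‖∫ b : SpaceTime, nullSymbol s₁ s₂ b.2 (a.2 + b.2) (fun j => Ψ j b)
      (fun j => Ψ' j (a + b))‖ₑ ≤ ENNReal.ofReal (Real.sqrt ‖a.2‖) *
        bilinConv (nullWeight (s₁ * -s₂)) (fun b => ENNReal.ofReal (len2 fun j => Ψ j b))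
          (fun b => ENNReal.ofReal (len2 fun j => Ψ' j b)) a := by
    refine (enorm_integral_le_lintegral_enorm _).trans ?_
    unfold bilinConv
    rw [← lintegral_const_mul' _ _ ENNReal.ofReal_ne_top]
    have hshift : ∀ᵐ b : SpaceTime, (a + b).2 ≠ 0 :=
      (measurePreserving_add_left volume a).quasiMeasurePreserving.ae ae_snd_ne_zero
    refine lintegral_mono_ae ?_
    filter_upwards [ae_snd_ne_zero, hshift] with b hb hab
    have hr0 : 0 < ‖a.2‖ := norm_pos_iff.2 ha0
    have hsym := norm_nullSymbol_le h1 h2 hb hab (fun j => Ψ j b) (fun j => Ψ' j (a + b))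
    rw [Prod.snd_add, add_sub_cancel_right] at hsym
    have hX : |‖a.2‖ ^ 2 - (‖b.2‖ + s₁ * -s₂ * ‖a.2 + b.2‖) ^ 2| / (‖b.2‖ * ‖a.2 + b.2‖) =
        ‖a.2‖ * (|‖a.2‖ ^ 2 - (‖b.2‖ + s₁ * -s₂ * ‖a.2 + b.2‖) ^ 2| /
          (‖a.2‖ * ‖b.2‖ * ‖a.2 + b.2‖)) := by
      field_simp
    rw [hX, Real.sqrt_mul hr0.le] at hsym
    rw [← ofReal_norm]
    refine (ENNReal.ofReal_le_ofReal hsym).trans_eq ?_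
    unfold nullWeight
    rw [← ofReal_sqrt_eq_rpow, ENNReal.ofReal_mul (by positivity),
      ENNReal.ofReal_mul (Real.sqrt_nonneg _), ENNReal.ofReal_mul (p := len2 _) (Real.sqrt_nonneg _),
      mul_assoc]
  rw [← ofReal_norm]
  refine (ENNReal.ofReal_le_ofReal ha).trans ?_
  rw [hWa, norm_mul, norm_pow, ← mul_assoc, ENNReal.ofReal_mul (by positivity),
    ofReal_norm, norm_real, Real.norm_eq_abs, sq_abs]
  exact mul_le_mul' le_rfl hpt

theorem ofReal_l2F_le {g : ℝ → E2 → ℂ} {H : SpaceTime → ENNReal} (hH : Measurable H)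
    (hg : ∀ᵐ a : SpaceTime, ‖g a.1 a.2‖ₑ ≤ H a) : ENNReal.ofReal (l2F g) ≤ nrm H := by
  unfold l2F nrm
  rw [ofReal_sqrt_eq_rpow]
  refine ENNReal.rpow_le_rpow ?_ (by norm_num)
  refine Real.ofReal_le_enorm _ |>.trans ((enorm_integral_le_lintegral_enorm _).trans ?_)
  rw [Measure.volume_eq_prod, lintegral_prod _ (hH.pow_const 2).aemeasurable]
  refine lintegral_mono_ae ?_
  filter_upwards [Measure.ae_ae_of_ae_prod hg] with τ hτ
  refine (enorm_integral_le_lintegral_enorm _).trans (lintegral_mono_ae ?_)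
  filter_upwards [hτ] with ξ hξ
  rw [enorm_pow, enorm_norm]
  exact pow_le_pow_left' hξ 2

theorem nrm_const_mul (c : ENNReal) {f : SpaceTime → ENNReal} (hf : Measurable f) :
    nrm (fun a => c * f a) = c * nrm f := by
  unfold nrm
  simp only [mul_pow]
  rw [lintegral_const_mul _ (hf.pow_const 2), ENNReal.mul_rpow_of_nonneg _ _ (by norm_num),
    ← ENNReal.rpow_natCast, ← ENNReal.rpow_mul]
  norm_num

theorem jap_rpow_mul_sqrt_le (r : ℝ) : jap r ^ (-(1 / 2) : ℝ) * Real.sqrt r ≤ 1 := by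
  have hj : 0 < jap r := Real.sqrt_pos.2 (by positivity)
  have hr : r ≤ jap r := Real.le_sqrt_of_sq_le (by linarith)
  rw [Real.rpow_neg hj.le, ← Real.sqrt_eq_rpow, inv_mul_le_one₀ (Real.sqrt_pos.2 hj)]
  exact Real.sqrt_le_sqrt hr

theorem SchwartzMap.integrable_weight_mul_norm_sq (Ψ : SchwartzMap SpaceTime ℂ) :
    Integrable fun a : SpaceTime => (1 + 2 * ‖a‖) ^ 2 * ‖Ψ a‖ ^ 2 := by
  obtain ⟨C, hC⟩ := Ψ.decay 0 0
  have hC' : ∀ a, ‖Ψ a‖ ≤ C := fun a => by simpa using hC.2 a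
  have h0 := SchwartzMap.integrable_pow_mul volume Ψ 0
  have h2 := SchwartzMap.integrable_pow_mul volume Ψ 2
  have hm : Continuous fun a : SpaceTime => (1 + 2 * ‖a‖) ^ 2 * ‖Ψ a‖ ^ 2 := by
    have := Ψ.continuous
    fun_prop
  refine (((h0.const_mul 2).add (h2.const_mul 8)).const_mul C).mono' hm.aestronglyMeasurable
    (.of_forall fun a => ?_)
  have hn := norm_nonneg (Ψ a)
  rw [Real.norm_of_nonneg (by positivity)]
  simp only [Pi.add_apply, pow_zero, one_mul]
  have k1 : (1 + 2 * ‖a‖) ^ 2 ≤ 2 + 8 * ‖a‖ ^ 2 := by nlinarith [sq_nonneg (1 - 2 * ‖a‖)]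
  have k2 : ‖Ψ a‖ ^ 2 ≤ C * ‖Ψ a‖ := by nlinarith [hC' a]
  calc _ ≤ (2 + 8 * ‖a‖ ^ 2) * (C * ‖Ψ a‖) := by gcongr
    _ = _ := by ring

/-- The density in the definition of `XnormBvec`. -/
def vecDensity (φ : ℝ → ℝ) (s : ℝ) (Ψ : Fin 2 → SchwartzMap SpaceTime ℂ) (k : ℕ)
    (a : SpaceTime) : ℝ :=
  lpPiece φ k (a.1 + s * ‖a.2‖) ^ 2 * ∑ i : Fin 2, ‖Ψ i a‖ ^ 2

/-- A weighted density dominating all the pieces. -/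
def weightDensity (Ψ : Fin 2 → SchwartzMap SpaceTime ℂ) (a : SpaceTime) : ℝ :=
  4 * ∑ i : Fin 2, (1 + 2 * ‖a‖) ^ 2 * ‖Ψ i a‖ ^ 2

theorem integrable_weightDensity (Ψ : Fin 2 → SchwartzMap SpaceTime ℂ) :
    Integrable (weightDensity Ψ) :=
  (integrable_finsetSum _ fun i _ => (Ψ i).integrable_weight_mul_norm_sq).const_mul 4

theorem vecDensity_nonneg (φ : ℝ → ℝ) (s : ℝ) (Ψ : Fin 2 → SchwartzMap SpaceTime ℂ) (k : ℕ)
    (a : SpaceTime) : 0 ≤ vecDensity φ s Ψ k a := by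
  unfold vecDensity
  positivity

theorem IsLPBump.vecDensity_le {φ : ℝ → ℝ} (hφ : IsLPBump φ) {s : ℝ} (hs : s = 1 ∨ s = -1)
    (Ψ : Fin 2 → SchwartzMap SpaceTime ℂ) (k : ℕ) (a : SpaceTime) :
    vecDensity φ s Ψ k a ≤ (((2 : ℝ) ^ k)⁻¹) ^ 2 * weightDensity Ψ a := by
  have hs1 : |s| = 1 := by rcases hs with rfl | rfl <;> norm_num
  have hS : 0 ≤ ∑ i : Fin 2, ‖Ψ i a‖ ^ 2 := by positivity
  have hw : weightDensity Ψ a = (2 * (1 + 2 * ‖a‖)) ^ 2 * ∑ i : Fin 2, ‖Ψ i a‖ ^ 2 := by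
    unfold weightDensity
    rw [← Finset.mul_sum]
    ring
  unfold vecDensity
  rw [hw, ← mul_assoc, ← mul_pow]
  refine mul_le_mul_of_nonneg_right (pow_le_pow_left₀ (hφ.lpPiece_nonneg k _) ?_ 2) hS
  rcases eq_or_ne (lpPiece φ k (a.1 + s * ‖a.2‖)) 0 with h | h
  · rw [h]; positivity
  · refine (hφ.lpPiece_le_one k _).trans ?_
    have h1 := hφ.le_abs_of_lpPiece_ne_zero h
    have h2 : |a.1 + s * ‖a.2‖| ≤ 2 * ‖a‖ := by
      refine (abs_add_le _ _).trans ?_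
      rw [abs_mul, hs1, one_mul, abs_norm]
      have e1 : |a.1| ≤ ‖a‖ := norm_fst_le a
      have e2 : ‖a.2‖ ≤ ‖a‖ := norm_snd_le a
      linarith
    rw [← div_eq_inv_mul, one_le_div (by positivity)]
    linarith

theorem IsLPBump.integrable_vecDensity {φ : ℝ → ℝ} (hφ : IsLPBump φ) {s : ℝ}
    (hs : s = 1 ∨ s = -1) (Ψ : Fin 2 → SchwartzMap SpaceTime ℂ) (k : ℕ) :
    Integrable (vecDensity φ s Ψ k) := by
  have hm : Measurable (vecDensity φ s Ψ k) := by
    have h1 : Measurable fun a : SpaceTime => lpPiece φ k (a.1 + s * ‖a.2‖) :=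
      (hφ.measurable_lpPiece k).comp
        (by fun_prop : Measurable fun a : SpaceTime => a.1 + s * ‖a.2‖)
    have h2 : Continuous fun a : SpaceTime => ∑ i : Fin 2, ‖Ψ i a‖ ^ 2 := by
      have := fun i => (Ψ i).continuous
      fun_prop
    exact (h1.pow_const 2).mul h2.measurable
  refine ((integrable_weightDensity Ψ).const_mul ((((2 : ℝ) ^ k)⁻¹) ^ 2)).mono'
    hm.aestronglyMeasurable (.of_forall fun a => ?_)
  rw [Real.norm_of_nonneg (vecDensity_nonneg ..)]
  exact hφ.vecDensity_le hs Ψ k a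

theorem IsLPBump.nrm_lpPart_eq {φ : ℝ → ℝ} (hφ : IsLPBump φ) {s : ℝ} (hs : s = 1 ∨ s = -1)
    (Ψ : Fin 2 → SchwartzMap SpaceTime ℂ) (k : ℕ) :
    nrm (lpPart φ s k fun b => ENNReal.ofReal (len2 fun j => Ψ j b)) =
      ENNReal.ofReal (Real.sqrt (∫ a, vecDensity φ s Ψ k a)) := by
  rw [ofReal_sqrt_eq_rpow, ofReal_integral_eq_lintegral_ofReal (hφ.integrable_vecDensity hs Ψ k)
    (.of_forall fun a => vecDensity_nonneg ..)]
  unfold nrm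
  congr 1
  refine lintegral_congr fun a => ?_
  unfold lpPart vecDensity len2
  rw [← ENNReal.ofReal_mul (hφ.lpPiece_nonneg k _), ← ENNReal.ofReal_pow
    (mul_nonneg (hφ.lpPiece_nonneg k _) (Real.sqrt_nonneg _)), mul_pow,
    Real.sq_sqrt (by positivity)]

theorem IsLPBump.XnormBvec_eq {φ : ℝ → ℝ} (hφ : IsLPBump φ) {s : ℝ} (hs : s = 1 ∨ s = -1)
    {ψ : SpaceTime → C2} {Ψ : Fin 2 → SchwartzMap SpaceTime ℂ}
    (hΨ : ∀ j τ ξ, ftST (fun q => ψ q j) τ ξ = Ψ j (τ, ξ)) :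
    XnormBvec φ 0 (1 / 3) s ψ =
      ∑' k : ℕ, (2 : ℝ) ^ (1 / 3 * k : ℝ) * Real.sqrt (∫ a, vecDensity φ s Ψ k a) := by
  unfold XnormBvec
  refine tsum_congr fun k => ?_
  simp only [hΨ, Real.rpow_zero, one_mul]
  congr 2
  exact (integral_prod _ (hφ.integrable_vecDensity hs Ψ k)).symm

theorem IsLPBump.summable_XnormBvec {φ : ℝ → ℝ} (hφ : IsLPBump φ) {s : ℝ} (hs : s = 1 ∨ s = -1)
    (Ψ : Fin 2 → SchwartzMap SpaceTime ℂ) :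
    Summable fun k : ℕ =>
      (2 : ℝ) ^ (1 / 3 * k : ℝ) * Real.sqrt (∫ a, vecDensity φ s Ψ k a) := by
  have hr : (2 : ℝ) ^ (1 / 3 : ℝ) * 2⁻¹ < 1 := by
    have : (2 : ℝ) ^ (1 / 3 : ℝ) < 2 ^ (1 : ℝ) :=
      Real.rpow_lt_rpow_of_exponent_lt one_lt_two (by norm_num)
    rw [Real.rpow_one] at this
    linarith
  refine Summable.of_nonneg_of_le (fun k => by positivity) (fun k => ?_)
    ((summable_geometric_of_lt_one (by positivity) hr).mul_right
      (Real.sqrt (∫ a, weightDensity Ψ a)))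
  have h1 : ∫ a, vecDensity φ s Ψ k a ≤ (((2 : ℝ) ^ k)⁻¹) ^ 2 * ∫ a, weightDensity Ψ a := by
    rw [← integral_const_mul]
    exact integral_mono (hφ.integrable_vecDensity hs Ψ k)
      ((integrable_weightDensity Ψ).const_mul _) (hφ.vecDensity_le hs Ψ k)
  have h2 := Real.sqrt_le_sqrt h1
  rw [Real.sqrt_mul (by positivity), Real.sqrt_sq (by positivity)] at h2
  rw [Real.rpow_mul two_pos.le, Real.rpow_natCast, mul_pow, inv_pow, mul_assoc]
  gcongr

theorem XnormBvec_nonneg (φ : ℝ → ℝ) (a b s : ℝ) (ψ : SpaceTime → C2) :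
    0 ≤ XnormBvec φ a b s ψ :=
  tsum_nonneg fun k => by positivity

theorem IsLPBump.tsum_dyadicRoot_nrm_lpPart {φ : ℝ → ℝ} (hφ : IsLPBump φ) {s : ℝ}
    (hs : s = 1 ∨ s = -1) {ψ : SpaceTime → C2} {Ψ : Fin 2 → SchwartzMap SpaceTime ℂ}
    (hΨ : ∀ j τ ξ, ftST (fun q => ψ q j) τ ξ = Ψ j (τ, ξ)) :
    ∑' k, ENNReal.ofReal (dyadicRoot k) *
        nrm (lpPart φ s k fun b => ENNReal.ofReal (len2 fun j => Ψ j b)) =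
      ENNReal.ofReal ((2 : ℝ) ^ (1 / 3 : ℝ) * XnormBvec φ 0 (1 / 3) s ψ) := by
  rw [hφ.XnormBvec_eq hs hΨ, ← tsum_mul_left, ENNReal.ofReal_tsum_of_nonneg
    (fun k => by positivity) ((hφ.summable_XnormBvec hs Ψ).mul_left _)]
  refine tsum_congr fun k => ?_
  rw [hφ.nrm_lpPart_eq hs, dyadicRoot_eq, ← ENNReal.ofReal_mul (by positivity), mul_assoc]

theorem IsLPBump.l2F_nullForm_le {φ : ℝ → ℝ} (hφ : IsLPBump φ) {s₁ s₂ s₃ : ℝ}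
    (h1 : s₁ = 1 ∨ s₁ = -1) (h2 : s₂ = 1 ∨ s₂ = -1) (h3 : s₃ = 1 ∨ s₃ = -1)
    (ψ ψ' : SchwartzMap SpaceTime C2) (k : ℕ) :
    (l2F fun τ ξ => ((jap ‖ξ‖ ^ (-(1 / 2) : ℝ) * lpPiece φ k (τ + s₃ * ‖ξ‖) : ℝ) : ℂ) *
        ftST (nullForm s₁ s₂ (fun p => ψ p) (fun p => ψ' p)) τ ξ) ≤
      nullFormConst * (2 * Real.sqrt (2 * weightConst) * dyadicRoot k *
        ((2 : ℝ) ^ (1 / 3 : ℝ) * XnormBvec φ 0 (1 / 3) s₁ (fun p => ψ p) *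
          ((2 : ℝ) ^ (1 / 3 : ℝ) * XnormBvec φ 0 (1 / 3) s₂ (fun p => ψ' p)))) := by
  obtain ⟨Ψ, hΨ⟩ := exists_schwartz_ftST_comp ψ
  obtain ⟨Ψ', hΨ'⟩ := exists_schwartz_ftST_comp ψ'
  have hX := XnormBvec_nonneg φ 0 (1 / 3) s₁ fun p => ψ p
  have hX' := XnormBvec_nonneg φ 0 (1 / 3) s₂ fun p => ψ' p
  have hK := nullFormConst_pos
  have hd := dyadicRoot_pos k
  rw [← ENNReal.ofReal_le_ofReal_iff (by positivity), ENNReal.ofReal_mul hK.le,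
    ENNReal.ofReal_mul (by positivity), ENNReal.ofReal_mul (p := _ * XnormBvec _ _ _ _ _)
    (by positivity), ← hφ.tsum_dyadicRoot_nrm_lpPart h1 hΨ,
    ← hφ.tsum_dyadicRoot_nrm_lpPart h2 hΨ']
  set F : SpaceTime → ENNReal := fun b => ENNReal.ofReal (len2 fun j => Ψ j b) with hF
  set G : SpaceTime → ENNReal := fun b => ENNReal.ofReal (len2 fun j => Ψ' j b) with hG
  have hFm : Measurable F := measurable_len2.ennreal_ofReal
  have hGm : Measurable G := measurable_len2.ennreal_ofReal
  have hBm := hφ.measurable_lpPart s₃ k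
    (measurable_bilinConv (measWeight_nullWeight (s₁ * -s₂)) hFm hGm)
  refine le_trans ?_ (mul_le_mul' le_rfl (hφ.nrm_lpPart_bilinConv_le h1 h2 h3 hFm hGm k))
  rw [← nrm_const_mul _ hBm]
  refine ofReal_l2F_le (hBm.const_mul _) ?_
  filter_upwards [enorm_ftST_nullForm_le h1 h2 hΨ hΨ'] with a ha
  have hj : 0 ≤ jap ‖a.2‖ ^ (-(1 / 2) : ℝ) := Real.rpow_nonneg (Real.sqrt_nonneg _) _
  have hl := hφ.lpPiece_nonneg k (a.1 + s₃ * ‖a.2‖)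
  rw [enorm_mul, ← ofReal_norm (ofReal _), norm_real,
    Real.norm_of_nonneg (mul_nonneg hj hl), ENNReal.ofReal_mul hj]
  refine (mul_le_mul' le_rfl ha).trans ?_
  have hone : ENNReal.ofReal (jap ‖a.2‖ ^ (-(1 / 2) : ℝ)) * ENNReal.ofReal (Real.sqrt ‖a.2‖) ≤ 1 := by
    rw [← ENNReal.ofReal_mul hj]
    exact ENNReal.ofReal_le_one.2 (jap_rpow_mul_sqrt_le _)
  unfold lpPart
  calc _ = ENNReal.ofReal (jap ‖a.2‖ ^ (-(1 / 2) : ℝ)) * ENNReal.ofReal (Real.sqrt ‖a.2‖) *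
        (ENNReal.ofReal nullFormConst * (ENNReal.ofReal (lpPiece φ k (a.1 + s₃ * ‖a.2‖)) *
          bilinConv (nullWeight (s₁ * -s₂)) F G a)) := by ring
    _ ≤ _ := mul_le_of_le_one_left' hone

/-- Null-form bilinear estimate:
    ‖⟨β Π_{s₁}(D)ψ, Π_{s₂}(D)ψ′⟩‖_{X^{−1/2,−1/3,∞}_{s₃}} ≤
    c ‖ψ‖_{X^{0,1/3,1}_{s₁}} ‖ψ′‖_{X^{0,1/3,1}_{s₂}}. -/
theorem nullform_bilinear_estimate :
    ∀ φ : ℝ → ℝ, IsLPBump φ →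
      ∃ c : ℝ, 0 < c ∧
        ∀ s₁ s₂ s₃ : ℝ, (s₁ = 1 ∨ s₁ = -1) → (s₂ = 1 ∨ s₂ = -1) → (s₃ = 1 ∨ s₃ = -1) →
          ∀ ψ ψ' : SchwartzMap SpaceTime C2,
            XnormBinf φ (-(1 / 2)) (-(1 / 3)) s₃ (nullForm s₁ s₂ (fun p => ψ p) (fun p => ψ' p)) ≤
              c * XnormBvec φ 0 (1 / 3) s₁ (fun p => ψ p) *
                XnormBvec φ 0 (1 / 3) s₂ (fun p => ψ' p) := by
  intro φ hφ
  have hK := nullFormConst_pos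
  refine ⟨nullFormConst * (2 * Real.sqrt (2 * weightConst)) * ((2 : ℝ) ^ (1 / 3 : ℝ)) ^ 3 + 1,
    by positivity, fun s₁ s₂ s₃ h1 h2 h3 ψ ψ' => ciSup_le fun k => ?_⟩
  have hX := XnormBvec_nonneg φ 0 (1 / 3) s₁ fun p => ψ p
  have hX' := XnormBvec_nonneg φ 0 (1 / 3) s₂ fun p => ψ' p
  have hroot : (2 : ℝ) ^ (-(1 / 3) * k : ℝ) * dyadicRoot k = (2 : ℝ) ^ (1 / 3 : ℝ) := by
    rw [dyadicRoot_eq, mul_left_comm, ← Real.rpow_add two_pos]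
    simp
  refine (mul_le_mul_of_nonneg_left (hφ.l2F_nullForm_le h1 h2 h3 ψ ψ' k) (by positivity)).trans ?_
  calc
    _ = nullFormConst * (2 * Real.sqrt (2 * weightConst)) *
        (((2 : ℝ) ^ (-(1 / 3) * k : ℝ) * dyadicRoot k) * ((2 : ℝ) ^ (1 / 3 : ℝ)) ^ 2) *
        (XnormBvec φ 0 (1 / 3) s₁ (fun p => ψ p) * XnormBvec φ 0 (1 / 3) s₂ fun p => ψ' p) := by
      ring
    _ ≤ _ := by
      rw [hroot]
      nlinarith [mul_nonneg hX hX']
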